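/- arXiv:1808.08231 — 2 statements merged into one kernel-verified Lean document; each statement's English description precedes it below -/
import Mathlib

section
/- Concavity of conditional entropy along the heat semigroup (quantum conditioning): Let X be a random variable with values in ℝⁿ correlated with a finite-dimensional quantum system M, with E‖X‖² finite, with the map x ↦ ρ(x) (the state of M conditioned on X = x) continuous in trace norm, and with S(X|M) finite. Let Z be a standard Gaussian random variable on ℝⁿ independent of (X, M). Then the function t ↦ I(X + √t Z : Z | M) = S(X + √t Z | M) − S(X|M) is concave on [0, ∞). -/
open MeasureTheory Real Filter Topology
open scoped ComplexOrder

noncomputable section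

/-- `ℝⁿ`. -/
abbrev En (n : ℕ) := EuclideanSpace ℝ (Fin n)

/-- The density of the standard Gaussian probability measure on `ℝⁿ`. -/
def gaussDensity (n : ℕ) (z : En n) : ℝ :=
  (2 * π) ^ (-(n : ℝ) / 2) * Real.exp (-‖z‖ ^ 2 / 2)

/-- A state of a finite-dimensional quantum system: a positive semidefinite matrix
with unit trace. -/
def IsState {ι : Type*} [Fintype ι] [DecidableEq ι] (ρ : Matrix ι ι ℂ) : Prop :=
  ρ.PosSemidef ∧ ρ.trace = 1

open scoped Classical in
/-- The von Neumann entropy `S(ρ) = -Σᵢ λᵢ ln λᵢ` of a (Hermitian) matrix, the sum running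
over its eigenvalues (with the convention `0 ln 0 = 0`; junk value `0` on
non-Hermitian matrices). -/
def vnEnt {ι : Type*} [Fintype ι] [DecidableEq ι] (ρ : Matrix ι ι ℂ) : ℝ :=
  if h : ρ.IsHermitian then -∑ i, h.eigenvalues i * Real.log (h.eigenvalues i) else 0

/-- The classical (differential or discrete) entropy `S = -∫ p ln p` of a density `p`. -/
def clEnt {α : Type*} [MeasureSpace α] (p : α → ℝ) : ℝ := -∫ a, p a * Real.log (p a)

/-- The average state `∫ p(a) ρ(a) da` of a classical-quantum state. -/
def avgState {α : Type*} [MeasureSpace α] {d : ℕ} (p : α → ℝ)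
    (ρ : α → Matrix (Fin d) (Fin d) ℂ) : Matrix (Fin d) (Fin d) ℂ :=
  Matrix.of fun i j => ∫ a, (p a : ℂ) * ρ a i j

/-- The conditional entropy `S(A|M) = S(M|A) + S(A) - S(M)` of the classical system `A`
of a classical-quantum state `(p, ρ)` given the quantum system `M`. -/
def condEnt {α : Type*} [MeasureSpace α] {d : ℕ} (p : α → ℝ)
    (ρ : α → Matrix (Fin d) (Fin d) ℂ) : ℝ :=
  (∫ a, p a * vnEnt (ρ a)) + clEnt p - vnEnt (avgState p ρ)

/-- The integrability conditions expressing that the conditional entropy `S(A|M)` of the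
classical-quantum state `(p, ρ)` is finite. -/
def EntFinite {α : Type*} [MeasureSpace α] {d : ℕ} (p : α → ℝ)
    (ρ : α → Matrix (Fin d) (Fin d) ℂ) : Prop :=
  Integrable (fun a => p a * Real.log (p a)) ∧ Integrable (fun a => p a * vnEnt (ρ a))

/-- The marginal density of the first variable of a joint density on `ℝⁿ × ℝⁿ`. -/
def margFst {n : ℕ} (p : En n × En n → ℝ) : En n → ℝ := fun x => ∫ y, p (x, y)

/-- The state of `M` conditioned on the first classical variable:
`ρ_X(x) = (∫ p(x,y) ρ(x,y) dy) / p_X(x)`. -/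
def margFstState {n d : ℕ} (p : En n × En n → ℝ)
    (ρ : En n × En n → Matrix (Fin d) (Fin d) ℂ) : En n → Matrix (Fin d) (Fin d) ℂ :=
  fun x => ((margFst p x : ℂ))⁻¹ • Matrix.of fun i j => ∫ y, (p (x, y) : ℂ) * ρ (x, y) i j

/-- The marginal density of the second variable of a joint density on `ℝⁿ × ℝⁿ`. -/
def margSnd {n : ℕ} (p : En n × En n → ℝ) : En n → ℝ := fun y => ∫ x, p (x, y)

/-- The state of `M` conditioned on the second classical variable. -/
def margSndState {n d : ℕ} (p : En n × En n → ℝ)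
    (ρ : En n × En n → Matrix (Fin d) (Fin d) ℂ) : En n → Matrix (Fin d) (Fin d) ℂ :=
  fun y => ((margSnd p y : ℂ))⁻¹ • Matrix.of fun i j => ∫ x, (p (x, y) : ℂ) * ρ (x, y) i j

/-- The density of the sum `X + Y`: `p_S(s) = ∫ p(x, s - x) dx`. -/
def sumDensity {n : ℕ} (p : En n × En n → ℝ) : En n → ℝ := fun s => ∫ x, p (x, s - x)

/-- The state of `M` conditioned on `X + Y = s`. -/
def sumState {n d : ℕ} (p : En n × En n → ℝ)
    (ρ : En n × En n → Matrix (Fin d) (Fin d) ℂ) : En n → Matrix (Fin d) (Fin d) ℂ :=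
  fun s => ((sumDensity p s : ℂ))⁻¹ •
    Matrix.of fun i j => ∫ x, (p (x, s - x) : ℂ) * ρ (x, s - x) i j

/-- The conditional mutual information `I(X:Y|M) = S(X|M) + S(Y|M) - S(X,Y|M)` of the two
classical variables of a joint classical-quantum state on `ℝⁿ × ℝⁿ` given `M`. -/
def condMI {n d : ℕ} (p : En n × En n → ℝ)
    (ρ : En n × En n → Matrix (Fin d) (Fin d) ℂ) : ℝ :=
  condEnt (margFst p) (margFstState p ρ) + condEnt (margSnd p) (margSndState p ρ)
    - condEnt p ρ

/-- The joint density of `(A + c Z, Z)` where `A` has density `q` and `Z` is an independent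
standard Gaussian. -/
def noisyDensity {n : ℕ} (c : ℝ) (q : En n → ℝ) : En n × En n → ℝ :=
  fun wz => gaussDensity n wz.2 * q (wz.1 - c • wz.2)

/-- The state of `M` conditioned on `A + c Z = w` and `Z = z`, namely `σ(w - c z)`. -/
def noisyState {n d : ℕ} (c : ℝ) (σ : En n → Matrix (Fin d) (Fin d) ℂ) :
    En n × En n → Matrix (Fin d) (Fin d) ℂ :=
  fun wz => σ (wz.1 - c • wz.2)

/-- The mutual information `I(A + c Z : Z | M)` for a classical-quantum state `(q, σ)`. -/
def noisyMI {n d : ℕ} (c : ℝ) (q : En n → ℝ) (σ : En n → Matrix (Fin d) (Fin d) ℂ) : ℝ :=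
  condMI (noisyDensity c q) (noisyState c σ)

/-- The heat-semigroup-evolved conditional entropy `t ↦ S(A + √t Z | M)`. -/
def heatEnt {n d : ℕ} (q : En n → ℝ) (σ : En n → Matrix (Fin d) (Fin d) ℂ) (t : ℝ) : ℝ :=
  condEnt (margFst (noisyDensity (Real.sqrt t) q))
    (margFstState (noisyDensity (Real.sqrt t) q) (noisyState (Real.sqrt t) σ))

/-- The difference quotient `I(A + √t Z : Z | M) / t` whose limit as `t → 0⁺` is the
conditional Fisher information `J(A|M)`. -/
def fisherSlope {n d : ℕ} (q : En n → ℝ) (σ : En n → Matrix (Fin d) (Fin d) ℂ) (t : ℝ) : ℝ :=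
  noisyMI (Real.sqrt t) q σ / t

/-- The conditional Fisher information `J(A|M) = lim_{t→0⁺} I(A + √t Z : Z | M) / t`, as an
extended real number (the limit always exists, and is computed here as a `limsup`). -/
def condFisher {n d : ℕ} (q : En n → ℝ) (σ : En n → Matrix (Fin d) (Fin d) ℂ) : EReal :=
  Filter.limsup (fun t : ℝ => ((fisherSlope q σ t : ℝ) : EReal)) (𝓝[>] (0 : ℝ))

/-- The basic regularity hypotheses on a classical-quantum state `(p, ρ)`:
`p` is a probability density and `ρ` is a (trace-norm continuous) family of states. -/
def IsCQState {α : Type*} [MeasureSpace α] [TopologicalSpace α] {d : ℕ} (p : α → ℝ)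
    (ρ : α → Matrix (Fin d) (Fin d) ℂ) : Prop :=
  Measurable p ∧ (∀ a, 0 ≤ p a) ∧ (∫ a, p a) = 1 ∧ Continuous ρ ∧ ∀ a, IsState (ρ a)


section Helpers

section

/-- The integrand of the integral representation of the scalar relative entropy. -/
def sc (b c u : ℝ) : ℝ := (b - c) ^ 2 / (u * b + c) * ((1 + u) ^ 2)⁻¹

lemma sc_nonneg {b c u : ℝ} (hb : 0 ≤ b) (hc : 0 ≤ c) (hu : 0 ≤ u) : 0 ≤ sc b c u := by
  unfold sc; positivity

lemma sc_lintegral {b c : ℝ} (hb : 0 ≤ b) (hc : 0 < c) :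
    ∫⁻ u in Set.Ioi (0 : ℝ), ENNReal.ofReal (sc b c u)
      = ENNReal.ofReal (b * log b - b * log c - b + c) := by
  set g : ℝ → ℝ := fun u => (b - c) / (1 + u) - b * log (1 + u) + b * log (u * b + c) with hg
  have hder : ∀ u ∈ Set.Ici (0 : ℝ), HasDerivAt g (sc b c u) u := by
    intro u hu
    have hu : 0 ≤ u := hu
    have h1 : (1 + u) ≠ 0 := by positivity
    have h2 : (u * b + c) ≠ 0 := by positivity
    have d1 : HasDerivAt (fun u : ℝ => 1 + u) 1 u := by
      simpa using (hasDerivAt_id u).const_add 1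
    have d2 : HasDerivAt (fun u : ℝ => u * b + c) b u := by
      simpa using ((hasDerivAt_id u).mul_const b).add_const c
    have := (((hasDerivAt_const u (b - c)).div d1 h1).sub ((d1.log h1).const_mul b)).add
      ((d2.log h2).const_mul b)
    refine this.congr_deriv ?_
    unfold sc
    field_simp
    ring
  have hpos : ∀ u ∈ Set.Ioi (0 : ℝ), 0 ≤ sc b c u := fun u hu => sc_nonneg hb hc.le (le_of_lt hu)
  have hlim : Tendsto g atTop (𝓝 (b * log b)) := by
    have t1 : Tendsto (fun u : ℝ => 1 + u) atTop atTop := tendsto_atTop_add_const_left _ _ tendsto_id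
    have t2 : Tendsto (fun u : ℝ => (b - c) / (1 + u)) atTop (𝓝 0) := t1.const_div_atTop _
    rcases hb.eq_or_lt with rfl | hb'
    · simpa [hg] using t2
    · have t3 : Tendsto (fun u : ℝ => b * log (b + (c - b) / (1 + u))) atTop (𝓝 (b * log b)) := by
        have : Tendsto (fun u : ℝ => b + (c - b) / (1 + u)) atTop (𝓝 (b + 0)) :=
          (t1.const_div_atTop (c - b)).const_add b
        rw [add_zero] at this
        exact (this.log hb'.ne').const_mul b
      have t4 := t2.add t3
      rw [zero_add] at t4
      refine t4.congr' ?_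
      filter_upwards [eventually_ge_atTop 0] with u hu
      have h1 : (1 + u) ≠ 0 := by positivity
      have h2 : (u * b + c) ≠ 0 := by positivity
      have : b + (c - b) / (1 + u) = (u * b + c) / (1 + u) := by field_simp; ring
      rw [this, Real.log_div h2 h1]
      simp only [hg]
      ring
  have hint := integrableOn_Ioi_deriv_of_nonneg' hder hpos hlim
  have hval := integral_Ioi_of_hasDerivAt_of_nonneg' hder hpos hlim
  rw [← ofReal_integral_eq_lintegral_ofReal hint, hval]
  · congr 1
    simp [hg]
    ring
  · exact (ae_restrict_iff' measurableSet_Ioi).2 (ae_of_all _ hpos)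

lemma sc_zero_right (u : ℝ) : sc 0 0 u = 0 := by simp [sc]

/-- The scalar divergence. -/
lemma klein_scalar {b c : ℝ} (hb : 0 ≤ b) (hc : 0 < c) : 0 ≤ b * log b - b * log c - b + c := by
  rcases hb.eq_or_lt with rfl | hb'
  · simpa using hc.le
  · have h := Real.log_le_sub_one_of_pos (div_pos hc hb')
    rw [Real.log_div hc.ne' hb'.ne'] at h
    have h2 := mul_le_mul_of_nonneg_left h hb
    have : b * (c / b - 1) = c - b := by field_simp
    rw [this] at h2
    linarith

lemma complete_square {a t : ℝ} (z w : ℂ) (hz : t = 0 → a = 0) (ht : 0 ≤ t) :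
    2 * a * (z * w).re - t * ‖w‖ ^ 2 ≤ ‖z‖ ^ 2 * (a ^ 2 / t) := by
  rcases ht.eq_or_lt with h | h
  · simp [hz h.symm, ← h]
  · have h1 : (z * w).re ≤ ‖z‖ * ‖w‖ := by
      rw [← norm_mul]; exact Complex.re_le_norm _
    have h1' : -(‖z‖ * ‖w‖) ≤ (z * w).re := by
      rw [← norm_mul]; exact (abs_le.1 (Complex.abs_re_le_norm _)).1
    have h2 : a * (z * w).re ≤ |a| * (‖z‖ * ‖w‖) := by
      rw [← norm_mul]
      calc a * (z * w).re ≤ |a * (z * w).re| := le_abs_self _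
        _ = |a| * |(z * w).re| := abs_mul _ _
        _ ≤ _ := by gcongr; exact Complex.abs_re_le_norm _
    have h3 : ‖z‖ ^ 2 * (a ^ 2 / t) - (2 * (|a| * (‖z‖ * ‖w‖)) - t * ‖w‖ ^ 2)
        = (‖z‖ * |a| - t * ‖w‖) ^ 2 / t := by
      rw [← sq_abs a]; field_simp; ring
    have h4 : 0 ≤ (‖z‖ * |a| - t * ‖w‖) ^ 2 / t := by positivity
    linarith

lemma complete_square_eq {a t : ℝ} (z : ℂ) (hz : t = 0 → a = 0) :
    2 * a * (z * (star z * ((a / t : ℝ) : ℂ))).re - t * ‖star z * ((a / t : ℝ) : ℂ)‖ ^ 2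
      = ‖z‖ ^ 2 * (a ^ 2 / t) := by
  have e1 : z * (star z * ((a / t : ℝ) : ℂ)) = ((‖z‖ ^ 2 * (a / t) : ℝ) : ℂ) := by
    rw [← mul_assoc]
    have := Complex.mul_conj z
    rw [Complex.normSq_eq_norm_sq] at this
    simp only [Complex.star_def]
    rw [this]; push_cast; ring
  rw [e1, Complex.ofReal_re, norm_mul, norm_star, Complex.norm_real, mul_pow, Real.norm_eq_abs, sq_abs]
  by_cases h : t = 0
  · simp [h]
  · field_simp; ring
end

section
open Matrix

/-- The linear functional of the variational formula. -/
def Lf {d : ℕ} (Y : Matrix (Fin d) (Fin d) ℂ) (u : ℝ) (B C : Matrix (Fin d) (Fin d) ℂ) : ℝ :=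
  (trace (B * ((2 : ℂ) • Y - (u : ℂ) • (Y * Yᴴ)))).re - (trace (C * ((2 : ℂ) • Y + Yᴴ * Y))).re

/-- The quadratic divergence. -/
def Qf {d : ℕ} (u : ℝ) (B C : Matrix (Fin d) (Fin d) ℂ) : ENNReal :=
  ⨆ Y : Matrix (Fin d) (Fin d) ℂ, ENNReal.ofReal (Lf Y u B C)

/-- The quantum relative entropy, with its trace correction. -/
def Phi {d : ℕ} (B C : Matrix (Fin d) (Fin d) ℂ) : ENNReal :=
  ∫⁻ u in Set.Ioi (0 : ℝ), ENNReal.ofReal ((1 + u) ^ 2)⁻¹ * Qf u B C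

/-- Diagonal matrix with real entries. -/
def dg {d : ℕ} (b : Fin d → ℝ) : Matrix (Fin d) (Fin d) ℂ := diagonal fun i => (b i : ℂ)

lemma Lf_diag {d : ℕ} {U V : Matrix (Fin d) (Fin d) ℂ} (hU : Uᴴ * U = 1) (hV : Vᴴ * V = 1)
    (b c : Fin d → ℝ) (u : ℝ) (W : Matrix (Fin d) (Fin d) ℂ) :
    Lf (U * W * Vᴴ) u (U * dg b * Uᴴ) (V * dg c * Vᴴ) =
      ∑ i, ∑ j, (2 * (b i - c j) * ((Vᴴ * U) j i * W i j).re - (u * b i + c j) * ‖W i j‖ ^ 2) := by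
  have e1 : trace (U * dg b * Uᴴ * (U * W * Vᴴ)) = ∑ i, ∑ j, (b i : ℂ) * ((Vᴴ * U) j i * W i j) := by
    have : trace (U * dg b * Uᴴ * (U * W * Vᴴ)) = trace (dg b * (W * (Vᴴ * U))) := by
      calc _ = trace (U * (dg b * ((Uᴴ * U) * (W * Vᴴ)))) := by simp only [Matrix.mul_assoc]
        _ = _ := by rw [hU, Matrix.one_mul, Matrix.trace_mul_comm]; simp only [Matrix.mul_assoc]
    rw [this, trace]
    refine Finset.sum_congr rfl fun i _ => ?_
    rw [diag_apply, dg, diagonal_mul, Matrix.mul_apply, Finset.mul_sum]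
    exact Finset.sum_congr rfl fun j _ => by ring
  have e2 : trace (V * dg c * Vᴴ * (U * W * Vᴴ)) = ∑ i, ∑ j, (c j : ℂ) * ((Vᴴ * U) j i * W i j) := by
    have : trace (V * dg c * Vᴴ * (U * W * Vᴴ)) = trace (dg c * ((Vᴴ * U) * W)) := by
      calc _ = trace ((V * (dg c * (Vᴴ * U) * W)) * Vᴴ) := by simp only [Matrix.mul_assoc]
        _ = trace ((Vᴴ * V) * (dg c * (Vᴴ * U) * W)) := by
            rw [Matrix.trace_mul_comm]; simp only [Matrix.mul_assoc]
        _ = _ := by rw [hV, Matrix.one_mul]; simp only [Matrix.mul_assoc]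
    rw [this, trace, Finset.sum_comm]
    refine Finset.sum_congr rfl fun i _ => ?_
    rw [diag_apply, dg, diagonal_mul, Matrix.mul_apply, Finset.mul_sum]
  have e3 : trace (U * dg b * Uᴴ * ((U * W * Vᴴ) * (U * W * Vᴴ)ᴴ)) =
      ∑ i, ∑ j, (b i : ℂ) * ((‖W i j‖ ^ 2 : ℝ) : ℂ) := by
    have : trace (U * dg b * Uᴴ * ((U * W * Vᴴ) * (U * W * Vᴴ)ᴴ)) = trace (dg b * (W * Wᴴ)) := by
      calc _ = trace (U * (dg b * ((Uᴴ * U) * (W * ((Vᴴ * V) * (Wᴴ * Uᴴ)))))) := by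
            simp only [Matrix.mul_assoc, conjTranspose_mul, conjTranspose_conjTranspose]
        _ = trace ((dg b * (W * Wᴴ)) * (Uᴴ * U)) := by
            rw [hU, hV, Matrix.one_mul, Matrix.one_mul, Matrix.trace_mul_comm]
            simp only [Matrix.mul_assoc]
            rw [hU]
        _ = _ := by rw [hU, Matrix.mul_one]
    rw [this, trace]
    refine Finset.sum_congr rfl fun i _ => ?_
    rw [diag_apply, dg, diagonal_mul, Matrix.mul_apply, Finset.mul_sum]
    refine Finset.sum_congr rfl fun j _ => ?_
    rw [conjTranspose_apply, Complex.star_def, Complex.mul_conj, Complex.normSq_eq_norm_sq]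
  have e4 : trace (V * dg c * Vᴴ * ((U * W * Vᴴ)ᴴ * (U * W * Vᴴ))) =
      ∑ i, ∑ j, (c j : ℂ) * ((‖W i j‖ ^ 2 : ℝ) : ℂ) := by
    have : trace (V * dg c * Vᴴ * ((U * W * Vᴴ)ᴴ * (U * W * Vᴴ))) = trace (dg c * (Wᴴ * W)) := by
      calc _ = trace (V * (dg c * ((Vᴴ * V) * (Wᴴ * ((Uᴴ * U) * (W * Vᴴ)))))) := by
            simp only [Matrix.mul_assoc, conjTranspose_mul, conjTranspose_conjTranspose]
        _ = trace ((dg c * (Wᴴ * W)) * (Vᴴ * V)) := by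
            rw [hU, hV, Matrix.one_mul, Matrix.one_mul, Matrix.trace_mul_comm]
            simp only [Matrix.mul_assoc]
            rw [hV]
        _ = _ := by rw [hV, Matrix.mul_one]
    rw [this, trace, Finset.sum_comm]
    refine Finset.sum_congr rfl fun i _ => ?_
    rw [diag_apply, dg, diagonal_mul, Matrix.mul_apply, Finset.mul_sum]
    refine Finset.sum_congr rfl fun j _ => ?_
    rw [conjTranspose_apply, Complex.star_def, mul_comm (starRingEnd ℂ _), Complex.mul_conj, Complex.normSq_eq_norm_sq]
  unfold Lf
  rw [Matrix.mul_sub, Matrix.mul_add, Matrix.mul_smul, Matrix.mul_smul, Matrix.mul_smul, trace_sub, trace_add,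
    trace_smul, trace_smul, trace_smul, e1, e2, e3, e4]
  rw [smul_eq_mul, smul_eq_mul, smul_eq_mul, ← Complex.sub_re]
  simp only [Finset.mul_sum, ← Finset.sum_add_distrib, ← Finset.sum_sub_distrib]
  rw [Complex.re_sum]
  refine Finset.sum_congr rfl fun i _ => ?_
  rw [Complex.re_sum]
  refine Finset.sum_congr rfl fun j _ => ?_
  have : ∀ z : ℂ, (2 * (↑(b i) * z) - ↑u * (↑(b i) * ((‖W i j‖ ^ 2 : ℝ) : ℂ))
      - (2 * (↑(c j) * z) + ↑(c j) * ((‖W i j‖ ^ 2 : ℝ) : ℂ)))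
      = ((2 * (b i - c j) : ℝ) : ℂ) * z - (((u * b i + c j) * ‖W i j‖ ^ 2 : ℝ) : ℂ) := by
    intro z; push_cast; ring
  rw [this, Complex.sub_re, Complex.ofReal_re, Complex.re_ofReal_mul]

lemma Qf_diag {d : ℕ} {U V : Matrix (Fin d) (Fin d) ℂ} (hU : Uᴴ * U = 1) (hV : Vᴴ * V = 1)
    {b c : Fin d → ℝ} (hb : ∀ i, 0 ≤ b i) (hc : ∀ i, 0 ≤ c i) {u : ℝ} (hu : 0 < u) :
    Qf u (U * dg b * Uᴴ) (V * dg c * Vᴴ) =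
      ENNReal.ofReal (∑ i, ∑ j, ‖(Vᴴ * U) j i‖ ^ 2 * ((b i - c j) ^ 2 / (u * b i + c j))) := by
  have hz : ∀ i j, u * b i + c j = 0 → b i - c j = 0 := by
    intro i j h
    have h1 : 0 ≤ u * b i := mul_nonneg hu.le (hb i)
    have h2 := hc j
    have h3 : u * b i = 0 := by linarith
    have h4 : b i = 0 := by
      rcases mul_eq_zero.1 h3 with h | h
      · exact absurd h hu.ne'
      · exact h
    rw [h4]; linarith
  apply le_antisymm
  · refine iSup_le fun Y => ENNReal.ofReal_le_ofReal ?_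
    have hY : Y = U * (Uᴴ * Y * V) * Vᴴ := by
      have hU' : U * Uᴴ = 1 := mul_eq_one_comm.1 hU
      have hV' : V * Vᴴ = 1 := mul_eq_one_comm.1 hV
      calc Y = (U * Uᴴ) * Y * (V * Vᴴ) := by rw [hU', hV', Matrix.one_mul, Matrix.mul_one]
        _ = _ := by simp only [Matrix.mul_assoc]
    rw [hY, Lf_diag hU hV]
    refine Finset.sum_le_sum fun i _ => Finset.sum_le_sum fun j _ => ?_
    exact complete_square _ _ (hz i j) (add_nonneg (mul_nonneg hu.le (hb i)) (hc j))
  · set W : Matrix (Fin d) (Fin d) ℂ := Matrix.of fun i j =>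
      star ((Vᴴ * U) j i) * (((b i - c j) / (u * b i + c j) : ℝ) : ℂ) with hW
    refine le_trans (ENNReal.ofReal_le_ofReal (le_of_eq ?_))
      (le_iSup (fun Y => ENNReal.ofReal (Lf Y u (U * dg b * Uᴴ) (V * dg c * Vᴴ))) (U * W * Vᴴ))
    rw [Lf_diag hU hV]
    refine Finset.sum_congr rfl fun i _ => Finset.sum_congr rfl fun j _ => ?_
    exact (complete_square_eq _ (hz i j)).symm

lemma diag_conj_entry {d : ℕ} (U V : Matrix (Fin d) (Fin d) ℂ) (b : Fin d → ℝ) (j : Fin d) :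
    (Vᴴ * (U * dg b * Uᴴ) * V) j j = ((∑ i, ‖(Vᴴ * U) j i‖ ^ 2 * b i : ℝ) : ℂ) := by
  have : Vᴴ * (U * dg b * Uᴴ) * V = (Vᴴ * U) * dg b * (Vᴴ * U)ᴴ := by
    simp only [Matrix.mul_assoc, conjTranspose_mul, conjTranspose_conjTranspose]
  rw [this, Matrix.mul_apply]
  push_cast
  refine Finset.sum_congr rfl fun i _ => ?_
  rw [dg, mul_diagonal, conjTranspose_apply, mul_right_comm, Complex.star_def, Complex.mul_conj,
    Complex.normSq_eq_norm_sq]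
  push_cast; ring

lemma trace_mul_conj_dg {d : ℕ} (B V : Matrix (Fin d) (Fin d) ℂ) (m : Fin d → ℝ) :
    (trace (B * (V * dg m * Vᴴ))).re = ∑ j, m j * ((Vᴴ * B * V) j j).re := by
  have : trace (B * (V * dg m * Vᴴ)) = trace ((Vᴴ * B * V) * dg m) := by
    calc _ = trace ((B * (V * dg m)) * Vᴴ) := by simp only [Matrix.mul_assoc]
      _ = _ := by rw [Matrix.trace_mul_comm]; simp only [Matrix.mul_assoc]
  rw [this, trace, Complex.re_sum]
  refine Finset.sum_congr rfl fun j _ => ?_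
  rw [diag_apply, dg, mul_diagonal, mul_comm, Complex.re_ofReal_mul]

lemma sum_row {d : ℕ} {P : Matrix (Fin d) (Fin d) ℂ} (h : P * Pᴴ = 1) (j : Fin d) :
    ∑ i, ‖P j i‖ ^ 2 = 1 := by
  have h1 := congrFun (congrFun h j) j
  rw [Matrix.mul_apply, Matrix.one_apply_eq] at h1
  have : ((∑ i, ‖P j i‖ ^ 2 : ℝ) : ℂ) = 1 := by
    rw [← h1]; push_cast
    refine Finset.sum_congr rfl fun i _ => ?_
    rw [conjTranspose_apply, Complex.star_def, Complex.mul_conj, Complex.normSq_eq_norm_sq]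
    push_cast; ring
  exact_mod_cast this

lemma sum_col {d : ℕ} {P : Matrix (Fin d) (Fin d) ℂ} (h : Pᴴ * P = 1) (i : Fin d) :
    ∑ j, ‖P j i‖ ^ 2 = 1 := by
  have := sum_row (P := Pᴴ) (by rwa [conjTranspose_conjTranspose]) i
  simpa [conjTranspose_apply] using this

/-- Main formula for the relative entropy. -/
lemma Phi_diag {d : ℕ} {U V : Matrix (Fin d) (Fin d) ℂ} (hU : Uᴴ * U = 1) (hV : Vᴴ * V = 1)
    {b c : Fin d → ℝ} (hb : ∀ i, 0 ≤ b i) (hc : ∀ i, 0 ≤ c i)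
    (hker : ∀ j, c j = 0 → ((Vᴴ * (U * dg b * Uᴴ) * V) j j).re = 0) :
    0 ≤ (∑ i, b i * log (b i)) - (trace (U * dg b * Uᴴ * (V * dg (fun j => log (c j)) * Vᴴ))).re
        - (∑ i, b i) + ∑ j, c j ∧
    Phi (U * dg b * Uᴴ) (V * dg c * Vᴴ) = ENNReal.ofReal
      ((∑ i, b i * log (b i)) - (trace (U * dg b * Uᴴ * (V * dg (fun j => log (c j)) * Vᴴ))).re
        - (∑ i, b i) + ∑ j, c j) := by
  set p : Fin d → Fin d → ℝ := fun i j => ‖(Vᴴ * U) j i‖ ^ 2 with hp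
  have hp0 : ∀ i j, 0 ≤ p i j := fun i j => by positivity
  have hU' : U * Uᴴ = 1 := mul_eq_one_comm.1 hU
  have hV' : V * Vᴴ = 1 := mul_eq_one_comm.1 hV
  have hpc : ∀ i, ∑ j, p i j = 1 := by
    refine sum_col ?_
    calc (Vᴴ * U)ᴴ * (Vᴴ * U) = Uᴴ * ((V * Vᴴ) * U) := by
          simp only [Matrix.mul_assoc, conjTranspose_mul, conjTranspose_conjTranspose]
      _ = 1 := by rw [hV', Matrix.one_mul, hU]
  have hpr : ∀ j, ∑ i, p i j = 1 := by
    refine sum_row ?_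
    calc (Vᴴ * U) * (Vᴴ * U)ᴴ = Vᴴ * ((U * Uᴴ) * V) := by
          simp only [Matrix.mul_assoc, conjTranspose_mul, conjTranspose_conjTranspose]
      _ = 1 := by rw [hU', Matrix.one_mul, hV]
  have hpz : ∀ i j, c j = 0 → p i j = 0 ∨ b i = 0 := by
    intro i j hj
    have h1 := hker j hj
    rw [diag_conj_entry, Complex.ofReal_re,
      Finset.sum_eq_zero_iff_of_nonneg (fun i _ => mul_nonneg (hp0 i j) (hb i))] at h1
    exact mul_eq_zero.1 (h1 i (Finset.mem_univ i))
  have hterm0 : ∀ i j, 0 ≤ p i j * (b i * log (b i) - b i * log (c j) - b i + c j) := by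
    intro i j
    rcases (hc j).eq_or_lt with h | h
    · rcases hpz i j h.symm with h' | h'
      · simp [h']
      · simp [h', ← h]
    · exact mul_nonneg (hp0 i j) (klein_scalar (hb i) h)
  have hE : (∑ i, b i * log (b i)) - (trace (U * dg b * Uᴴ * (V * dg (fun j => log (c j)) * Vᴴ))).re
        - (∑ i, b i) + ∑ j, c j
        = ∑ i, ∑ j, p i j * (b i * log (b i) - b i * log (c j) - b i + c j) := by
    have s1 : ∑ i, b i * log (b i) = ∑ i, ∑ j, p i j * (b i * log (b i)) := by
      refine Finset.sum_congr rfl fun i _ => ?_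
      rw [← Finset.sum_mul, hpc, one_mul]
    have s2 : ∑ i, b i  = ∑ i, ∑ j, p i j * (b i) := by
      refine Finset.sum_congr rfl fun i _ => ?_
      rw [← Finset.sum_mul, hpc, one_mul]
    have s3 : ∑ j, c j  = ∑ i, ∑ j, p i j * (c j) := by
      rw [Finset.sum_comm]
      refine Finset.sum_congr rfl fun i _ => ?_
      rw [← Finset.sum_mul, hpr, one_mul]
    have s4 : (trace (U * dg b * Uᴴ * (V * dg (fun j => log (c j)) * Vᴴ))).re
        = ∑ i, ∑ j, p i j * (b i * log (c j)) := by
      rw [trace_mul_conj_dg, Finset.sum_comm]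
      refine Finset.sum_congr rfl fun j _ => ?_
      rw [diag_conj_entry, Complex.ofReal_re, Finset.mul_sum]
      exact Finset.sum_congr rfl fun i _ => by ring
    rw [s1, s2, s3, s4]
    simp only [← Finset.sum_add_distrib, ← Finset.sum_sub_distrib]
    exact Finset.sum_congr rfl fun i _ => Finset.sum_congr rfl fun j _ => by ring
  rw [hE]
  refine ⟨Finset.sum_nonneg fun i _ => Finset.sum_nonneg fun j _ => hterm0 i j, ?_⟩
  have hI : Phi (U * dg b * Uᴴ) (V * dg c * Vᴴ)
      = ∫⁻ u in Set.Ioi (0 : ℝ), ∑ i, ∑ j, ENNReal.ofReal (p i j) * ENNReal.ofReal (sc (b i) (c j) u) := by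
    refine setLIntegral_congr_fun measurableSet_Ioi fun u hu => ?_
    have hu : 0 < u := hu
    rw [Qf_diag hU hV hb hc hu, ← ENNReal.ofReal_mul (by positivity), Finset.mul_sum,
      ENNReal.ofReal_sum_of_nonneg]
    · refine Finset.sum_congr rfl fun i _ => ?_
      rw [Finset.mul_sum, ENNReal.ofReal_sum_of_nonneg]
      · refine Finset.sum_congr rfl fun j _ => ?_
        rw [← ENNReal.ofReal_mul (hp0 i j)]
        congr 1
        simp only [hp, sc]; ring
      · intro j _
        have := hb i
        have := hc j
        positivity
    · intro i _
      refine mul_nonneg (by positivity) (Finset.sum_nonneg fun j _ => ?_)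
      have := hb i
      have := hc j
      positivity
  have hm : ∀ i j, Measurable fun u : ℝ => ENNReal.ofReal (sc (b i) (c j) u) := by
    intro i j
    unfold sc
    fun_prop
  rw [hI, lintegral_finsetSum _ (fun i _ => Finset.measurable_sum _ fun j _ => (hm i j).const_mul _),
    ENNReal.ofReal_sum_of_nonneg (fun i _ => Finset.sum_nonneg fun j _ => hterm0 i j)]
  refine Finset.sum_congr rfl fun i _ => ?_
  rw [lintegral_finsetSum _ (fun j _ => (hm i j).const_mul _),
    ENNReal.ofReal_sum_of_nonneg (fun j _ => hterm0 i j)]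
  refine Finset.sum_congr rfl fun j _ => ?_
  rw [lintegral_const_mul _ (hm i j)]
  rcases (hc j).eq_or_lt with h | h
  · rcases hpz i j h.symm with h' | h'
    · simp [h']
    · simp [h', ← h, sc_zero_right]
  · rw [sc_lintegral (hb i) h, ENNReal.ofReal_mul (hp0 i j)]

end

section
open Matrix

lemma spec {d : ℕ} {A : Matrix (Fin d) (Fin d) ℂ} (hA : A.PosSemidef) :
    ∃ (U : Matrix (Fin d) (Fin d) ℂ) (b : Fin d → ℝ), Uᴴ * U = 1 ∧ (∀ i, 0 ≤ b i) ∧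
      A = U * dg b * Uᴴ ∧ vnEnt A = -∑ i, b i * log (b i) := by
  refine ⟨hA.1.eigenvectorUnitary, hA.1.eigenvalues, ?_, hA.eigenvalues_nonneg, ?_, ?_⟩
  · exact Unitary.coe_star_mul_self hA.1.eigenvectorUnitary
  · have := hA.1.spectral_theorem
    rw [Unitary.conjStarAlgAut_apply] at this
    exact this
  · rw [vnEnt, dif_pos hA.1]

lemma trace_conj_dg {d : ℕ} {U : Matrix (Fin d) (Fin d) ℂ} (hU : Uᴴ * U = 1) (b : Fin d → ℝ) :
    trace (U * dg b * Uᴴ) = ((∑ i, b i : ℝ) : ℂ) := by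
  rw [Matrix.trace_mul_comm, ← Matrix.mul_assoc, hU, Matrix.one_mul, dg, trace_diagonal]
  push_cast; rfl

lemma dg_one {d : ℕ} : dg (fun _ : Fin d => (1 : ℝ)) = 1 := by
  simp [dg]

lemma Phi_one_diag {d : ℕ} {U : Matrix (Fin d) (Fin d) ℂ} (hU : Uᴴ * U = 1)
    {b : Fin d → ℝ} (hb : ∀ i, 0 ≤ b i) :
    0 ≤ (∑ i, b i * log (b i)) - (∑ i, b i) + d ∧
    Phi (U * dg b * Uᴴ) 1 = ENNReal.ofReal ((∑ i, b i * log (b i)) - (∑ i, b i) + d) := by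
  have h := Phi_diag (V := 1) (c := fun _ => 1) hU (by simp) hb (fun _ => zero_le_one)
    (fun j hj => absurd hj one_ne_zero)
  have h0 : dg (fun _ : Fin d => log (1 : ℝ)) = 0 := by simp [dg]
  simp only [h0, dg_one] at h
  simpa using h

/-- Independence of the diagonalization. -/
lemma vnEnt_diag {d : ℕ} {U : Matrix (Fin d) (Fin d) ℂ} (hU : Uᴴ * U = 1)
    {b : Fin d → ℝ} (hb : ∀ i, 0 ≤ b i) :
    vnEnt (U * dg b * Uᴴ) = -∑ i, b i * log (b i) := by
  have hpsd : (U * dg b * Uᴴ).PosSemidef := by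
    refine PosSemidef.mul_mul_conjTranspose_same ?_ U
    rw [dg, posSemidef_diagonal_iff]
    intro i; exact_mod_cast hb i
  obtain ⟨V, c, hV, hc, hA, hE⟩ := spec hpsd
  have h1 := Phi_one_diag hU hb
  have h2 := Phi_one_diag hV hc
  have ht : ∑ i, b i = ∑ i, c i := by
    have := trace_conj_dg hU b
    rw [hA, trace_conj_dg hV] at this
    exact_mod_cast this.symm
  rw [hE]
  rw [← hA, h1.2, ENNReal.ofReal_eq_ofReal_iff h1.1 h2.1] at h2
  linarith [h2.2]

lemma vnEnt_smul {d : ℕ} {A : Matrix (Fin d) (Fin d) ℂ} (hA : A.PosSemidef) {r : ℝ} (hr : 0 ≤ r) :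
    vnEnt ((r : ℂ) • A) = r * vnEnt A - r * log r * (trace A).re := by
  obtain ⟨U, b, hU, hb, hA, hE⟩ := spec hA
  have h1 : (r : ℂ) • A = U * dg (fun i => r * b i) * Uᴴ := by
    have : dg (fun i => r * b i) = (r : ℂ) • dg b := by
      rw [dg, dg, ← diagonal_smul]; congr 1; ext i; simp
    rw [this, hA]; simp
  rw [h1, vnEnt_diag hU (fun i => mul_nonneg hr (hb i)), hE, hA, trace_conj_dg hU, Complex.ofReal_re,
    mul_neg, Finset.mul_sum, Finset.mul_sum, ← Finset.sum_neg_distrib, ← Finset.sum_neg_distrib,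
    ← Finset.sum_sub_distrib]
  refine Finset.sum_congr rfl fun i _ => ?_
  rcases hr.eq_or_lt with rfl | h
  · simp
  rcases (hb i).eq_or_lt with h' | h'
  · simp [← h']
  · rw [Real.log_mul h.ne' h'.ne']; ring

lemma vnEnt_le {d : ℕ} {A : Matrix (Fin d) (Fin d) ℂ} (hA : A.PosSemidef) {r : ℝ} (hr : 0 < r) :
    vnEnt A ≤ -log r * (trace A).re - (trace A).re + d * r := by
  obtain ⟨U, b, hU, hb, hA, hE⟩ := spec hA
  rw [hE, hA, trace_conj_dg hU, Complex.ofReal_re]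
  have : 0 ≤ ∑ i, (b i * log (b i) - b i * log r - b i + r) :=
    Finset.sum_nonneg fun i _ => klein_scalar (hb i) hr
  simp only [Finset.sum_add_distrib, Finset.sum_sub_distrib, ← Finset.sum_mul] at this
  simp at this
  linarith

lemma vnEnt_state {d : ℕ} {A : Matrix (Fin d) (Fin d) ℂ} (hA : A.PosSemidef)
    (ht : (trace A).re ≤ 1) : 0 ≤ vnEnt A ∧ vnEnt A ≤ d := by
  obtain ⟨U, b, hU, hb, hA', hE⟩ := spec hA
  have htr : (trace A).re = ∑ i, b i := by rw [hA', trace_conj_dg hU, Complex.ofReal_re]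
  constructor
  · rw [hE, ← Finset.sum_neg_distrib]
    refine Finset.sum_nonneg fun i _ => ?_
    have h1 : b i ≤ 1 := by
      refine le_trans ?_ ht
      rw [htr]
      exact Finset.single_le_sum (fun i _ => hb i) (Finset.mem_univ i)
    have := Real.log_nonpos (hb i) h1
    nlinarith [hb i]
  · have := vnEnt_le hA one_pos
    have h0 : 0 ≤ (trace A).re := by rw [htr]; exact Finset.sum_nonneg fun i _ => hb i
    simp at this
    linarith

lemma Lf_continuous {d : ℕ} (Y : Matrix (Fin d) (Fin d) ℂ) :
    Continuous fun p : ℝ × (Fin d → Fin d → ℂ) × (Fin d → Fin d → ℂ) =>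
      Lf Y p.1 (Matrix.of p.2.1) (Matrix.of p.2.2) := by
  have h1 : Continuous fun p : ℝ × (Fin d → Fin d → ℂ) × (Fin d → Fin d → ℂ) => p.1 := continuous_fst
  have h2 : ∀ i j, Continuous fun p : ℝ × (Fin d → Fin d → ℂ) × (Fin d → Fin d → ℂ) => p.2.1 i j := by
    intro i j; fun_prop
  have h3 : ∀ i j, Continuous fun p : ℝ × (Fin d → Fin d → ℂ) × (Fin d → Fin d → ℂ) => p.2.2 i j := by
    intro i j; fun_prop
  simp only [Lf, trace, diag_apply, Matrix.mul_apply, Matrix.of_apply, Matrix.sub_apply,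
      Matrix.add_apply, Matrix.smul_apply]
  refine Continuous.sub (Complex.continuous_re.comp ?_) (Complex.continuous_re.comp ?_)
  · refine continuous_finsetSum _ fun i _ => continuous_finsetSum _ fun j _ => (h2 i j).mul ?_
    exact continuous_const.sub ((Complex.continuous_ofReal.comp h1).smul continuous_const)
  · exact continuous_finsetSum _ fun i _ => continuous_finsetSum _ fun j _ =>
      (h3 i j).mul continuous_const

lemma Qf_lsc {d : ℕ} : LowerSemicontinuous fun p : ℝ × (Fin d → Fin d → ℂ) × (Fin d → Fin d → ℂ) =>
      Qf p.1 (Matrix.of p.2.1) (Matrix.of p.2.2) := by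
  unfold Qf
  refine lowerSemicontinuous_iSup fun Y => Continuous.lowerSemicontinuous ?_
  exact ENNReal.continuous_ofReal.comp (Lf_continuous Y)

lemma Qf_measurable {d : ℕ} {α : Type*} [MeasurableSpace α] {f : α → ℝ}
    {B C : α → Matrix (Fin d) (Fin d) ℂ} (hf : Measurable f)
    (hB : ∀ i j, Measurable fun a => B a i j) (hC : ∀ i j, Measurable fun a => C a i j) :
    Measurable fun a => Qf (f a) (B a) (C a) := by
  have h1 : Measurable fun a => (fun i j => B a i j : Fin d → Fin d → ℂ) := by
    rw [measurable_pi_iff]; intro i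
    rw [measurable_pi_iff]; intro j
    exact hB i j
  have h2 : Measurable fun a => (fun i j => C a i j : Fin d → Fin d → ℂ) := by
    rw [measurable_pi_iff]; intro i
    rw [measurable_pi_iff]; intro j
    exact hC i j
  have hm := hf.prodMk (h1.prodMk h2)
  have hq := (Qf_lsc (d := d)).measurable
  have h3 := hq.comp hm
  have h4 : (fun a => Qf (f a) (B a) (C a)) = (fun p : ℝ × (Fin d → Fin d → ℂ) × (Fin d → Fin d → ℂ) =>
      Qf p.1 (Matrix.of p.2.1) (Matrix.of p.2.2)) ∘ (fun a => (f a, (fun i j => B a i j), (fun i j => C a i j))) := rfl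
  rw [h4]
  exact h3

lemma Phi_measurable {d : ℕ} {α : Type*} [MeasurableSpace α]
    {B C : α → Matrix (Fin d) (Fin d) ℂ}
    (hB : ∀ i j, Measurable fun a => B a i j) (hC : ∀ i j, Measurable fun a => C a i j) :
    Measurable fun a => Phi (B a) (C a) := by
  unfold Phi
  refine Measurable.lintegral_prod_right' (f := fun p : α × ℝ =>
    ENNReal.ofReal ((1 + p.2) ^ 2)⁻¹ * Qf p.2 (B p.1) (C p.1)) ?_
  refine Measurable.mul (by fun_prop) (Qf_measurable measurable_snd ?_ ?_)
  · exact fun i j => (hB i j).comp measurable_fst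
  · exact fun i j => (hC i j).comp measurable_fst

/-- A measurable version of the entropy. -/
lemma vnEnt_eq_Phi {d : ℕ} {A : Matrix (Fin d) (Fin d) ℂ} (hA : A.PosSemidef) :
    vnEnt A = d - (trace A).re - (Phi A 1).toReal := by
  obtain ⟨U, b, hU, hb, hA, hE⟩ := spec hA
  have h := Phi_one_diag hU hb
  rw [hE, hA, h.2, ENNReal.toReal_ofReal h.1, trace_conj_dg hU, Complex.ofReal_re]
  ring

lemma vnEnt_aesm {d : ℕ} {α : Type*} [MeasurableSpace α] {μ : Measure α}
    {B : α → Matrix (Fin d) (Fin d) ℂ}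
    (hB : ∀ i j, Measurable fun a => B a i j) (hp : ∀ᵐ a ∂μ, (B a).PosSemidef) :
    AEStronglyMeasurable (fun a => vnEnt (B a)) μ := by
  have : Measurable fun a => (d : ℝ) - (trace (B a)).re - (Phi (B a) 1).toReal := by
    refine Measurable.sub (Measurable.sub measurable_const ?_) ?_
    · simp only [trace, diag_apply]
      exact Complex.measurable_re.comp (Finset.measurable_sum _ fun i _ => hB i i)
    · have h1 : Measurable fun a => Phi (B a) 1 :=
        Phi_measurable (C := fun _ => 1) hB fun i j => measurable_const
      exact h1.ennreal_toReal
  refine this.aestronglyMeasurable.congr ?_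
  filter_upwards [hp] with a ha
  exact (vnEnt_eq_Phi ha).symm

/-- Entrywise integral. -/
def mint {d : ℕ} {α : Type*} [MeasurableSpace α] (μ : Measure α)
    (B : α → Matrix (Fin d) (Fin d) ℂ) : Matrix (Fin d) (Fin d) ℂ :=
  Matrix.of fun i j => ∫ a, B a i j ∂μ

section mint
variable {d : ℕ} {α : Type*} [MeasurableSpace α] {μ : Measure α}
  {B C : α → Matrix (Fin d) (Fin d) ℂ}

lemma integrable_trace_mul (hB : ∀ i j, Integrable (fun a => B a i j) μ)
    (M : Matrix (Fin d) (Fin d) ℂ) : Integrable (fun a => (trace (B a * M)).re) μ := by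
  have : Integrable (fun a => trace (B a * M)) μ := by
    simp only [trace, diag_apply, Matrix.mul_apply]
    exact integrable_finsetSum _ fun i _ => integrable_finsetSum _ fun j _ => (hB i j).mul_const _
  exact this.re

lemma integral_trace_mul (hB : ∀ i j, Integrable (fun a => B a i j) μ)
    (M : Matrix (Fin d) (Fin d) ℂ) :
    ∫ a, (trace (B a * M)).re ∂μ = (trace (mint μ B * M)).re := by
  have h : Integrable (fun a => trace (B a * M)) μ := by
    simp only [trace, diag_apply, Matrix.mul_apply]
    exact integrable_finsetSum _ fun i _ => integrable_finsetSum _ fun j _ => (hB i j).mul_const _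
  have e : ∫ a, trace (B a * M) ∂μ = trace (mint μ B * M) := by
    simp only [trace, diag_apply, Matrix.mul_apply]
    rw [integral_finsetSum _ fun i _ => integrable_finsetSum _ fun j _ => (hB i j).mul_const _]
    refine Finset.sum_congr rfl fun i _ => ?_
    rw [integral_finsetSum _ fun j _ => (hB i j).mul_const _]
    refine Finset.sum_congr rfl fun j _ => ?_
    rw [integral_mul_const]; rfl
  rw [← e]
  exact integral_re h

lemma integral_trace (hB : ∀ i j, Integrable (fun a => B a i j) μ) :
    ∫ a, (trace (B a)).re ∂μ = (trace (mint μ B)).re := by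
  simpa using integral_trace_mul hB 1

lemma integrable_trace (hB : ∀ i j, Integrable (fun a => B a i j) μ) :
    Integrable (fun a => (trace (B a)).re) μ := by
  simpa using integrable_trace_mul hB 1

lemma mint_psd (hB : ∀ i j, Integrable (fun a => B a i j) μ) (hp : ∀ᵐ a ∂μ, (B a).PosSemidef) :
    (mint μ B).PosSemidef := by
  refine PosSemidef.of_dotProduct_mulVec_nonneg ?_ ?_
  · ext i j
    rw [conjTranspose_apply, mint, of_apply, of_apply, Complex.star_def, ← integral_conj]
    refine integral_congr_ae ?_
    filter_upwards [hp] with a ha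
    exact ha.1.apply i j
  · intro x
    have e : star x ⬝ᵥ mint μ B *ᵥ x = ∫ a, star x ⬝ᵥ B a *ᵥ x ∂μ := by
      simp only [dotProduct, mulVec, Finset.mul_sum]
      rw [integral_finsetSum _ fun i _ => integrable_finsetSum _ fun j _ =>
        ((hB i j).mul_const _).const_mul _]
      refine Finset.sum_congr rfl fun i _ => ?_
      rw [integral_finsetSum _ fun j _ => ((hB i j).mul_const _).const_mul _]
      refine Finset.sum_congr rfl fun j _ => ?_
      rw [integral_const_mul, integral_mul_const]; rfl
    rw [e]
    refine integral_nonneg_of_ae ?_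
    filter_upwards [hp] with a ha
    exact ha.dotProduct_mulVec_nonneg x

lemma Lf_mint (hB : ∀ i j, Integrable (fun a => B a i j) μ)
    (hC : ∀ i j, Integrable (fun a => C a i j) μ) (Y : Matrix (Fin d) (Fin d) ℂ) (u : ℝ) :
    ENNReal.ofReal (Lf Y u (mint μ B) (mint μ C)) ≤ ∫⁻ a, ENNReal.ofReal (Lf Y u (B a) (C a)) ∂μ := by
  have : Lf Y u (mint μ B) (mint μ C) = ∫ a, Lf Y u (B a) (C a) ∂μ := by
    unfold Lf
    rw [integral_sub (integrable_trace_mul hB _) (integrable_trace_mul hC _), integral_trace_mul hB,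
      integral_trace_mul hC]
  have hi : Integrable (fun a => Lf Y u (B a) (C a)) μ :=
    (integrable_trace_mul hB _).sub (integrable_trace_mul hC _)
  rw [this]
  calc ENNReal.ofReal (∫ a, Lf Y u (B a) (C a) ∂μ)
      ≤ ENNReal.ofReal (∫ a, max (Lf Y u (B a) (C a)) 0 ∂μ) :=
        ENNReal.ofReal_le_ofReal (integral_mono hi hi.pos_part fun a => le_max_left _ _)
    _ = ∫⁻ a, ENNReal.ofReal (max (Lf Y u (B a) (C a)) 0) ∂μ :=
        ofReal_integral_eq_lintegral_ofReal hi.pos_part (ae_of_all _ fun a => le_max_right _ _)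
    _ = _ := by simp

/-- Joint convexity of the relative entropy (Lieb), in Jensen form. -/
lemma Phi_jensen [SFinite μ] (hB : ∀ i j, Integrable (fun a => B a i j) μ)
    (hC : ∀ i j, Integrable (fun a => C a i j) μ)
    (hBm : ∀ i j, Measurable fun a => B a i j) (hCm : ∀ i j, Measurable fun a => C a i j) :
    Phi (mint μ B) (mint μ C) ≤ ∫⁻ a, Phi (B a) (C a) ∂μ := by
  unfold Phi
  rw [lintegral_lintegral_swap]
  · refine lintegral_mono fun u => ?_
    rw [lintegral_const_mul _ (Qf_measurable measurable_const hBm hCm)]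
    gcongr
    refine iSup_le fun Y => (Lf_mint hB hC Y u).trans (lintegral_mono fun a => ?_)
    exact le_iSup (fun Y => ENNReal.ofReal (Lf Y u (B a) (C a))) Y
  · refine (Measurable.mul (by fun_prop) (Qf_measurable measurable_snd ?_ ?_)).aemeasurable
    · exact fun i j => (hBm i j).comp measurable_fst
    · exact fun i j => (hCm i j).comp measurable_fst

/-- The Jensen gap of the entropy is an average relative entropy. -/
lemma gap [IsProbabilityMeasure μ] (hB : ∀ i j, Integrable (fun a => B a i j) μ)
    (hp : ∀ᵐ a ∂μ, (B a).PosSemidef) (hE : Integrable (fun a => vnEnt (B a)) μ) :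
    0 ≤ vnEnt (mint μ B) - ∫ a, vnEnt (B a) ∂μ ∧
    ∫⁻ a, Phi (B a) (mint μ B) ∂μ = ENNReal.ofReal (vnEnt (mint μ B) - ∫ a, vnEnt (B a) ∂μ) := by
  obtain ⟨V, c, hV, hc, hC, hCE⟩ := spec (mint_psd hB hp)
  set M := V * dg (fun j => log (c j)) * Vᴴ with hM
  have hV' : V * Vᴴ = 1 := mul_eq_one_comm.1 hV
  -- the kernel condition
  have hker : ∀ᵐ a ∂μ, ∀ j, c j = 0 → ((Vᴴ * B a * V) j j).re = 0 := by
    rw [ae_all_iff]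
    intro j
    by_cases hj : c j = 0
    · have e : ∀ X : Matrix (Fin d) (Fin d) ℂ, ((Vᴴ * X * V) j j).re
          = (trace (X * (V * dg (Pi.single j 1) * Vᴴ))).re := by
        intro X
        rw [trace_mul_conj_dg]
        rw [Finset.sum_eq_single j]
        · simp
        · intro i _ hi; simp [hi]
        · simp
      have h0 : ∫ a, ((Vᴴ * B a * V) j j).re ∂μ = 0 := by
        simp only [e]
        rw [integral_trace_mul hB, ← e, hC]
        have : Vᴴ * (V * dg c * Vᴴ) * V = (Vᴴ * V) * dg c * (Vᴴ * V) := by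
          simp only [Matrix.mul_assoc]
        rw [this, hV, Matrix.one_mul, Matrix.mul_one, dg, diagonal_apply_eq, hj]
        simp
      rw [integral_eq_zero_iff_of_nonneg_ae] at h0
      · filter_upwards [h0] with a ha _ using ha
      · filter_upwards [hp] with a ha
        have := (ha.conjTranspose_mul_mul_same V).diag_nonneg (i := j)
        exact (Complex.le_def.1 this).1
      · simp only [e]
        exact integrable_trace_mul hB _
    · exact ae_of_all _ fun a h => absurd h hj
  have key : ∀ᵐ a ∂μ, 0 ≤ -vnEnt (B a) - (trace (B a * M)).re - (trace (B a)).re + ∑ j, c j ∧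
      Phi (B a) (mint μ B) = ENNReal.ofReal
        (-vnEnt (B a) - (trace (B a * M)).re - (trace (B a)).re + ∑ j, c j) := by
    filter_upwards [hp, hker] with a ha hk
    obtain ⟨U, b, hU, hb, hBa, hBE⟩ := spec ha
    rw [hBa] at hk
    have := Phi_diag hU hV hb hc hk
    rw [hBE, hC, hBa, trace_conj_dg hU, Complex.ofReal_re, neg_neg]
    exact this
  have hint : Integrable (fun a => -vnEnt (B a) - (trace (B a * M)).re - (trace (B a)).re + ∑ j, c j) μ :=
    ((hE.neg.sub (integrable_trace_mul hB M)).sub (integrable_trace hB)).add (integrable_const _)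
  have hval : ∫ a, (-vnEnt (B a) - (trace (B a * M)).re - (trace (B a)).re + ∑ j, c j) ∂μ
      = vnEnt (mint μ B) - ∫ a, vnEnt (B a) ∂μ := by
    rw [integral_add (f := fun a => -vnEnt (B a) - (trace (B a * M)).re - (trace (B a)).re)
        ((hE.neg.sub (integrable_trace_mul hB M)).sub (integrable_trace hB)) (integrable_const _),
      integral_sub (f := fun a => -vnEnt (B a) - (trace (B a * M)).re)
        (hE.neg.sub (integrable_trace_mul hB M)) (integrable_trace hB),
      integral_sub (f := fun a => -vnEnt (B a)) hE.neg (integrable_trace_mul hB M), integral_neg,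
      integral_trace_mul hB, integral_trace hB, integral_const, hCE, hC, trace_conj_dg hV, Complex.ofReal_re]
    have : (trace (V * dg c * Vᴴ * M)).re = ∑ j, c j * log (c j) := by
      rw [hM, trace_mul_conj_dg]
      have : Vᴴ * (V * dg c * Vᴴ) * V = (Vᴴ * V) * dg c * (Vᴴ * V) := by
          simp only [Matrix.mul_assoc]
      rw [this, hV, Matrix.one_mul, Matrix.mul_one, dg]
      simp [mul_comm]
    rw [this]
    simp
    ring
  have hnn : 0 ≤ᵐ[μ] fun a => -vnEnt (B a) - (trace (B a * M)).re - (trace (B a)).re + ∑ j, c j := by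
    filter_upwards [key] with a ha using ha.1
  refine ⟨?_, ?_⟩
  · rw [← hval]
    exact integral_nonneg_of_ae hnn
  · rw [← hval, ofReal_integral_eq_lintegral_ofReal hint hnn]
    refine lintegral_congr_ae ?_
    filter_upwards [key] with a ha using ha.2
end mint
end

section
open Matrix

section convs
variable {n d : ℕ} {μ ν : Measure (En n)} [IsProbabilityMeasure μ] [IsProbabilityMeasure ν]
  {B C : En n → Matrix (Fin d) (Fin d) ℂ}

/-- Convolution of a probability measure with a matrix-valued function. -/
def cv (μ : Measure (En n)) (B : En n → Matrix (Fin d) (Fin d) ℂ) (x : En n) :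
    Matrix (Fin d) (Fin d) ℂ := mint μ fun y => B (x - y)

/-- Regular matrix-valued densities. -/
structure Nice (B : En n → Matrix (Fin d) (Fin d) ℂ) : Prop where
  meas : ∀ i j, Measurable fun x => B x i j
  psd : ∀ᵐ x, (B x).PosSemidef
  int : ∀ i j, Integrable fun x => B x i j
  mom : Integrable fun x => ‖x‖ ^ 2 * (trace (B x)).re
  ent : Integrable fun x => vnEnt (B x)

lemma ae_sub_ae {P : En n → Prop} (h : ∀ᵐ x, P x) : ∀ᵐ w : En n, ∀ᵐ y ∂μ, P (w - y) := by
  have h1 := (quasiMeasurePreserving_sub_of_right_invariant (volume : Measure (En n)) μ).ae h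
  exact Measure.ae_ae_of_ae_prod h1

lemma int_prod {E : Type*} [NormedAddCommGroup E] [NormedSpace ℝ E] {f : En n → E} (hf : Integrable f) :
    Integrable (fun p : En n × En n => f (p.1 - p.2)) (volume.prod μ) := by
  have := Integrable.convolution_integrand (ContinuousLinearMap.lsmul ℝ ℝ) (integrable_const (1 : ℝ) (μ := μ)) hf
  simpa using this

lemma int_ae {E : Type*} [NormedAddCommGroup E] [NormedSpace ℝ E] {f : En n → E} (hf : Integrable f) :
    ∀ᵐ w : En n, Integrable (fun y => f (w - y)) μ :=
  (int_prod hf).prod_right_ae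

lemma int_cv {E : Type*} [NormedAddCommGroup E] [NormedSpace ℝ E] {f : En n → E}
    (hf : Integrable f) : Integrable (fun w => ∫ y, f (w - y) ∂μ) :=
  (int_prod (μ := μ) hf).integral_prod_left

lemma integral_cv {E : Type*} [NormedAddCommGroup E] [NormedSpace ℝ E] [CompleteSpace E] {f : En n → E}
    (hf : Integrable f) : ∫ w, ∫ y, f (w - y) ∂μ = ∫ x, f x := by
  rw [integral_integral_swap (int_prod (μ := μ) hf)]
  simp [integral_sub_right_eq_self]

lemma integrable_exp_neg_sq : Integrable fun x : En n => Real.exp (-‖x‖ ^ 2) := by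
  have := GaussianFourier.integrable_cexp_neg_mul_sq_norm_add (V := En n) (b := 1) (by simp) 0 0
  have := this.norm
  simpa [Complex.norm_exp, ← Complex.ofReal_pow] using this

lemma trace_int_ae (hB : Nice B) : ∀ᵐ w : En n, ∀ i j, Integrable (fun y => B (w - y) i j) μ := by
  rw [ae_all_iff]; intro i
  rw [ae_all_iff]; intro j
  exact int_ae (hB.int i j)

lemma meas_sub (hB : Nice B) (w : En n) (i j : Fin d) : Measurable fun y => B (w - y) i j :=
  (hB.meas i j).comp (measurable_const.sub measurable_id)

/-- The pointwise gap identity. -/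
lemma gap_ae (hB : Nice B) : ∀ᵐ w : En n, 0 ≤ vnEnt (cv μ B w) - ∫ y, vnEnt (B (w - y)) ∂μ ∧
    ∫⁻ y, Phi (B (w - y)) (cv μ B w) ∂μ
      = ENNReal.ofReal (vnEnt (cv μ B w) - ∫ y, vnEnt (B (w - y)) ∂μ) := by
  filter_upwards [trace_int_ae (μ := μ) hB, ae_sub_ae (μ := μ) hB.psd, int_ae (μ := μ) hB.ent] with w h1 h2 h3
  exact gap h1 h2 h3

lemma cv_meas (hB : Nice B) (i j : Fin d) : Measurable fun x => cv μ B x i j := by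
  have : Measurable fun p : En n × En n => B (p.1 - p.2) i j := (hB.meas i j).comp measurable_sub
  exact (this.stronglyMeasurable.integral_prod_right (ν := μ)).measurable

lemma cv_psd (hB : Nice B) : ∀ᵐ x, (cv μ B x).PosSemidef := by
  filter_upwards [trace_int_ae (μ := μ) hB, ae_sub_ae (μ := μ) hB.psd] with w h1 h2
  exact mint_psd h1 h2

lemma psd_trace_nonneg {A : Matrix (Fin d) (Fin d) ℂ} (hA : A.PosSemidef) : 0 ≤ (trace A).re :=
  (Complex.le_def.1 hA.trace_nonneg).1

lemma cv_mom (hμ : Integrable (fun y => ‖y‖ ^ 2) μ) (hB : Nice B) :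
    Integrable fun x => ‖x‖ ^ 2 * (trace (cv μ B x)).re := by
  have htr : Integrable fun x => (trace (B x)).re := integrable_trace hB.int
  have i1 : Integrable (fun p : En n × En n => ‖p.1 - p.2‖ ^ 2 * (trace (B (p.1 - p.2))).re)
      (volume.prod μ) := int_prod hB.mom
  have i2 : Integrable (fun p : En n × En n => ‖p.2‖ ^ 2 * (trace (B (p.1 - p.2))).re)
      (volume.prod μ) := by
    have := Integrable.convolution_integrand (ContinuousLinearMap.lsmul ℝ ℝ) hμ htr
    simpa using this
  have hm : Measurable fun x => (trace (B x)).re := by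
    simp only [trace, diag_apply]
    exact Complex.measurable_re.comp (Finset.measurable_sum _ fun i _ => hB.meas i i)
  have i3 : Integrable (fun p : En n × En n => ‖p.1‖ ^ 2 * (trace (B (p.1 - p.2))).re)
      (volume.prod μ) := by
    refine Integrable.mono' ((i1.add i2).const_mul 2) ?_ ?_
    · refine Measurable.aestronglyMeasurable ?_
      exact (measurable_fst.norm.pow_const 2).mul (hm.comp measurable_sub)
    · have h1 := (quasiMeasurePreserving_sub_of_right_invariant (volume : Measure (En n)) μ).ae hB.psd
      filter_upwards [h1] with p hp
      have h0 := psd_trace_nonneg hp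
      rw [Real.norm_of_nonneg (by positivity)]
      simp only [Pi.add_apply]
      rw [← add_mul, ← mul_assoc]
      refine mul_le_mul_of_nonneg_right ?_ h0
      have : ‖p.1‖ ≤ ‖p.1 - p.2‖ + ‖p.2‖ := by
        simpa using norm_add_le (p.1 - p.2) p.2
      nlinarith [norm_nonneg p.1, sq_nonneg (‖p.1 - p.2‖ - ‖p.2‖), norm_nonneg p.2, norm_nonneg (p.1 - p.2)]
  refine i3.integral_prod_left.congr ?_
  filter_upwards [trace_int_ae (μ := μ) hB] with w hw
  rw [integral_const_mul, cv, ← integral_trace hw]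

lemma cv_nice (hμ : Integrable (fun y => ‖y‖ ^ 2) μ) (hB : Nice B) : Nice (cv μ B) where
  meas := cv_meas hB
  psd := cv_psd hB
  int := fun i j => int_cv (hB.int i j)
  mom := cv_mom hμ hB
  ent := by
    have hi : Integrable fun w => ∫ y, vnEnt (B (w - y)) ∂μ := int_cv hB.ent
    have hj : Integrable fun w : En n => ‖w‖ ^ 2 * (trace (cv μ B w)).re + d * Real.exp (-‖w‖ ^ 2) :=
      (cv_mom hμ hB).add (integrable_exp_neg_sq.const_mul _)
    refine Integrable.mono' (hi.abs.add hj.abs) (vnEnt_aesm (cv_meas hB) (cv_psd hB)) ?_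
    filter_upwards [gap_ae (μ := μ) hB, cv_psd (μ := μ) hB] with w h1 h2
    have h3 := vnEnt_le h2 (Real.exp_pos (-‖w‖ ^ 2))
    rw [Real.log_exp] at h3
    have h4 := psd_trace_nonneg h2
    have h5 := h1.1
    simp only [Pi.add_apply]
    rw [Real.norm_eq_abs, abs_le]
    constructor
    · have := neg_abs_le (∫ y, vnEnt (B (w - y)) ∂μ)
      have := abs_nonneg (‖w‖ ^ 2 * (trace (cv μ B w)).re + d * Real.exp (-‖w‖ ^ 2))
      linarith
    · have := abs_nonneg (∫ y, vnEnt (B (w - y)) ∂μ)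
      have := le_abs_self (‖w‖ ^ 2 * (trace (cv μ B w)).re + d * Real.exp (-‖w‖ ^ 2))
      linarith

/-- Total entropy. -/
def HH (B : En n → Matrix (Fin d) (Fin d) ℂ) : ℝ := ∫ x, vnEnt (B x)

lemma HH_gap (hμ : Integrable (fun y => ‖y‖ ^ 2) μ) (hB : Nice B) :
    0 ≤ HH (cv μ B) - HH B ∧
    ∫⁻ w, ∫⁻ y, Phi (B (w - y)) (cv μ B w) ∂μ = ENNReal.ofReal (HH (cv μ B) - HH B) := by
  have hi : Integrable fun w => ∫ y, vnEnt (B (w - y)) ∂μ := int_cv hB.ent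
  have hC := (cv_nice hμ hB).ent
  have e : HH (cv μ B) - HH B = ∫ w, (vnEnt (cv μ B w) - ∫ y, vnEnt (B (w - y)) ∂μ) := by
    rw [integral_sub hC hi, integral_cv hB.ent]; rfl
  have hn : 0 ≤ᵐ[volume] fun w => vnEnt (cv μ B w) - ∫ y, vnEnt (B (w - y)) ∂μ := by
    filter_upwards [gap_ae (μ := μ) hB] with w h1 using h1.1
  rw [e]
  refine ⟨integral_nonneg_of_ae hn, ?_⟩
  have hs : Integrable (fun w => vnEnt (cv μ B w) - ∫ y, vnEnt (B (w - y)) ∂μ) := hC.sub hi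
  rw [ofReal_integral_eq_lintegral_ofReal hs hn]
  refine lintegral_congr_ae ?_
  filter_upwards [gap_ae (μ := μ) hB] with w h1 using h1.2

lemma cv_conv_ae (hB : Nice B) : ∀ᵐ w, cv (Measure.conv μ ν) B w = cv μ (cv ν B) w := by
  filter_upwards [trace_int_ae (μ := Measure.conv μ ν) hB] with w hw
  ext i j
  simp only [cv, mint, of_apply]
  rw [integral_conv (hw i j)]
  simp only [sub_sub]

lemma cv_comm_ae (hB : Nice B) : ∀ᵐ w, cv μ (cv ν B) w = cv ν (cv μ B) w := by
  filter_upwards [cv_conv_ae (μ := μ) (ν := ν) hB, cv_conv_ae (μ := ν) (ν := μ) hB] with w h1 h2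
  rw [← h1, ← h2, Measure.conv_comm]

lemma HH_wright (hμ : Integrable (fun y => ‖y‖ ^ 2) μ) (hν : Integrable (fun y => ‖y‖ ^ 2) ν)
    (hB : Nice B) : HH (cv μ (cv ν B)) - HH (cv ν B) ≤ HH (cv μ B) - HH B := by
  have h1 := HH_gap hμ (cv_nice hν hB)
  have h2 := HH_gap hμ hB
  rw [← ENNReal.ofReal_le_ofReal_iff h2.1, ← h1.2, ← h2.2]
  have hC := cv_nice hμ hB
  have m3 : Measurable fun p : (En n × En n) × En n =>
      Phi (B (p.1.1 - p.1.2 - p.2)) (cv μ B (p.1.1 - p.2)) := by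
    refine Phi_measurable (fun i j => ?_) (fun i j => ?_)
    · exact (hB.meas i j).comp ((measurable_fst.fst.sub measurable_fst.snd).sub measurable_snd)
    · exact (hC.meas i j).comp (measurable_fst.fst.sub measurable_snd)
  have mK : Measurable fun w => ∫⁻ y, Phi (B (w - y)) (cv μ B w) ∂μ := by
    refine Measurable.lintegral_prod_right' (f := fun p : En n × En n =>
      Phi (B (p.1 - p.2)) (cv μ B p.1)) ?_
    refine Phi_measurable (fun i j => ?_) (fun i j => ?_)
    · exact (hB.meas i j).comp (measurable_fst.sub measurable_snd)
    · exact (hC.meas i j).comp measurable_fst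
  calc ∫⁻ w, ∫⁻ y, Phi (cv ν B (w - y)) (cv μ (cv ν B) w) ∂μ
      ≤ ∫⁻ w, ∫⁻ y, ∫⁻ v, Phi (B (w - y - v)) (cv μ B (w - v)) ∂ν ∂μ := by
        refine lintegral_mono_ae ?_
        filter_upwards [cv_comm_ae (μ := μ) (ν := ν) hB, trace_int_ae (μ := ν) hC,
          ae_sub_ae (μ := μ) (trace_int_ae (μ := ν) hB)] with w e1 e2 e3
        refine lintegral_mono_ae ?_
        filter_upwards [e3] with y e4
        rw [e1]
        exact Phi_jensen e4 e2 (meas_sub hB (w - y)) (meas_sub hC w)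
    _ = ∫⁻ w, ∫⁻ v, ∫⁻ y, Phi (B (w - v - y)) (cv μ B (w - v)) ∂μ ∂ν := by
        refine lintegral_congr fun w => ?_
        rw [lintegral_lintegral_swap]
        · refine lintegral_congr fun v => lintegral_congr fun y => ?_
          rw [sub_right_comm]
        · have : Measurable fun q : En n × En n => ((w, q.1), q.2) :=
            (measurable_const.prodMk measurable_fst).prodMk measurable_snd
          exact (m3.comp this).aemeasurable
    _ = ∫⁻ v, (∫⁻ w, ∫⁻ y, Phi (B (w - v - y)) (cv μ B (w - v)) ∂μ) ∂ν := by
        rw [lintegral_lintegral_swap]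
        exact (mK.comp measurable_sub).aemeasurable
    _ = ∫⁻ v, (∫⁻ w, ∫⁻ y, Phi (B (w - y)) (cv μ B w) ∂μ) ∂ν := by
        refine lintegral_congr fun v => ?_
        exact lintegral_sub_right_eq_self (fun w => ∫⁻ y, Phi (B (w - y)) (cv μ B w) ∂μ) v
    _ = _ := by simp

lemma HH_congr (h : ∀ᵐ x, B x = C x) : HH B = HH C := by
  refine integral_congr_ae ?_
  filter_upwards [h] with x hx
  rw [hx]

end convs

/-- Decreasing increments together with monotonicity give concavity. -/
lemma concave_of_wright {f : ℝ → ℝ} (hm : ∀ t h, 0 ≤ t → 0 ≤ h → f t ≤ f (t + h))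
    (hw : ∀ t s h, 0 ≤ t → 0 ≤ s → 0 ≤ h → f (t + s + h) - f (t + s) ≤ f (t + h) - f t) :
    ConcaveOn ℝ (Set.Ici (0 : ℝ)) f := by
  refine concaveOn_of_slope_anti_adjacent (convex_Ici 0) ?_
  intro x y z hx hz hxy hyz
  have hx : 0 ≤ x := hx
  set p := y - x with hp
  set r := z - y with hr
  have hp0 : 0 < p := by linarith
  have hr0 : 0 < r := by linarith
  have hF : 0 ≤ f y - f x := by
    have := hm x p hx hp0.le
    rw [hp, add_sub_cancel] at this
    linarith
  have key : ∀ N : ℕ, 0 < N → f z - f y ≤ (r / p + 1 / N) * (f y - f x) := by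
    intro N hN
    have hN' : (0 : ℝ) < N := by exact_mod_cast hN
    set δ := p / N with hδ
    have hδ0 : 0 < δ := by positivity
    set D := f y - f (y - δ) with hD
    have hδp : δ ≤ p := div_le_self hp0.le (by exact_mod_cast hN)
    have hyδ : 0 ≤ y - δ := by linarith
    have hup : ∀ k : ℕ, f (y + k * δ) - f y ≤ k * D := by
      intro k
      induction k with
      | zero => simp
      | succ k ih =>
        have h1 := hw (y - δ) ((k + 1) * δ) δ hyδ (by positivity) hδ0.le
        have e1 : y - δ + (k + 1) * δ + δ = y + ((k + 1 : ℕ) : ℝ) * δ := by push_cast; ring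
        have e2 : y - δ + (k + 1) * δ = y + k * δ := by ring
        have e3 : y - δ + δ = y := by ring
        rw [e1, e2, e3] at h1
        push_cast at h1 ⊢
        linarith
    have hdown : ∀ k : ℕ, k ≤ N → k * D ≤ f y - f (y - k * δ) := by
      intro k
      induction k with
      | zero => simp
      | succ k ih =>
        intro hk
        have hk' : ((k : ℝ) + 1) ≤ N := by exact_mod_cast hk
        have hkp : ((k : ℝ) + 1) * δ ≤ p := by
          calc ((k : ℝ) + 1) * δ ≤ N * δ := by gcongr
            _ = p := by rw [hδ]; field_simp
        have h1 := hw (y - (k + 1) * δ) (k * δ) δ (by linarith) (by positivity) hδ0.le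
        have e1 : y - (k + 1) * δ + k * δ + δ = y := by ring
        have e2 : y - (k + 1) * δ + k * δ = y - δ := by ring
        have e3 : y - (k + 1) * δ + δ = y - k * δ := by ring
        rw [e1, e2, e3] at h1
        have := ih (by omega)
        push_cast
        linarith
    have hDN : N * D ≤ f y - f x := by
      have := hdown N le_rfl
      have e : y - N * δ = x := by rw [hδ, hp]; field_simp; ring
      rwa [e] at this
    have hD0 : 0 ≤ D := by
      have := hm (y - δ) δ hyδ hδ0.le
      rw [sub_add_cancel] at this
      linarith
    set m := ⌊r / δ⌋₊ with hmdef
    have hm1 : r / δ < m + 1 := Nat.lt_floor_add_one _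
    have hm2 : (m : ℝ) ≤ r / δ := Nat.floor_le (by positivity)
    have hz1 : f z ≤ f (y + ((m + 1 : ℕ) : ℝ) * δ) := by
      have h3 : r ≤ (m + 1) * δ := by
        rw [div_lt_iff₀ hδ0] at hm1; exact hm1.le
      have := hm z ((m + 1) * δ - r) hz (by linarith)
      have e : z + ((m + 1) * δ - r) = y + ((m + 1 : ℕ) : ℝ) * δ := by push_cast; rw [hr]; ring
      rwa [e] at this
    have hz2 := hup (m + 1)
    have h5 : ((m + 1 : ℕ) : ℝ) * D ≤ (r / δ + 1) * D := by
      push_cast; gcongr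
    have h6 : (r / δ + 1) * D = (r / p + 1 / N) * (N * D) := by
      rw [hδ]; field_simp
    have h7 : (r / p + 1 / N) * (N * D) ≤ (r / p + 1 / N) * (f y - f x) := by
      gcongr
    linarith
  have hlim : Tendsto (fun N : ℕ => (r / p + 1 / (N : ℝ)) * (f y - f x)) atTop
      (𝓝 ((r / p + 0) * (f y - f x))) :=
    (tendsto_one_div_atTop_nhds_zero_nat.const_add _).mul_const _
  have hfin : f z - f y ≤ (r / p + 0) * (f y - f x) := by
    refine ge_of_tendsto hlim ?_
    filter_upwards [eventually_gt_atTop 0] with N hN using key N hN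
  rw [add_zero] at hfin
  rw [div_le_div_iff₀ hr0 hp0]
  calc (f z - f y) * p ≤ (r / p * (f y - f x)) * p := by gcongr
    _ = (f y - f x) * r := by field_simp
end

section
open Matrix

section gauss
variable {n d : ℕ}

/-- The standard Gaussian measure, through its density. -/
def gm (n : ℕ) : Measure (En n) := volume.withDensity fun z => ENNReal.ofReal (gaussDensity n z)

lemma gd_cont : Continuous (gaussDensity n) := by
  unfold gaussDensity; fun_prop

lemma gd_nonneg (z : En n) : 0 ≤ gaussDensity n z := by
  unfold gaussDensity; positivity

lemma gm_integral {E : Type*} [NormedAddCommGroup E] [NormedSpace ℝ E] (f : En n → E) :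
    ∫ z, f z ∂(gm n) = ∫ z, gaussDensity n z • f z := by
  unfold gm
  rw [integral_withDensity_eq_integral_toReal_smul (gd_cont.measurable.ennreal_ofReal)
    (ae_of_all _ fun _ => ENNReal.ofReal_lt_top)]
  refine integral_congr_ae (ae_of_all _ fun z => ?_)
  simp [ENNReal.toReal_ofReal (gd_nonneg z)]

lemma gd_eq (z : En n) : gaussDensity n z = (2 * π) ^ (-(n : ℝ) / 2) * rexp (-(1 / 2) * ‖z‖ ^ 2) := by
  unfold gaussDensity; congr 2; ring

lemma gd_integrable : Integrable (gaussDensity n) := by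
  have := GaussianFourier.integrable_cexp_neg_mul_sq_norm_add (V := En n) (b := 1 / 2) (by norm_num) 0 0
  have := (this.norm).const_mul ((2 * π) ^ (-(n : ℝ) / 2))
  refine this.congr (ae_of_all _ fun z => ?_)
  simp only
  rw [gd_eq, Complex.norm_exp]
  congr 2
  simp [← Complex.ofReal_pow]

lemma gd_int : ∫ z, gaussDensity n z = 1 := by
  simp_rw [gd_eq]
  rw [integral_const_mul, GaussianFourier.integral_rexp_neg_mul_sq_norm (by norm_num)]
  rw [finrank_euclideanSpace_fin, show π / (1 / 2) = 2 * π by ring, ← Real.rpow_add (by positivity)]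
  rw [show -(n : ℝ) / 2 + n / 2 = 0 by ring, Real.rpow_zero]

instance : IsProbabilityMeasure (gm n) := by
  refine ⟨?_⟩
  unfold gm
  rw [withDensity_apply _ MeasurableSet.univ, Measure.restrict_univ,
    ← ofReal_integral_eq_lintegral_ofReal gd_integrable (ae_of_all _ gd_nonneg), gd_int]
  simp

lemma gm_charFun (t : En n) : charFun (gm n) t = Complex.exp (-‖t‖ ^ 2 / 2) := by
  rw [charFun_apply, gm_integral]
  have := GaussianFourier.integral_cexp_neg_mul_sq_norm_add (V := En n) (b := ((1 / 2 : ℝ) : ℂ))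
    (by simp) Complex.I t
  have h2 : ∀ z : En n, gaussDensity n z • Complex.exp (↑(inner ℝ z t) * Complex.I)
      = ((2 * π) ^ (-(n : ℝ) / 2) : ℝ) * Complex.exp (-((1 / 2 : ℝ) : ℂ) * ‖z‖ ^ 2 + Complex.I * (inner ℝ t z)) := by
    intro z
    rw [gd_eq, Complex.real_smul, Complex.exp_add, real_inner_comm]
    push_cast
    ring_nf
  simp_rw [h2]
  rw [integral_const_mul, this, ← mul_assoc, finrank_euclideanSpace_fin]
  have h3 : (((π : ℝ) : ℂ) / ((1 / 2 : ℝ) : ℂ)) ^ ((n : ℂ) / 2) = (((2 * π) ^ ((n : ℝ) / 2) : ℝ) : ℂ) := by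
    rw [Complex.ofReal_cpow (by positivity)]
    push_cast
    congr 1
    ring
  rw [h3, ← Complex.ofReal_mul, ← Real.rpow_add (by positivity),
    show -(n : ℝ) / 2 + n / 2 = 0 by ring, Real.rpow_zero]
  simp only [Complex.ofReal_one, one_mul, Complex.I_sq]
  congr 1
  push_cast
  ring

lemma gm_mom : Integrable (fun y => ‖y‖ ^ 2) (gm n) := by
  have h : gm n = ProbabilityTheory.stdGaussian (En n) := by
    refine Measure.ext_of_charFun (funext fun t => ?_)
    rw [gm_charFun, ProbabilityTheory.charFun_stdGaussian]
  rw [h]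
  have := (ProbabilityTheory.IsGaussian.memLp_two_id (μ := ProbabilityTheory.stdGaussian (En n)))
  exact this.integrable_norm_pow (by norm_num)

/-- The law of `c Z`. -/
def gs (n : ℕ) (c : ℝ) : Measure (En n) := (gm n).map (c • ·)

instance (c : ℝ) : IsProbabilityMeasure (gs n c) :=
  Measure.isProbabilityMeasure_map (by fun_prop)

lemma gs_integral {E : Type*} [NormedAddCommGroup E] [NormedSpace ℝ E] {c : ℝ} {f : En n → E}
    (hf : StronglyMeasurable f) :
    ∫ y, f y ∂(gs n c) = ∫ z, gaussDensity n z • f (c • z) := by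
  unfold gs
  rw [integral_map (by fun_prop) hf.aestronglyMeasurable, gm_integral]

lemma gs_mom (c : ℝ) : Integrable (fun y => ‖y‖ ^ 2) (gs n c) := by
  unfold gs
  rw [integrable_map_measure (by fun_prop) (by fun_prop)]
  have := (gm_mom (n := n)).const_mul (c ^ 2)
  refine this.congr (ae_of_all _ fun z => ?_)
  simp [norm_smul, mul_pow]

lemma gs_conv {s t : ℝ} (hs : 0 ≤ s) (ht : 0 ≤ t) :
    Measure.conv (gs n (√s)) (gs n (√t)) = gs n (√(t + s)) := by
  refine Measure.ext_of_charFun (funext fun x => ?_)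
  rw [charFun_conv]
  unfold gs
  rw [charFun_map_smul, charFun_map_smul, charFun_map_smul, gm_charFun, gm_charFun, gm_charFun,
    ← Complex.exp_add]
  congr 1
  simp only [norm_smul, Complex.ofReal_mul, mul_pow, Real.norm_eq_abs]
  simp only [← Complex.ofReal_pow, sq_abs]
  rw [Real.sq_sqrt hs, Real.sq_sqrt ht, Real.sq_sqrt (by positivity)]
  push_cast
  ring

end gauss
end

section
open Matrix

section final
variable {n d : ℕ}

lemma condEnt_congr {p p' : En n → ℝ} {ρ ρ' : En n → Matrix (Fin d) (Fin d) ℂ}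
    (hp : ∀ᵐ x, p x = p' x) (hρ : ∀ᵐ x, ρ x = ρ' x) : condEnt p ρ = condEnt p' ρ' := by
  unfold condEnt clEnt avgState
  have h1 : ∫ a, p a * vnEnt (ρ a) = ∫ a, p' a * vnEnt (ρ' a) := by
    refine integral_congr_ae ?_
    filter_upwards [hp, hρ] with x h1 h2
    rw [h1, h2]
  have h2 : ∫ a, p a * log (p a) = ∫ a, p' a * log (p' a) := by
    refine integral_congr_ae ?_
    filter_upwards [hp] with x h1
    rw [h1]
  have h3 : ∀ i j, ∫ a, (p a : ℂ) * ρ a i j = ∫ a, (p' a : ℂ) * ρ' a i j := by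
    intro i j
    refine integral_congr_ae ?_
    filter_upwards [hp, hρ] with x h1 h2
    rw [h1, h2]
  simp_rw [h1, h2, h3]

lemma psd_trace_eq {A : Matrix (Fin d) (Fin d) ℂ} (hA : A.PosSemidef) :
    trace A = ((trace A).re : ℂ) := by
  have := (Complex.le_def.1 hA.trace_nonneg).2
  apply Complex.ext
  · simp
  · simp [← this]

lemma psd_normalize {A : Matrix (Fin d) (Fin d) ℂ} (hA : A.PosSemidef) :
    ∃ ρ : Matrix (Fin d) (Fin d) ℂ, ρ = ((trace A).re : ℂ)⁻¹ • A ∧ ρ.PosSemidef ∧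
      (trace ρ).re ≤ 1 ∧ ((trace A).re : ℂ) • ρ = A ∧
      vnEnt A = (trace A).re * vnEnt ρ - (trace A).re * log (trace A).re := by
  have h0 := psd_trace_nonneg hA
  refine ⟨_, rfl, ?_⟩
  have hp : (((trace A).re : ℂ)⁻¹ • A).PosSemidef := by
    refine hA.smul ?_
    rw [← Complex.ofReal_inv]
    exact_mod_cast inv_nonneg.2 h0
  rcases eq_or_ne (trace A).re 0 with h | h
  · have hz : A = 0 := by
      have := psd_trace_eq hA
      rw [h] at this
      exact hA.trace_eq_zero_iff.1 (by simpa using this)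
    refine ⟨hp, ?_, ?_, ?_⟩
    · simp [hz]
    · simp [hz]
    · have := vnEnt_smul hA le_rfl
      subst hz
      simpa using this
  · have hc : ((trace A).re : ℂ) ≠ 0 := by exact_mod_cast h
    have ht : trace (((trace A).re : ℂ)⁻¹ • A) = 1 := by
      rw [trace_smul, smul_eq_mul]
      nth_rw 2 [psd_trace_eq hA]
      exact inv_mul_cancel₀ hc
    have he : ((trace A).re : ℂ) • (((trace A).re : ℂ)⁻¹ • A) = A := by
      rw [smul_smul, mul_inv_cancel₀ hc, one_smul]
    refine ⟨hp, by simp [ht], he, ?_⟩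
    have := vnEnt_smul hp h0
    rw [he, ht] at this
    simpa using this

lemma condEnt_nice {B : En n → Matrix (Fin d) (Fin d) ℂ} (hB : Nice B) :
    condEnt (fun x => (trace (B x)).re) (fun x => ((trace (B x)).re : ℂ)⁻¹ • B x)
      = HH B - vnEnt (mint volume B) := by
  have htr : Integrable fun x => (trace (B x)).re := integrable_trace hB.int
  have mtr : Measurable fun x => (trace (B x)).re := by
    simp only [trace, diag_apply]
    exact Complex.measurable_re.comp (Finset.measurable_sum _ fun i _ => hB.meas i i)
  have hN := hB.psd.mono fun x hx => psd_normalize hx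
  have hv : AEStronglyMeasurable (fun x => vnEnt (((trace (B x)).re : ℂ)⁻¹ • B x)) := by
    refine vnEnt_aesm (fun i j => ?_) ?_
    · simp only [Matrix.smul_apply, smul_eq_mul]
      exact (Complex.measurable_ofReal.comp mtr).inv.mul (hB.meas i j)
    · filter_upwards [hN] with x ⟨ρ, h, h1, _⟩
      rw [← h]; exact h1
  have i1 : Integrable fun x => (trace (B x)).re * vnEnt (((trace (B x)).re : ℂ)⁻¹ • B x) := by
    refine (htr.const_mul (d : ℝ)).mono' (mtr.aestronglyMeasurable.mul hv) ?_
    filter_upwards [hN, hB.psd] with x ⟨ρ, h, h1, h2, _⟩ hp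
    rw [← h]
    have h0 := psd_trace_nonneg hp
    have hs := vnEnt_state h1 h2
    rw [Real.norm_eq_abs, abs_of_nonneg (mul_nonneg h0 hs.1), mul_comm]
    exact mul_le_mul_of_nonneg_right hs.2 h0
  have hE : ∀ᵐ x, (trace (B x)).re * log (trace (B x)).re
      = (trace (B x)).re * vnEnt (((trace (B x)).re : ℂ)⁻¹ • B x) - vnEnt (B x) := by
    filter_upwards [hN] with x ⟨ρ, h, h1, h2, h3, h4⟩
    rw [← h, h4]; ring
  have hA : avgState (fun x => (trace (B x)).re) (fun x => ((trace (B x)).re : ℂ)⁻¹ • B x)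
      = mint volume B := by
    ext i j
    simp only [avgState, mint, of_apply]
    refine integral_congr_ae ?_
    filter_upwards [hN] with x ⟨ρ, h, h1, h2, h3, h4⟩
    rw [← h]
    nth_rw 2 [← h3]
    rfl
  unfold condEnt clEnt
  rw [hA, integral_congr_ae hE, integral_sub i1 hB.ent, HH]
  ring

lemma psd_entry_le {A : Matrix (Fin d) (Fin d) ℂ} (hA : A.PosSemidef) (i j : Fin d) :
    ‖A i j‖ ≤ (trace A).re := by
  obtain ⟨U, b, hU, hb, hA, -⟩ := spec hA
  rw [hA, trace_conj_dg hU, Complex.ofReal_re, Matrix.mul_apply]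
  have hmem : U ∈ Matrix.unitaryGroup (Fin d) ℂ := Matrix.mem_unitaryGroup_iff'.2 hU
  refine (norm_sum_le _ _).trans (Finset.sum_le_sum fun k _ => ?_)
  rw [dg, mul_diagonal, conjTranspose_apply, norm_mul, norm_mul, norm_star, Complex.norm_real,
    Real.norm_eq_abs, abs_of_nonneg (hb k)]
  have h1 := entry_norm_bound_of_unitary hmem i k
  have h2 := entry_norm_bound_of_unitary hmem j k
  calc ‖U i k‖ * b k * ‖U j k‖ ≤ 1 * b k * 1 := by
        gcongr
        · exact mul_nonneg zero_le_one (hb k)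
        · exact hb k
    _ = b k := by ring

lemma base_nice {q : En n → ℝ} {σ : En n → Matrix (Fin d) (Fin d) ℂ} (hcq : IsCQState q σ)
    (hX2 : Integrable fun x : En n => ‖x‖ ^ 2 * q x) (hfin : EntFinite q σ) :
    Nice (fun x => (q x : ℂ) • σ x) := by
  obtain ⟨hm, h0, h1, hc, hs⟩ := hcq
  have hq : Integrable q := by
    by_contra h
    rw [integral_undef h] at h1
    exact zero_ne_one h1
  have ht : ∀ x, (trace ((q x : ℂ) • σ x)).re = q x := by
    intro x
    rw [trace_smul, (hs x).2]; simp
  have hp : ∀ x, ((q x : ℂ) • σ x).PosSemidef := fun x =>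
    (hs x).1.smul (by exact_mod_cast h0 x)
  have hme : ∀ i j, Measurable fun x => ((q x : ℂ) • σ x) i j := by
    intro i j
    simp only [Matrix.smul_apply, smul_eq_mul]
    refine (Complex.measurable_ofReal.comp hm).mul ?_
    exact (hc.matrix_elem i j).measurable
  refine ⟨hme, ae_of_all _ hp, fun i j => ?_, ?_, ?_⟩
  · refine hq.mono' (hme i j).aestronglyMeasurable (ae_of_all _ fun x => ?_)
    have := psd_entry_le (hp x) i j
    rwa [ht] at this
  · simpa only [ht] using hX2
  · have : (fun x => vnEnt ((q x : ℂ) • σ x)) = fun x => q x * vnEnt (σ x) - q x * log (q x) := by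
      funext x
      rw [vnEnt_smul (hs x).1 (h0 x), (hs x).2]
      simp
    rw [this]
    exact hfin.2.sub hfin.1

lemma heat_eq {q : En n → ℝ} {σ : En n → Matrix (Fin d) (Fin d) ℂ} (hcq : IsCQState q σ)
    (hX2 : Integrable fun x : En n => ‖x‖ ^ 2 * q x) (hfin : EntFinite q σ) (t : ℝ) :
    heatEnt q σ t = HH (cv (gs n (√t)) fun x => (q x : ℂ) • σ x)
      - vnEnt (mint volume fun x => (q x : ℂ) • σ x) := by
  have hN := base_nice hcq hX2 hfin
  have hN' := cv_nice (gs_mom (n := n) (√t)) hN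
  have e1 : mint volume (cv (gs n (√t)) fun x => (q x : ℂ) • σ x)
      = mint volume fun x => (q x : ℂ) • σ x := by
    ext i j
    exact integral_cv (hN.int i j)
  rw [← e1, ← condEnt_nice hN']
  have ht : ∀ x, (trace ((q x : ℂ) • σ x)).re = q x := by
    intro x
    rw [trace_smul, (hcq.2.2.2.2 x).2]; simp
  have hq : ∀ᵐ x, margFst (noisyDensity (√t) q) x
      = (trace (cv (gs n (√t)) (fun x => (q x : ℂ) • σ x) x)).re := by
    filter_upwards [trace_int_ae (μ := gs n (√t)) hN] with x hx
    unfold cv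
    rw [← integral_trace hx]
    simp only [ht, margFst, noisyDensity]
    rw [gs_integral (f := fun y => q (x - y))]
    · rfl
    · exact (hcq.1.comp (measurable_const.sub measurable_id)).stronglyMeasurable
  refine condEnt_congr hq ?_
  filter_upwards [hq] with x hx
  rw [margFstState, hx]
  congr 1
  ext i j
  simp only [of_apply, cv, mint]
  rw [gs_integral (f := fun y => ((q (x - y) : ℂ) • σ (x - y)) i j)
    (meas_sub hN x i j).stronglyMeasurable]
  refine integral_congr_ae (ae_of_all _ fun z => ?_)
  simp [noisyDensity, noisyState, mul_assoc]

lemma main_aux (q : En n → ℝ) (σ : En n → Matrix (Fin d) (Fin d) ℂ) (hcq : IsCQState q σ)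
    (hX2 : Integrable fun x : En n => ‖x‖ ^ 2 * q x) (hfin : EntFinite q σ) :
    ConcaveOn ℝ (Set.Ici (0 : ℝ)) (fun t : ℝ => heatEnt q σ t - condEnt q σ) := by
  have hN := base_nice hcq hX2 hfin
  have hadd : ∀ t s, 0 ≤ t → 0 ≤ s →
      HH (cv (gs n (√(t + s))) fun x => (q x : ℂ) • σ x)
        = HH (cv (gs n (√s)) (cv (gs n (√t)) fun x => (q x : ℂ) • σ x)) := by
    intro t s ht hs
    rw [← gs_conv hs ht]
    exact HH_congr (cv_conv_ae hN)
  have hn : ∀ t, Nice (cv (gs n (√t)) fun x => (q x : ℂ) • σ x) := fun t => cv_nice (gs_mom _) hN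
  refine concave_of_wright ?_ ?_
  · intro t h ht hh
    simp only [heat_eq hcq hX2 hfin]
    rw [hadd t h ht hh]
    have := (HH_gap (gs_mom (√h)) (hn t)).1
    linarith
  · intro t s h ht hs hh
    simp only [heat_eq hcq hX2 hfin]
    have e : HH (cv (gs n (√(t + s + h))) fun x => (q x : ℂ) • σ x)
        = HH (cv (gs n (√h)) (cv (gs n (√s)) (cv (gs n (√t)) fun x => (q x : ℂ) • σ x))) := by
      rw [add_assoc, hadd t (s + h) ht (by positivity), ← gs_conv hh hs]
      exact HH_congr (cv_conv_ae (hn t))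
    rw [e, hadd t s ht hs, hadd t h ht hh]
    have := HH_wright (gs_mom (√h)) (gs_mom (√s)) (hn t)
    linarith

end final
end

end Helpers

/-- Concavity of the conditional entropy along the heat semigroup, with quantum
conditioning: `t ↦ I(X + √t Z : Z | M) = S(X + √t Z | M) - S(X|M)` is concave on `[0, ∞)`. -/
theorem condEnt_heat_concave {n d : ℕ}
    (q : En n → ℝ) (σ : En n → Matrix (Fin d) (Fin d) ℂ)
    (hcq : IsCQState q σ)
    (hX2 : Integrable fun x : En n => ‖x‖ ^ 2 * q x)
    (hfin : EntFinite q σ) :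
    ConcaveOn ℝ (Set.Ici (0 : ℝ)) (fun t : ℝ => heatEnt q σ t - condEnt q σ) := by
  exact main_aux q σ hcq hX2 hfin

end
end

section
/- de Bruijn identity with quantum conditioning: Let X be a random variable with values in ℝⁿ correlated with a finite-dimensional quantum system M, with E‖X‖² finite, with the map x ↦ ρ(x) (the state of M conditioned on X = x) continuous in trace norm, and with S(X|M) finite. Let Z be a standard Gaussian random variable on ℝⁿ independent of (X, M). Then the right derivative at t = 0 of t ↦ S(X + √t Z | M) exists (finite or +∞) and equals the conditional Fisher information J(X|M). -/
open MeasureTheory Real Filter Topology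
open scoped ComplexOrder

noncomputable section

set_option linter.unusedSectionVars false

namespace QD

section MatrixAlgebra
open Matrix

variable {d : ℕ}

/-- squared overlaps of the eigenbases -/
def ov {A B : Matrix (Fin d) (Fin d) ℂ} (hA : A.IsHermitian) (hB : B.IsHermitian)
    (i j : Fin d) : ℝ :=
  ‖((star (hA.eigenvectorUnitary : Matrix (Fin d) (Fin d) ℂ)) *
    (hB.eigenvectorUnitary : Matrix (Fin d) (Fin d) ℂ)) i j‖ ^ 2

lemma spectral' {A : Matrix (Fin d) (Fin d) ℂ} (hA : A.IsHermitian) :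
    A = (hA.eigenvectorUnitary : Matrix (Fin d) (Fin d) ℂ) *
      diagonal (fun i => (hA.eigenvalues i : ℂ)) *
      star (hA.eigenvectorUnitary : Matrix (Fin d) (Fin d) ℂ) := by
  conv_lhs => rw [hA.spectral_theorem]
  rw [Unitary.conjStarAlgAut_apply]
  rfl

lemma cfc_spectral {A : Matrix (Fin d) (Fin d) ℂ} (hA : A.IsHermitian) (φ : ℝ → ℝ) :
    cfc φ A = (hA.eigenvectorUnitary : Matrix (Fin d) (Fin d) ℂ) *
      diagonal (fun i => (φ (hA.eigenvalues i) : ℂ)) *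
      star (hA.eigenvectorUnitary : Matrix (Fin d) (Fin d) ℂ) := by
  rw [hA.cfc_eq, Matrix.IsHermitian.cfc, Unitary.conjStarAlgAut_apply]
  rfl

lemma ov_nonneg {A B : Matrix (Fin d) (Fin d) ℂ} (hA : A.IsHermitian) (hB : B.IsHermitian)
    (i j : Fin d) : 0 ≤ ov hA hB i j := by unfold ov; positivity

lemma unit_row (M : Matrix (Fin d) (Fin d) ℂ) (hM : M * star M = 1) (i : Fin d) :
    ∑ j, ‖M i j‖ ^ 2 = 1 := by
  have h := congrFun (congrFun hM i) i
  rw [Matrix.mul_apply] at h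
  simp only [star_apply, one_apply_eq] at h
  have : ((∑ j, ‖M i j‖ ^ 2 : ℝ) : ℂ) = 1 := by
    rw [← h]; push_cast
    refine Finset.sum_congr rfl fun j _ => ?_
    rw [← Complex.conj_mul', mul_comm]; rfl
  exact_mod_cast this

lemma unit_col (M : Matrix (Fin d) (Fin d) ℂ) (hM : star M * M = 1) (j : Fin d) :
    ∑ i, ‖M i j‖ ^ 2 = 1 := by
  have := unit_row (star M) (by simpa using hM) j
  simpa [star_apply] using this

lemma ov_sum_right {A B : Matrix (Fin d) (Fin d) ℂ} (hA : A.IsHermitian) (hB : B.IsHermitian)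
    (i : Fin d) : ∑ j, ov hA hB i j = 1 := by
  refine unit_row _ ?_ i
  have h1 : (hB.eigenvectorUnitary : Matrix (Fin d) (Fin d) ℂ) * star (hB.eigenvectorUnitary : Matrix (Fin d) (Fin d) ℂ) = 1 :=
    Unitary.coe_mul_star_self hB.eigenvectorUnitary
  have h2 := Unitary.coe_star_mul_self hA.eigenvectorUnitary
  simp only [star_mul, star_star]
  rw [Matrix.mul_assoc, ← Matrix.mul_assoc (hB.eigenvectorUnitary : Matrix (Fin d) (Fin d) ℂ), h1, Matrix.one_mul, h2]

lemma ov_sum_left {A B : Matrix (Fin d) (Fin d) ℂ} (hA : A.IsHermitian) (hB : B.IsHermitian)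
    (j : Fin d) : ∑ i, ov hA hB i j = 1 := by
  refine unit_col _ ?_ j
  have h1 : (hA.eigenvectorUnitary : Matrix (Fin d) (Fin d) ℂ) * star (hA.eigenvectorUnitary : Matrix (Fin d) (Fin d) ℂ) = 1 :=
    Unitary.coe_mul_star_self hA.eigenvectorUnitary
  have h2 := Unitary.coe_star_mul_self hB.eigenvectorUnitary
  simp only [star_mul, star_star]
  rw [Matrix.mul_assoc, ← Matrix.mul_assoc (hA.eigenvectorUnitary : Matrix (Fin d) (Fin d) ℂ), h1, Matrix.one_mul, h2]

lemma trace_cfc {A : Matrix (Fin d) (Fin d) ℂ} (hA : A.IsHermitian) (φ : ℝ → ℝ) :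
    (cfc φ A).trace = ((∑ i, φ (hA.eigenvalues i) : ℝ) : ℂ) := by
  rw [cfc_spectral hA, Matrix.trace_mul_comm, ← Matrix.mul_assoc,
    Unitary.coe_star_mul_self, Matrix.one_mul, Matrix.trace_diagonal]
  push_cast; rfl

/-- trace of `D₁ M D₂ Mᴴ` for real diagonals -/
lemma trace_diag_conj (a b : Fin d → ℝ) (M : Matrix (Fin d) (Fin d) ℂ) :
    (diagonal (fun i => (a i : ℂ)) * M * diagonal (fun j => (b j : ℂ)) * star M).trace
      = ((∑ i, ∑ j, a i * b j * ‖M i j‖ ^ 2 : ℝ) : ℂ) := by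
  simp only [Matrix.trace, Matrix.diag_apply, Matrix.mul_apply (N := star M), Matrix.mul_diagonal,
    Matrix.diagonal_mul, star_apply]
  push_cast
  refine Finset.sum_congr rfl fun i _ => Finset.sum_congr rfl fun j _ => ?_
  rw [← Complex.conj_mul']
  simp only [RCLike.star_def]
  ring

lemma trace_cfc_mul {A B : Matrix (Fin d) (Fin d) ℂ} (hA : A.IsHermitian) (hB : B.IsHermitian)
    (φ ψ : ℝ → ℝ) :
    (cfc φ A * cfc ψ B).trace =
      ((∑ i, ∑ j, φ (hA.eigenvalues i) * ψ (hB.eigenvalues j) * ov hA hB i j : ℝ) : ℂ) := by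
  rw [cfc_spectral hA, cfc_spectral hB]
  unfold ov
  rw [← trace_diag_conj]
  rw [Matrix.mul_assoc, Matrix.mul_assoc, Matrix.trace_mul_comm]
  simp only [star_mul, star_star, Matrix.mul_assoc]

lemma vnEnt_eq {A : Matrix (Fin d) (Fin d) ℂ} (hA : A.IsHermitian) :
    vnEnt A = ∑ i, negMulLog (hA.eigenvalues i) := by
  unfold vnEnt
  rw [dif_pos hA]
  simp [negMulLog, Finset.sum_neg_distrib]

lemma vnEnt_eq_cfc {A : Matrix (Fin d) (Fin d) ℂ} (hA : A.IsHermitian) :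
    vnEnt A = (cfc negMulLog A).trace.re := by
  rw [vnEnt_eq hA, trace_cfc hA, Complex.ofReal_re]

open scoped Matrix.Norms.L2Operator in
lemma continuousOn_cfc_herm (φ : ℝ → ℝ) (hφ : Continuous φ) :
    ContinuousOn (fun A : Matrix (Fin d) (Fin d) ℂ => cfc φ A) {A | A.IsHermitian} := by
  refine ContinuousOn.cfc_of_mem_nhdsSet (s := Set.univ) φ (by simp) continuousOn_id
    (fun x hx => hx) hφ.continuousOn

lemma continuous_tr : Continuous (fun A : Matrix (Fin d) (Fin d) ℂ => A.trace.re) :=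
  Complex.continuous_re.comp (Continuous.matrix_trace continuous_id)

lemma continuousOn_vnEnt :
    ContinuousOn (fun A : Matrix (Fin d) (Fin d) ℂ => vnEnt A) {A | A.IsHermitian} := by
  refine (continuous_tr.comp_continuousOn (continuousOn_cfc_herm negMulLog continuous_negMulLog)).congr ?_
  intro A hA
  exact vnEnt_eq_cfc hA

/-- relative entropy -/
def rD (A B : Matrix (Fin d) (Fin d) ℂ) : ℝ := -vnEnt A - (A * cfc Real.log B).trace.re

lemma rD_eq {A B : Matrix (Fin d) (Fin d) ℂ} (hA : A.IsHermitian) (hB : B.IsHermitian) :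
    rD A B = ∑ i, ∑ j, (hA.eigenvalues i * (Real.log (hA.eigenvalues i)
      - Real.log (hB.eigenvalues j))) * ov hA hB i j := by
  have h : A * cfc Real.log B = cfc (id : ℝ → ℝ) A * cfc Real.log B := by
    rw [cfc_id ℝ A hA.isSelfAdjoint]
  unfold rD
  rw [h, trace_cfc_mul hA hB, Complex.ofReal_re, vnEnt_eq hA]
  rw [← Finset.sum_neg_distrib, ← Finset.sum_sub_distrib]
  refine Finset.sum_congr rfl fun i _ => ?_
  have : -negMulLog (hA.eigenvalues i) = ∑ j, (hA.eigenvalues i * Real.log (hA.eigenvalues i)) * ov hA hB i j := by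
    rw [← Finset.mul_sum, ov_sum_right, negMulLog]; ring
  rw [this, ← Finset.sum_sub_distrib]
  refine Finset.sum_congr rfl fun j _ => ?_
  simp only [id]; ring

def rQ {A B : Matrix (Fin d) (Fin d) ℂ} (hA : A.IsHermitian) (hB : B.IsHermitian) (u : ℝ) : ℝ :=
  ∑ i, ∑ j, ((hA.eigenvalues i) ^ 2 / (hB.eigenvalues j + u * hA.eigenvalues i)) * ov hA hB i j

/-- linear functional appearing in the variational formula -/
def lQ (u : ℝ) (W A B : Matrix (Fin d) (Fin d) ℂ) : ℝ :=
  2 * (A * W).trace.re - (B * (W * star W)).trace.re - u * (A * (star W * W)).trace.re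

lemma lQ_eq {A B : Matrix (Fin d) (Fin d) ℂ} (hA : A.IsHermitian) (hB : B.IsHermitian) (u : ℝ)
    (W : Matrix (Fin d) (Fin d) ℂ) :
    lQ u W A B = ∑ i, ∑ j, (2 * hA.eigenvalues i *
      (((star (hA.eigenvectorUnitary : Matrix (Fin d) (Fin d) ℂ)) *
      (hB.eigenvectorUnitary : Matrix (Fin d) (Fin d) ℂ)) i j *
      (star (hB.eigenvectorUnitary : Matrix (Fin d) (Fin d) ℂ) * W *
      (hA.eigenvectorUnitary : Matrix (Fin d) (Fin d) ℂ)) j i).re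
      - (hB.eigenvalues j + u * hA.eigenvalues i) * 
      ‖(star (hB.eigenvectorUnitary : Matrix (Fin d) (Fin d) ℂ) * W *
      (hA.eigenvectorUnitary : Matrix (Fin d) (Fin d) ℂ)) j i‖ ^ 2) := by
  set U := (hA.eigenvectorUnitary : Matrix (Fin d) (Fin d) ℂ) with hU
  set V := (hB.eigenvectorUnitary : Matrix (Fin d) (Fin d) ℂ) with hV
  have hV1 : V * star V = 1 := Unitary.coe_mul_star_self hB.eigenvectorUnitary
  have hU1 : U * star U = 1 := Unitary.coe_mul_star_self hA.eigenvectorUnitary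
  have hAe := spectral' hA
  have hBe := spectral' hB
  rw [← hU] at hAe
  rw [← hV] at hBe
  set T := star V * W * U with hT
  have e1 : (A * W).trace.re = ∑ i, ∑ j, hA.eigenvalues i * ((star U * V) i j * T j i).re := by
    have : (A * W).trace = (diagonal (fun i => (hA.eigenvalues i : ℂ)) * ((star U * V) * T)).trace := by
      conv_lhs => rw [hAe]
      rw [Matrix.mul_assoc, Matrix.mul_assoc, Matrix.trace_mul_comm]
      congr 1
      rw [hT]
      calc _ = diagonal (fun i => (hA.eigenvalues i : ℂ)) * (star U * 1 * W * U) := by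
            simp only [Matrix.mul_assoc, Matrix.mul_one]
        _ = _ := by rw [← hV1]; simp only [Matrix.mul_assoc]
    rw [this, Matrix.trace, Complex.re_sum]
    refine Finset.sum_congr rfl fun i _ => ?_
    rw [Matrix.diag_apply, Matrix.diagonal_mul, Complex.re_ofReal_mul, Matrix.mul_apply, Complex.re_sum,
      Finset.mul_sum]
  have e2 : (B * (W * star W)).trace.re = ∑ i, ∑ j, hB.eigenvalues j * ‖T j i‖ ^ 2 := by
    have : (B * (W * star W)).trace = (diagonal (fun i => (hB.eigenvalues i : ℂ)) * T *
        diagonal (fun i => ((1 : ℝ) : ℂ)) * star T).trace := by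
      conv_lhs => rw [hBe]
      rw [Matrix.mul_assoc, Matrix.mul_assoc, Matrix.trace_mul_comm]
      congr 1
      simp only [Complex.ofReal_one, diagonal_one, Matrix.mul_one]
      rw [hT]
      simp only [star_mul, star_star]
      calc _ = diagonal (fun i => (hB.eigenvalues i : ℂ)) * star V * W * 1 * star W * V := by
            simp only [Matrix.mul_assoc, Matrix.mul_one]
        _ = _ := by rw [← hU1]; simp only [Matrix.mul_assoc]
    rw [this, trace_diag_conj, Complex.ofReal_re, Finset.sum_comm]
    simp
  have e3 : (A * (star W * W)).trace.re = ∑ i, ∑ j, hA.eigenvalues i * ‖T j i‖ ^ 2 := by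
    have : (A * (star W * W)).trace = (diagonal (fun i => (hA.eigenvalues i : ℂ)) * star T *
        diagonal (fun i => ((1 : ℝ) : ℂ)) * star (star T)).trace := by
      conv_lhs => rw [hAe]
      rw [Matrix.mul_assoc, Matrix.mul_assoc, Matrix.trace_mul_comm]
      congr 1
      simp only [Complex.ofReal_one, diagonal_one, Matrix.mul_one]
      rw [hT]
      simp only [star_mul, star_star]
      calc _ = diagonal (fun i => (hA.eigenvalues i : ℂ)) * star U * star W * 1 * W * U := by
            simp only [Matrix.mul_assoc, Matrix.mul_one]
        _ = _ := by rw [← hV1]; simp only [Matrix.mul_assoc]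
    rw [this, trace_diag_conj, Complex.ofReal_re]
    simp [star_apply]
  unfold lQ
  rw [e1, e2, e3, Finset.mul_sum, Finset.mul_sum, ← Finset.sum_sub_distrib, ← Finset.sum_sub_distrib]
  refine Finset.sum_congr rfl fun i _ => ?_
  rw [Finset.mul_sum, Finset.mul_sum, ← Finset.sum_sub_distrib, ← Finset.sum_sub_distrib]
  refine Finset.sum_congr rfl fun j _ => ?_
  ring

lemma scalar_var (a c : ℝ) (hc : 0 < c) (p w : ℂ) :
    2 * a * (p * w).re - c * ‖w‖ ^ 2 ≤ a ^ 2 / c * ‖p‖ ^ 2 := by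
  have h1 : 0 ≤ ‖(c : ℂ) * w - (a : ℂ) * star p‖ ^ 2 := by positivity
  rw [← Complex.normSq_eq_norm_sq, Complex.normSq_apply] at h1
  rw [← Complex.normSq_eq_norm_sq, ← Complex.normSq_eq_norm_sq, Complex.normSq_apply, Complex.normSq_apply]
  simp at h1 ⊢
  rw [div_mul_eq_mul_div, ← sub_le_iff_le_add, le_div_iff₀ hc]
  nlinarith [h1]

lemma scalar_var_eq (a c : ℝ) (hc : 0 < c) (p : ℂ) :
    2 * a * (p * ((a / c : ℝ) * star p)).re - c * ‖((a / c : ℝ) : ℂ) * star p‖ ^ 2 = a ^ 2 / c * ‖p‖ ^ 2 := by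
  rw [← Complex.normSq_eq_norm_sq, ← Complex.normSq_eq_norm_sq, Complex.normSq_apply, Complex.normSq_apply]
  simp
  field_simp
  ring

lemma lQ_le_rQ {A B : Matrix (Fin d) (Fin d) ℂ} (hA : A.PosDef) (hB : B.PosDef) {u : ℝ}
    (hu : 0 ≤ u) (W : Matrix (Fin d) (Fin d) ℂ) :
    lQ u W A B ≤ rQ hA.1 hB.1 u := by
  rw [lQ_eq hA.1 hB.1]
  refine Finset.sum_le_sum fun i _ => Finset.sum_le_sum fun j _ => ?_
  have := hA.eigenvalues_pos i
  have := hB.eigenvalues_pos j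
  exact scalar_var _ _ (by positivity) _ _

lemma exists_lQ_eq {A B : Matrix (Fin d) (Fin d) ℂ} (hA : A.PosDef) (hB : B.PosDef) {u : ℝ}
    (hu : 0 ≤ u) : ∃ W : Matrix (Fin d) (Fin d) ℂ, lQ u W A B = rQ hA.1 hB.1 u := by
  set U := (hA.1.eigenvectorUnitary : Matrix (Fin d) (Fin d) ℂ) with hU
  set V := (hB.1.eigenvectorUnitary : Matrix (Fin d) (Fin d) ℂ) with hV
  have hV1 : star V * V = 1 := Unitary.coe_star_mul_self hB.1.eigenvectorUnitary
  have hU1 : star U * U = 1 := Unitary.coe_star_mul_self hA.1.eigenvectorUnitary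
  let T : Matrix (Fin d) (Fin d) ℂ := Matrix.of fun j i =>
    ((hA.1.eigenvalues i / (hB.1.eigenvalues j + u * hA.1.eigenvalues i) : ℝ) : ℂ) *
      star ((star U * V) i j)
  refine ⟨V * T * star U, ?_⟩
  have hT : star V * (V * T * star U) * U = T := by
    calc _ = (star V * V) * T * (star U * U) := by simp only [Matrix.mul_assoc]
      _ = T := by rw [hV1, hU1]; simp
  rw [lQ_eq hA.1 hB.1, ← hU, ← hV, hT]
  refine Finset.sum_congr rfl fun i _ => Finset.sum_congr rfl fun j _ => ?_
  have := hA.eigenvalues_pos i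
  have := hB.eigenvalues_pos j
  exact scalar_var_eq _ _ (by positivity) _

lemma rQ_convex {A B A' B' : Matrix (Fin d) (Fin d) ℂ} (hA : A.PosDef) (hB : B.PosDef)
    (hA' : A'.PosDef) (hB' : B'.PosDef) {α β : ℝ} (hα : 0 ≤ α) (hβ : 0 ≤ β)
    (h1 : (α • A + β • A').PosDef) (h2 : (α • B + β • B').PosDef) {u : ℝ} (hu : 0 ≤ u) :
    rQ h1.1 h2.1 u ≤ α * rQ hA.1 hB.1 u + β * rQ hA'.1 hB'.1 u := by
  obtain ⟨W, hW⟩ := exists_lQ_eq h1 h2 hu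
  rw [← hW]
  have e : lQ u W (α • A + β • A') (α • B + β • B') = α * lQ u W A B + β * lQ u W A' B' := by
    unfold lQ
    simp only [Matrix.add_mul, Matrix.smul_mul, Matrix.trace_add, Matrix.trace_smul, Complex.add_re,
      Complex.real_smul, Complex.re_ofReal_mul]
    ring
  rw [e]
  have := lQ_le_rQ hA hB hu W
  have := lQ_le_rQ hA' hB' hu W
  gcongr

end MatrixAlgebra
end QD

namespace QD

section ScalarInt

lemma scal_tendsto {a b : ℝ} (ha : 0 < a) (hb : 0 < b) :
    Tendsto (fun u : ℝ => a * Real.log (b + u * a) - a * Real.log (1 + u)) atTop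
      (𝓝 (a * Real.log a)) := by
  have h1 : Tendsto (fun u : ℝ => (b + u * a) / (1 + u)) atTop (𝓝 a) := by
    have h2 : Tendsto (fun u : ℝ => a + (b - a) / (1 + u)) atTop (𝓝 (a + 0)) := by
      refine tendsto_const_nhds.add (Tendsto.div_atTop tendsto_const_nhds ?_)
      exact tendsto_atTop_add_const_left _ _ tendsto_id
    rw [add_zero] at h2
    refine h2.congr' ?_
    filter_upwards [eventually_gt_atTop 0] with u hu
    field_simp
    ring
  have h3 := ((Real.continuousAt_log ha.ne').tendsto.comp h1).const_mul a
  refine h3.congr' ?_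
  filter_upwards [eventually_gt_atTop 0] with u hu
  simp only [Function.comp]
  rw [Real.log_div (by positivity) (by positivity)]
  ring

lemma scal_deriv {a b : ℝ} (ha : 0 < a) (hb : 0 < b) (u : ℝ) (hu : u ∈ Set.Ici (0 : ℝ)) :
    HasDerivAt (fun u : ℝ => a * Real.log (b + u * a) - a * Real.log (1 + u))
      (a ^ 2 / (b + u * a) - a / (1 + u)) u := by
  have hu : 0 ≤ u := hu
  have h1 : HasDerivAt (fun u : ℝ => b + u * a) a u := by
    simpa using ((hasDerivAt_id u).mul_const a).const_add b
  have h2 : HasDerivAt (fun u : ℝ => 1 + u) 1 u := by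
    simpa using (hasDerivAt_id u).const_add 1
  have h3 := ((h1.log (by positivity)).const_mul a).sub ((h2.log (by positivity)).const_mul a)
  refine h3.congr_deriv ?_
  field_simp

lemma scal_form {a b : ℝ} (ha : 0 < a) (hb : 0 < b) (u : ℝ) (hu : 0 < u) :
    a ^ 2 / (b + u * a) - a / (1 + u) = (a - b) * (a / ((b + u * a) * (1 + u))) := by
  field_simp
  ring

lemma scal_integrable {a b : ℝ} (ha : 0 < a) (hb : 0 < b) :
    IntegrableOn (fun u : ℝ => a ^ 2 / (b + u * a) - a / (1 + u)) (Set.Ioi 0) := by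
  rcases le_total b a with h | h
  · refine integrableOn_Ioi_deriv_of_nonneg' (scal_deriv ha hb) ?_ (scal_tendsto ha hb)
    intro u hu
    have hu : 0 < u := hu
    rw [scal_form ha hb u hu]
    exact mul_nonneg (by linarith) (by positivity)
  · refine integrableOn_Ioi_deriv_of_nonpos' (scal_deriv ha hb) ?_ (scal_tendsto ha hb)
    intro u hu
    have hu : 0 < u := hu
    rw [scal_form ha hb u hu]
    exact mul_nonpos_of_nonpos_of_nonneg (by linarith) (by positivity)

lemma scal_integral {a b : ℝ} (ha : 0 < a) (hb : 0 < b) :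
    ∫ u in Set.Ioi (0 : ℝ), (a ^ 2 / (b + u * a) - a / (1 + u)) =
      a * (Real.log a - Real.log b) := by
  rw [integral_Ioi_of_hasDerivAt_of_tendsto' (scal_deriv ha hb) (scal_integrable ha hb)
    (scal_tendsto ha hb)]
  simp
  ring

lemma negMulLog_shift {x ε : ℝ} (hx : 0 ≤ x) (hε : 0 < ε) (hε1 : ε ≤ 1) :
    |negMulLog (x + ε) - negMulLog x| ≤ x + 2 := by
  have e1 : ε * Real.log (x + ε) ≤ x + 1 := by
    have h := Real.log_le_sub_one_of_pos (show 0 < x + ε by linarith)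
    have : ε * Real.log (x + ε) ≤ ε * (x + ε - 1) := by gcongr
    nlinarith
  have e2 : -1 ≤ ε * Real.log (x + ε) := by
    have h := Real.one_sub_inv_le_log_of_pos hε
    have h' : Real.log ε ≤ Real.log (x + ε) := Real.log_le_log hε (by linarith)
    have : ε * (1 - ε⁻¹) ≤ ε * Real.log (x + ε) := by gcongr; linarith
    rw [mul_sub, mul_inv_cancel₀ hε.ne'] at this
    linarith
  rcases hx.eq_or_lt with rfl | hx
  · simp only [negMulLog, zero_add, Real.log_zero] at *
    rw [abs_le]; constructor <;> linarith
  · have e3 : 0 ≤ x * (Real.log (x + ε) - Real.log x) :=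
      mul_nonneg hx.le (sub_nonneg.2 (Real.log_le_log hx (by linarith)))
    have e4 : x * (Real.log (x + ε) - Real.log x) ≤ 1 := by
      rw [← Real.log_div (by positivity) hx.ne']
      have h := Real.log_le_sub_one_of_pos (show 0 < (x + ε) / x by positivity)
      have : x * Real.log ((x + ε) / x) ≤ x * ((x + ε) / x - 1) := by gcongr
      have h2 : x * ((x + ε) / x - 1) = ε := by field_simp; ring
      linarith
    have : negMulLog (x + ε) - negMulLog x = -(x * (Real.log (x + ε) - Real.log x)) -
      ε * Real.log (x + ε) := by
      simp only [negMulLog]; ring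
    rw [this, abs_le]; constructor <;> linarith

end ScalarInt

section MatrixTwo
open Matrix

variable {d : ℕ}

lemma trace_eq_sum {A : Matrix (Fin d) (Fin d) ℂ} (hA : A.IsHermitian) :
    A.trace.re = ∑ i, hA.eigenvalues i := by
  rw [hA.trace_eq_sum_eigenvalues, Complex.re_sum]
  simp

lemma rD_int_term {A B : Matrix (Fin d) (Fin d) ℂ} (hA : A.PosDef) (hB : B.PosDef) (u : ℝ) :
    rQ hA.1 hB.1 u - A.trace.re / (1 + u) = ∑ i, ∑ j,
      ((hA.1.eigenvalues i) ^ 2 / (hB.1.eigenvalues j + u * hA.1.eigenvalues i)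
        - hA.1.eigenvalues i / (1 + u)) * ov hA.1 hB.1 i j := by
  unfold rQ
  rw [trace_eq_sum hA.1, Finset.sum_div, ← Finset.sum_sub_distrib]
  refine Finset.sum_congr rfl fun i _ => ?_
  have : hA.1.eigenvalues i / (1 + u) = ∑ j, hA.1.eigenvalues i / (1 + u) * ov hA.1 hB.1 i j := by
    rw [← Finset.mul_sum, ov_sum_right, mul_one]
  rw [this, ← Finset.sum_sub_distrib]
  refine Finset.sum_congr rfl fun j _ => ?_
  rw [← this]
  ring

lemma rD_integrable {A B : Matrix (Fin d) (Fin d) ℂ} (hA : A.PosDef) (hB : B.PosDef) :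
    IntegrableOn (fun u : ℝ => rQ hA.1 hB.1 u - A.trace.re / (1 + u)) (Set.Ioi 0) := by
  simp only [rD_int_term hA hB]
  exact integrable_finsetSum _ fun i _ => integrable_finsetSum _ fun j _ =>
    (scal_integrable (hA.eigenvalues_pos i) (hB.eigenvalues_pos j)).mul_const _

lemma rD_integral {A B : Matrix (Fin d) (Fin d) ℂ} (hA : A.PosDef) (hB : B.PosDef) :
    ∫ u in Set.Ioi (0 : ℝ), (rQ hA.1 hB.1 u - A.trace.re / (1 + u)) = rD A B := by
  simp only [rD_int_term hA hB]
  rw [rD_eq hA.1 hB.1, integral_finsetSum]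
  · refine Finset.sum_congr rfl fun i _ => ?_
    rw [integral_finsetSum]
    · refine Finset.sum_congr rfl fun j _ => ?_
      rw [integral_mul_const, scal_integral (hA.eigenvalues_pos i) (hB.eigenvalues_pos j)]
    · exact fun j _ => (scal_integrable (hA.eigenvalues_pos i) (hB.eigenvalues_pos j)).mul_const _
  · exact fun i _ => integrable_finsetSum _ fun j _ =>
      (scal_integrable (hA.eigenvalues_pos i) (hB.eigenvalues_pos j)).mul_const _

lemma rsmul_eq (α : ℝ) (A : Matrix (Fin d) (Fin d) ℂ) : α • A = (α : ℂ) • A := by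
  ext i j; simp

lemma posSemidef_rsmul {A : Matrix (Fin d) (Fin d) ℂ} (hA : A.PosSemidef) {α : ℝ} (hα : 0 ≤ α) :
    (α • A).PosSemidef := by
  rw [rsmul_eq]; exact hA.smul (by exact_mod_cast hα)

lemma posDef_rsmul {A : Matrix (Fin d) (Fin d) ℂ} (hA : A.PosDef) {α : ℝ} (hα : 0 < α) :
    (α • A).PosDef := by
  rw [rsmul_eq]; exact hA.smul (by exact_mod_cast hα)

lemma posDef_comb {A A' : Matrix (Fin d) (Fin d) ℂ} (hA : A.PosDef) (hA' : A'.PosDef) {α β : ℝ}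
    (hα : 0 ≤ α) (hβ : 0 ≤ β) (hab : α + β = 1) : (α • A + β • A').PosDef := by
  rcases hα.eq_or_lt with rfl | hα
  · have : β = 1 := by linarith
    subst this; simpa using hA'
  · exact (posDef_rsmul hA hα).add_posSemidef (posSemidef_rsmul hA'.posSemidef hβ)

lemma rD_convex {A B A' B' : Matrix (Fin d) (Fin d) ℂ} (hA : A.PosDef) (hB : B.PosDef)
    (hA' : A'.PosDef) (hB' : B'.PosDef) {α β : ℝ} (hα : 0 ≤ α) (hβ : 0 ≤ β) (hab : α + β = 1) :
    rD (α • A + β • A') (α • B + β • B') ≤ α * rD A B + β * rD A' B' := by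
  have h1 := posDef_comb hA hA' hα hβ hab
  have h2 := posDef_comb hB hB' hα hβ hab
  rw [← rD_integral h1 h2, ← rD_integral hA hB, ← rD_integral hA' hB', ← integral_const_mul,
    ← integral_const_mul, ← integral_add ((rD_integrable hA hB).const_mul _)
      ((rD_integrable hA' hB').const_mul _)]
  refine setIntegral_mono_on (rD_integrable h1 h2) (((rD_integrable hA hB).const_mul _).add
      ((rD_integrable hA' hB').const_mul _)) measurableSet_Ioi ?_
  intro u hu
  have hu : 0 < u := hu
  have := rQ_convex hA hB hA' hB' hα hβ h1 h2 hu.le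
  simp only [Matrix.trace_add, Matrix.trace_smul, Complex.add_re, Complex.real_smul,
    Complex.re_ofReal_mul]
  have e : (α * A.trace.re + β * A'.trace.re) / (1 + u) =
    α * (A.trace.re / (1 + u)) + β * (A'.trace.re / (1 + u)) := by ring
  rw [e]
  linarith

lemma posDef_shift {A : Matrix (Fin d) (Fin d) ℂ} (hA : A.PosSemidef) {ε : ℝ} (hε : 0 < ε) :
    (A + ε • (1 : Matrix (Fin d) (Fin d) ℂ)).PosDef :=
  (posDef_rsmul Matrix.PosDef.one hε).posSemidef_add hA

lemma herm_shift {A : Matrix (Fin d) (Fin d) ℂ} (hA : A.IsHermitian) (ε : ℝ) :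
    (A + ε • (1 : Matrix (Fin d) (Fin d) ℂ)).IsHermitian := by
  refine hA.add ?_
  rw [rsmul_eq]
  ext i j
  by_cases h : i = j
  · subst h; simp
  · simp [h, Ne.symm h]

lemma cfc_shift {A : Matrix (Fin d) (Fin d) ℂ} (hA : A.IsHermitian) (φ : ℝ → ℝ) (ε : ℝ) :
    cfc φ (A + ε • (1 : Matrix (Fin d) (Fin d) ℂ)) = cfc (fun x => φ (x + ε)) A := by
  have hs := hA.isSelfAdjoint
  have h1 : A + ε • (1 : Matrix (Fin d) (Fin d) ℂ) = cfc (fun x : ℝ => x + ε) A := by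
    rw [cfc_add_const ε (fun x => x) A (by fun_prop) hs, cfc_id' ℝ A hs, Algebra.algebraMap_eq_smul_one]
  rw [h1, ← cfc_comp' φ (fun x : ℝ => x + ε) A
    ((A.finite_real_spectrum.image _).continuousOn _) (by fun_prop) hs]

lemma cfc_scale {A : Matrix (Fin d) (Fin d) ℂ} (hA : A.IsHermitian) (φ : ℝ → ℝ) (r : ℝ) :
    cfc φ (r • A) = cfc (fun x => φ (r * x)) A := by
  have hs := hA.isSelfAdjoint
  have h1 : r • A = cfc (fun x : ℝ => r * x) A := by
    rw [cfc_const_mul r (fun x => x) A (by fun_prop), cfc_id' ℝ A hs]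
  rw [h1, ← cfc_comp' φ (fun x : ℝ => r * x) A
    ((A.finite_real_spectrum.image _).continuousOn _) (by fun_prop) hs]

lemma herm_rsmul {A : Matrix (Fin d) (Fin d) ℂ} (hA : A.IsHermitian) (r : ℝ) :
    (r • A).IsHermitian := by
  have : (r • A)ᴴ = r • Aᴴ := by rw [conjTranspose_smul]; simp
  rw [IsHermitian, this, hA.eq]

lemma vnEnt_smul {A : Matrix (Fin d) (Fin d) ℂ} (hA : A.IsHermitian) (r : ℝ) :
    vnEnt (r • A) = r * vnEnt A + negMulLog r * A.trace.re := by
  rw [vnEnt_eq_cfc (herm_rsmul hA r), cfc_scale hA, trace_cfc hA, Complex.ofReal_re, vnEnt_eq hA,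
    trace_eq_sum hA, Finset.mul_sum, Finset.mul_sum, ← Finset.sum_add_distrib]
  refine Finset.sum_congr rfl fun i _ => ?_
  rw [negMulLog_mul]; ring

lemma vnEnt_shift_eq {A : Matrix (Fin d) (Fin d) ℂ} (hA : A.IsHermitian) (ε : ℝ) :
    vnEnt (A + ε • (1 : Matrix (Fin d) (Fin d) ℂ)) = ∑ i, negMulLog (hA.eigenvalues i + ε) := by
  rw [vnEnt_eq_cfc (herm_shift hA ε), cfc_shift hA, trace_cfc hA, Complex.ofReal_re]

lemma vnEnt_shift_bound {A : Matrix (Fin d) (Fin d) ℂ} (hA : A.PosSemidef) {ε : ℝ} (hε : 0 < ε)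
    (hε1 : ε ≤ 1) :
    |vnEnt (A + ε • (1 : Matrix (Fin d) (Fin d) ℂ))| ≤ |vnEnt A| + A.trace.re + 2 * d := by
  have h : |vnEnt (A + ε • (1 : Matrix (Fin d) (Fin d) ℂ)) - vnEnt A| ≤ A.trace.re + 2 * d := by
    rw [vnEnt_shift_eq hA.1, vnEnt_eq hA.1, ← Finset.sum_sub_distrib]
    refine (Finset.abs_sum_le_sum_abs _ _).trans ?_
    refine (Finset.sum_le_sum fun i _ => negMulLog_shift (hA.eigenvalues_nonneg i) hε hε1).trans ?_
    rw [Finset.sum_add_distrib, trace_eq_sum hA.1]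
    simp; linarith
  have := abs_sub_abs_le_abs_sub (vnEnt (A + ε • (1 : Matrix (Fin d) (Fin d) ℂ))) (vnEnt A)
  linarith

lemma vnEnt_shift_tendsto {A : Matrix (Fin d) (Fin d) ℂ} (hA : A.IsHermitian) :
    Tendsto (fun ε : ℝ => vnEnt (A + ε • (1 : Matrix (Fin d) (Fin d) ℂ))) (𝓝[>] 0) (𝓝 (vnEnt A)) := by
  simp only [vnEnt_shift_eq hA]
  rw [vnEnt_eq hA]
  refine tendsto_finsetSum _ fun i _ => ?_
  have : Continuous (fun ε : ℝ => negMulLog (hA.eigenvalues i + ε)) :=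
    continuous_negMulLog.comp (by fun_prop)
  have h := (this.tendsto 0).mono_left (nhdsWithin_le_nhds (s := Set.Ioi 0))
  simpa using h

lemma log_shift_bound {A B : Matrix (Fin d) (Fin d) ℂ} (hA : A.PosSemidef) (hB : B.PosSemidef)
    {ε β : ℝ} (hε : 0 < ε) (hβ : B.trace.re ≤ β) :
    |(A * cfc Real.log (B + ε • (1 : Matrix (Fin d) (Fin d) ℂ))).trace.re|
      ≤ (|Real.log ε| + |Real.log (β + ε)|) * A.trace.re := by
  have h : A * cfc Real.log (B + ε • (1 : Matrix (Fin d) (Fin d) ℂ)) =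
      cfc (id : ℝ → ℝ) A * cfc (fun x => Real.log (x + ε)) B := by
    rw [cfc_id ℝ A hA.1.isSelfAdjoint, cfc_shift hB.1]
  rw [h, trace_cfc_mul hA.1 hB.1, Complex.ofReal_re, trace_eq_sum hA.1, Finset.mul_sum]
  refine (Finset.abs_sum_le_sum_abs _ _).trans (Finset.sum_le_sum fun i _ => ?_)
  refine (Finset.abs_sum_le_sum_abs _ _).trans ?_
  have hL : ∀ j, |Real.log (hB.1.eigenvalues j + ε)| ≤ |Real.log ε| + |Real.log (β + ε)| := by
    intro j
    have h0 := hB.eigenvalues_nonneg j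
    have h1 : hB.1.eigenvalues j ≤ β := by
      refine le_trans ?_ hβ
      rw [trace_eq_sum hB.1]
      exact Finset.single_le_sum (fun k _ => hB.eigenvalues_nonneg k) (Finset.mem_univ j)
    have l1 : Real.log ε ≤ Real.log (hB.1.eigenvalues j + ε) := Real.log_le_log hε (by linarith)
    have l2 : Real.log (hB.1.eigenvalues j + ε) ≤ Real.log (β + ε) :=
      Real.log_le_log (by linarith) (by linarith)
    rw [abs_le]
    constructor
    · linarith [neg_abs_le (Real.log ε), abs_nonneg (Real.log (β + ε))]
    · linarith [le_abs_self (Real.log (β + ε)), abs_nonneg (Real.log ε)]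
  have h2 : ∀ j ∈ Finset.univ, |id (hA.1.eigenvalues i) * Real.log (hB.1.eigenvalues j + ε) * ov hA.1 hB.1 i j|
      ≤ ((|Real.log ε| + |Real.log (β + ε)|) * hA.1.eigenvalues i) * ov hA.1 hB.1 i j := by
    intro j _
    rw [abs_mul, abs_mul, abs_of_nonneg (ov_nonneg _ _ _ _), id, abs_of_nonneg (hA.eigenvalues_nonneg i)]
    have := ov_nonneg hA.1 hB.1 i j
    have := hA.eigenvalues_nonneg i
    rw [mul_comm (hA.1.eigenvalues i)]
    gcongr
    exact hL j
  refine (Finset.sum_le_sum h2).trans ?_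
  rw [← Finset.mul_sum, ov_sum_right, mul_one]

open scoped Matrix.Norms.L2Operator in
lemma continuousOn_log_shift {ε : ℝ} (hε : 0 < ε) :
    ContinuousOn (fun B : Matrix (Fin d) (Fin d) ℂ =>
      cfc Real.log (B + ε • (1 : Matrix (Fin d) (Fin d) ℂ))) {B | B.PosSemidef} := by
  refine ContinuousOn.cfc_of_mem_nhdsSet (s := Set.Ioi 0) Real.log ?_ (by fun_prop)
    (fun x hx => (posDef_shift hx hε).1.isSelfAdjoint) ?_
  · refine isOpen_Ioi.mem_nhdsSet.2 ?_
    intro y hy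
    simp only [Set.mem_iUnion] at hy
    obtain ⟨B, hB, hy⟩ := hy
    rw [(posDef_shift hB hε).1.spectrum_real_eq_range_eigenvalues] at hy
    obtain ⟨i, rfl⟩ := hy
    exact (posDef_shift hB hε).eigenvalues_pos i
  · intro x hx
    exact (Real.continuousAt_log (ne_of_gt hx)).continuousWithinAt

/-- diagonal of `A` in the eigenbasis of `C` -/
lemma diag_in_basis {A C : Matrix (Fin d) (Fin d) ℂ} (hA : A.IsHermitian) (hC : C.IsHermitian)
    (j : Fin d) :
    (star (hC.eigenvectorUnitary : Matrix (Fin d) (Fin d) ℂ) * A *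
      (hC.eigenvectorUnitary : Matrix (Fin d) (Fin d) ℂ)) j j
      = ((∑ i, hA.eigenvalues i * ov hA hC i j : ℝ) : ℂ) := by
  set U := (hA.eigenvectorUnitary : Matrix (Fin d) (Fin d) ℂ) with hU
  set V := (hC.eigenvectorUnitary : Matrix (Fin d) (Fin d) ℂ) with hV
  have hAe := spectral' hA
  rw [← hU] at hAe
  have : star V * A * V = star (star U * V) * (diagonal (fun i => (hA.eigenvalues i : ℂ)) * (star U * V)) := by
    conv_lhs => rw [hAe]
    simp only [star_mul, star_star, Matrix.mul_assoc]
  rw [this, Matrix.mul_apply]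
  simp only [Matrix.diagonal_mul, star_apply]
  unfold ov
  push_cast
  refine Finset.sum_congr rfl fun i _ => ?_
  rw [← hU, ← hV, ← Complex.conj_mul']
  simp only [RCLike.star_def]
  ring

lemma diag_self {C : Matrix (Fin d) (Fin d) ℂ} (hC : C.IsHermitian) (j : Fin d) :
    (star (hC.eigenvectorUnitary : Matrix (Fin d) (Fin d) ℂ) * C *
      (hC.eigenvectorUnitary : Matrix (Fin d) (Fin d) ℂ)) j j = (hC.eigenvalues j : ℂ) := by
  set V := (hC.eigenvectorUnitary : Matrix (Fin d) (Fin d) ℂ) with hV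
  have hV1 : star V * V = 1 := Unitary.coe_star_mul_self hC.eigenvectorUnitary
  have hCe := spectral' hC
  rw [← hV] at hCe
  have : star V * C * V = diagonal (fun i => (hC.eigenvalues i : ℂ)) := by
    conv_lhs => rw [hCe]
    calc _ = (star V * V) * diagonal (fun i => (hC.eigenvalues i : ℂ)) * (star V * V) := by
          simp only [Matrix.mul_assoc]
      _ = _ := by rw [hV1]; simp
  rw [this, diagonal_apply_eq]

lemma peierls {A C : Matrix (Fin d) (Fin d) ℂ} (hA : A.PosSemidef) (hC : C.IsHermitian) :
    vnEnt A ≤ ∑ j, negMulLog (∑ i, hA.1.eigenvalues i * ov hA.1 hC i j) := by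
  have h1 : ∀ j, ∑ i, ov hA.1 hC i j * negMulLog (hA.1.eigenvalues i) ≤
      negMulLog (∑ i, hA.1.eigenvalues i * ov hA.1 hC i j) := by
    intro j
    have := Real.concaveOn_negMulLog.le_map_sum (t := Finset.univ) (w := fun i => ov hA.1 hC i j)
      (p := fun i => hA.1.eigenvalues i) (fun i _ => ov_nonneg _ _ _ _) (ov_sum_left _ _ _)
      (fun i _ => hA.eigenvalues_nonneg i)
    simpa [smul_eq_mul, mul_comm] using this
  refine le_trans ?_ (Finset.sum_le_sum fun j _ => h1 j)
  rw [Finset.sum_comm, vnEnt_eq hA.1]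
  refine Finset.sum_le_sum fun i _ => ?_
  rw [← Finset.sum_mul, ov_sum_right, one_mul]

lemma convex_psd : Convex ℝ {A : Matrix (Fin d) (Fin d) ℂ | A.PosSemidef} := by
  intro A hA B hB α β hα hβ _
  exact (posSemidef_rsmul hA hα).add (posSemidef_rsmul hB hβ)

lemma concaveOn_vnEnt :
    ConcaveOn ℝ {A : Matrix (Fin d) (Fin d) ℂ | A.PosSemidef} vnEnt := by
  refine ⟨convex_psd, ?_⟩
  intro A hA B hB α β hα hβ hab
  have hC : (α • A + β • B).PosSemidef := convex_psd hA hB hα hβ hab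
  have hA : A.PosSemidef := hA
  have hB : B.PosSemidef := hB
  have hc : ∀ j, hC.1.eigenvalues j = α * (∑ i, hA.1.eigenvalues i * ov hA.1 hC.1 i j)
      + β * (∑ i, hB.1.eigenvalues i * ov hB.1 hC.1 i j) := by
    intro j
    have h := diag_self hC.1 j
    conv_lhs at h =>
      rw [Matrix.mul_add, Matrix.add_mul, Matrix.add_apply, Matrix.mul_smul, Matrix.mul_smul, Matrix.smul_mul,
        Matrix.smul_mul, Matrix.smul_apply, Matrix.smul_apply, diag_in_basis hA.1, diag_in_basis hB.1]
    simp only [Complex.real_smul] at h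
    exact_mod_cast h.symm
  rw [vnEnt_eq hC.1, smul_eq_mul, smul_eq_mul]
  have p1 := mul_le_mul_of_nonneg_left (peierls hA hC.1) hα
  have p2 := mul_le_mul_of_nonneg_left (peierls hB hC.1) hβ
  refine (add_le_add p1 p2).trans ?_
  rw [Finset.mul_sum, Finset.mul_sum, ← Finset.sum_add_distrib]
  refine Finset.sum_le_sum fun j _ => ?_
  rw [hc j]
  exact Real.concaveOn_negMulLog.2
    (Finset.sum_nonneg fun i _ => mul_nonneg (hA.eigenvalues_nonneg i) (ov_nonneg _ _ _ _))
    (Finset.sum_nonneg fun i _ => mul_nonneg (hB.eigenvalues_nonneg i) (ov_nonneg _ _ _ _)) hα hβ hab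

lemma isClosed_psd : IsClosed {A : Matrix (Fin d) (Fin d) ℂ | A.PosSemidef} := by
  have h : {A : Matrix (Fin d) (Fin d) ℂ | A.PosSemidef} =
      {A | A.conjTranspose = A} ∩
        ⋂ x, {A : Matrix (Fin d) (Fin d) ℂ | 0 ≤ dotProduct (star x) (A.mulVec x)} := by
    ext A
    simp [Matrix.posSemidef_iff_dotProduct_mulVec, Matrix.IsHermitian]
  rw [h]
  refine IsClosed.inter ?_ ?_
  · exact isClosed_eq (by fun_prop) continuous_id
  · refine isClosed_iInter fun x => isClosed_le continuous_const ?_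
    fun_prop

end MatrixTwo
end QD

namespace QD

section Jensen
open scoped Matrix.Norms.L2Operator

variable {d : ℕ}

lemma sm_comp {α T : Type*} [MeasurableSpace α] [TopologicalSpace T]
    [TopologicalSpace.PseudoMetrizableSpace T] [SecondCountableTopology T]
    {K : Set T} {F : T → ℝ} (hF : ContinuousOn F K) {g : α → T} (hg : StronglyMeasurable g)
    (hK : ∀ a, g a ∈ K) : StronglyMeasurable (fun a => F (g a)) := by
  borelize T
  have h1 : Measurable (fun a => (⟨g a, hK a⟩ : K)) := hg.measurable.subtype_mk
  have h2 : Continuous (K.domRestrict F) := continuousOn_iff_continuous_domRestrict.1 hF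
  exact (h2.measurable.comp h1).stronglyMeasurable

lemma vnEnt_eq_log {X : Matrix (Fin d) (Fin d) ℂ} (hX : X.IsHermitian) :
    vnEnt X = -(X * cfc Real.log X).trace.re := by
  have hs := hX.isSelfAdjoint
  have h : X * cfc Real.log X = cfc (fun x : ℝ => x * Real.log x) X := by
    rw [cfc_mul (fun x : ℝ => x) Real.log X (by fun_prop) (X.finite_real_spectrum.continuousOn _),
      cfc_id' ℝ X hs]
  rw [h, trace_cfc hX, vnEnt_eq hX, Complex.ofReal_re, ← Finset.sum_neg_distrib]
  refine Finset.sum_congr rfl fun i _ => ?_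
  simp [negMulLog]

/-- real-linear functional `G ↦ Re tr (G L)` -/
def trL (L : Matrix (Fin d) (Fin d) ℂ) : Matrix (Fin d) (Fin d) ℂ →L[ℝ] ℝ :=
  LinearMap.toContinuousLinearMap
    { toFun := fun G => (G * L).trace.re
      map_add' := by intro a b; simp [add_mul]
      map_smul' := by intro a b; simp }

lemma trL_apply (L G : Matrix (Fin d) (Fin d) ℂ) : trL L G = (G * L).trace.re := rfl

lemma integrable_trmul {α : Type*} [MeasurableSpace α] {μ : Measure α}
    {G : α → Matrix (Fin d) (Fin d) ℂ} (hG : Integrable G μ) (L : Matrix (Fin d) (Fin d) ℂ) :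
    Integrable (fun a => (G a * L).trace.re) μ := (trL L).integrable_comp hG

lemma integral_trmul {α : Type*} [MeasurableSpace α] {μ : Measure α}
    {G : α → Matrix (Fin d) (Fin d) ℂ} (hG : Integrable G μ) (L : Matrix (Fin d) (Fin d) ℂ) :
    ∫ a, (G a * L).trace.re ∂μ = ((∫ a, G a ∂μ) * L).trace.re := (trL L).integral_comp_comm hG

lemma integrable_tr {α : Type*} [MeasurableSpace α] {μ : Measure α}
    {G : α → Matrix (Fin d) (Fin d) ℂ} (hG : Integrable G μ) :
    Integrable (fun a => (G a).trace.re) μ := by simpa using integrable_trmul hG 1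

lemma integral_tr {α : Type*} [MeasurableSpace α] {μ : Measure α}
    {G : α → Matrix (Fin d) (Fin d) ℂ} (hG : Integrable G μ) :
    ∫ a, (G a).trace.re ∂μ = (∫ a, G a ∂μ).trace.re := by simpa using integral_trmul hG 1

lemma integral_psd {α : Type*} [MeasurableSpace α] {μ : Measure α}
    {G : α → Matrix (Fin d) (Fin d) ℂ} (hG : ∀ a, (G a).PosSemidef) :
    (∫ a, G a ∂μ).PosSemidef := by
  by_cases hi : Integrable G μ
  swap
  · rw [integral_undef hi]; exact Matrix.PosSemidef.zero
  rw [Matrix.posSemidef_iff_dotProduct_mulVec]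
  have hstar : (∫ a, G a ∂μ).IsHermitian := by
    let T : Matrix (Fin d) (Fin d) ℂ →L[ℝ] Matrix (Fin d) (Fin d) ℂ :=
      LinearMap.toContinuousLinearMap
        { toFun := fun G => G.conjTranspose
          map_add' := by intro a b; simp
          map_smul' := by intro a b; simp [Matrix.conjTranspose_smul] }
    have h1 : T (∫ a, G a ∂μ) = ∫ a, T (G a) ∂μ := (T.integral_comp_comm hi).symm
    have h2 : ∀ a, T (G a) = G a := fun a => (hG a).1
    simp only [h2] at h1
    exact h1
  refine ⟨hstar, fun x => ?_⟩
  let T : Matrix (Fin d) (Fin d) ℂ →L[ℝ] ℂ :=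
      LinearMap.toContinuousLinearMap
        { toFun := fun G => dotProduct (star x) (G.mulVec x)
          map_add' := by intro a b; simp [Matrix.add_mulVec]
          map_smul' := by intro a b; simp [Matrix.smul_mulVec] }
  have h1 : T (∫ a, G a ∂μ) = ∫ a, T (G a) ∂μ := (T.integral_comp_comm hi).symm
  have h2 : ∀ a, T (G a) = (((T (G a)).re : ℝ) : ℂ) := by
    intro a
    have h0 : 0 ≤ T (G a) := (Matrix.posSemidef_iff_dotProduct_mulVec.1 (hG a)).2 x
    have h3 := (Complex.nonneg_iff.1 h0).2
    apply Complex.ext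
    · simp
    · rw [← h3]; simp
  change 0 ≤ T (∫ a, G a ∂μ)
  rw [h1, integral_congr_ae (ae_of_all _ h2), integral_complex_ofReal]
  have h3 : 0 ≤ ∫ a, (T (G a)).re ∂μ := integral_nonneg fun a =>
    (Complex.nonneg_iff.1 (show 0 ≤ T (G a) from (Matrix.posSemidef_iff_dotProduct_mulVec.1 (hG a)).2 x)).1
  exact_mod_cast h3

lemma psd_tr_nonneg {A : Matrix (Fin d) (Fin d) ℂ} (hA : A.PosSemidef) : 0 ≤ A.trace.re := by
  rw [trace_eq_sum hA.1]; exact Finset.sum_nonneg fun i _ => hA.eigenvalues_nonneg i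

lemma sm_vnEnt {α : Type*} [MeasurableSpace α] {G : α → Matrix (Fin d) (Fin d) ℂ}
    (hm : StronglyMeasurable G) (hG : ∀ a, (G a).PosSemidef) :
    StronglyMeasurable (fun a => vnEnt (G a)) :=
  sm_comp (K := {A : Matrix (Fin d) (Fin d) ℂ | A.IsHermitian}) continuousOn_vnEnt hm fun a => (hG a).1

abbrev sh (ε : ℝ) (A : Matrix (Fin d) (Fin d) ℂ) : Matrix (Fin d) (Fin d) ℂ :=
  A + ε • (1 : Matrix (Fin d) (Fin d) ℂ)

lemma continuousOn_vnEnt_sh {ε : ℝ} : ContinuousOn (fun A : Matrix (Fin d) (Fin d) ℂ => vnEnt (sh ε A))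
    {A | A.PosSemidef} := by
  refine continuousOn_vnEnt.comp (f := sh ε) (by unfold sh; fun_prop) fun A hA => herm_shift hA.1 ε

lemma gfun_eq (ε : ℝ) (A B : Matrix (Fin d) (Fin d) ℂ) : rD (sh ε A) (sh ε B) =
    -vnEnt (sh ε A) - (A * cfc Real.log (sh ε B)).trace.re -
      ε * ((1 : Matrix (Fin d) (Fin d) ℂ) * cfc Real.log (sh ε B)).trace.re := by
  unfold rD
  simp [add_mul]
  ring

lemma gfun_cont {ε : ℝ} (hε : 0 < ε) :
    ContinuousOn (fun p : Matrix (Fin d) (Fin d) ℂ × Matrix (Fin d) (Fin d) ℂ =>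
      rD (sh ε p.1) (sh ε p.2)) ({A | A.PosSemidef} ×ˢ {A | A.PosSemidef}) := by
  have h1 : ContinuousOn (fun p : Matrix (Fin d) (Fin d) ℂ × Matrix (Fin d) (Fin d) ℂ => vnEnt (sh ε p.1))
      ({A | A.PosSemidef} ×ˢ {A | A.PosSemidef}) :=
    continuousOn_vnEnt_sh.comp continuousOn_fst fun p hp => hp.1
  have h2 : ContinuousOn (fun p : Matrix (Fin d) (Fin d) ℂ × Matrix (Fin d) (Fin d) ℂ =>
      cfc Real.log (sh ε p.2))
      ({A | A.PosSemidef} ×ˢ {A | A.PosSemidef}) :=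
    (continuousOn_log_shift hε).comp continuousOn_snd fun p hp => hp.2
  have h3 : ContinuousOn (fun p : Matrix (Fin d) (Fin d) ℂ × Matrix (Fin d) (Fin d) ℂ => sh ε p.1)
      ({A | A.PosSemidef} ×ˢ {A | A.PosSemidef}) := by unfold sh; fun_prop
  unfold rD
  exact h1.neg.sub (continuous_tr.comp_continuousOn (h3.mul h2))

lemma gfun_convex {ε : ℝ} (hε : 0 < ε) :
    ConvexOn ℝ ({A | A.PosSemidef} ×ˢ {A | A.PosSemidef})
      (fun p : Matrix (Fin d) (Fin d) ℂ × Matrix (Fin d) (Fin d) ℂ =>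
      rD (sh ε p.1) (sh ε p.2)) := by
  refine ⟨convex_psd.prod convex_psd, ?_⟩
  rintro ⟨A, B⟩ ⟨hA, hB⟩ ⟨A', B'⟩ ⟨hA', hB'⟩ α β hα hβ hab
  have := rD_convex (posDef_shift hA hε) (posDef_shift hB hε) (posDef_shift hA' hε)
    (posDef_shift hB' hε) hα hβ hab
  have e : ∀ X Y : Matrix (Fin d) (Fin d) ℂ, sh ε (α • X + β • Y) = α • sh ε X + β • sh ε Y := by
    intro X Y
    have : ε = α * ε + β * ε := by rw [← add_mul, hab, one_mul]
    unfold sh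
    rw [smul_add, smul_add, smul_smul, smul_smul]
    nth_rw 1 [this]
    rw [add_smul]; abel
  simp only [Prod.smul_mk, Prod.mk_add_mk, smul_eq_mul, e]
  exact this


section Main
variable {Y Z : Type*} [MeasurableSpace Y] [MeasurableSpace Z] {μ : Measure Y} {ν : Measure Z}
  [IsProbabilityMeasure μ] [IsProbabilityMeasure ν]

lemma int3 {α : Type*} [MeasurableSpace α] {κ : Measure α} {a b c : α → ℝ}
    (ha : Integrable a κ) (hb : Integrable b κ) (hc : Integrable c κ) :
    ∫ x, (-a x - b x - c x) ∂κ = -(∫ x, a x ∂κ) - (∫ x, b x ∂κ) - ∫ x, c x ∂κ := by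
  have h1 : Integrable (fun x => -a x) κ := ha.neg
  have h2 : Integrable (fun x => -a x - b x) κ := h1.sub hb
  rw [integral_sub h2 hc, integral_sub h1 hb, integral_neg]

lemma sh_int {α : Type*} [MeasurableSpace α] {κ : Measure α} [IsProbabilityMeasure κ]
    {G : α → Matrix (Fin d) (Fin d) ℂ} (hm : StronglyMeasurable G) (hi : Integrable G κ)
    (hG : ∀ a, (G a).PosSemidef)
    (he : Integrable (fun a => vnEnt (G a)) κ) {ε : ℝ} (hε : 0 < ε) (hε1 : ε ≤ 1) :
    Integrable (fun a => vnEnt (sh ε (G a))) κ := by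
  have hdom : Integrable (fun a => |vnEnt (G a)| + (G a).trace.re + 2 * d) κ :=
    (he.abs.add (integrable_tr hi)).add (integrable_const _)
  refine hdom.mono' ?_ (ae_of_all _ fun a => vnEnt_shift_bound (hG a) hε hε1)
  exact (sm_comp continuousOn_vnEnt_sh hm hG).aestronglyMeasurable

lemma sh_lim {α : Type*} [MeasurableSpace α] {κ : Measure α} [IsProbabilityMeasure κ]
    {G : α → Matrix (Fin d) (Fin d) ℂ} (hm : StronglyMeasurable G) (hi : Integrable G κ)
    (hG : ∀ a, (G a).PosSemidef)
    (he : Integrable (fun a => vnEnt (G a)) κ) :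
    Tendsto (fun ε : ℝ => ∫ a, vnEnt (sh ε (G a)) ∂κ) (𝓝[>] 0) (𝓝 (∫ a, vnEnt (G a) ∂κ)) := by
  have hdom : Integrable (fun a => |vnEnt (G a)| + (G a).trace.re + 2 * d) κ :=
    (he.abs.add (integrable_tr hi)).add (integrable_const _)
  have hev : ∀ᶠ ε : ℝ in 𝓝[>] 0, 0 < ε ∧ ε ≤ 1 := by
    filter_upwards [Ioc_mem_nhdsGT (zero_lt_one' ℝ)] with ε h using h
  refine tendsto_integral_filter_of_dominated_convergence _ ?_ ?_ hdom ?_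
  · filter_upwards [hev] with ε h
    exact (sm_comp continuousOn_vnEnt_sh hm hG).aestronglyMeasurable
  · filter_upwards [hev] with ε h
    exact ae_of_all _ fun a => vnEnt_shift_bound (hG a) h.1 h.2
  · exact ae_of_all _ fun a => vnEnt_shift_tendsto (hG a).1

lemma jensen_eps {A : Y × Z → Matrix (Fin d) (Fin d) ℂ} (hm : StronglyMeasurable A)
    (hi : Integrable A (μ.prod ν)) (hA : ∀ p, (A p).PosSemidef)
    (he : Integrable (fun p => vnEnt (A p)) (μ.prod ν))
    {β : ℝ} (hβ : ∀ y, (∫ z, A (y, z) ∂ν).trace.re ≤ β)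
    (heB : Integrable (fun y => vnEnt (∫ z, A (y, z) ∂ν)) μ)
    (heC : Integrable (fun z => vnEnt (∫ y, A (y, z) ∂μ)) ν) {ε : ℝ} (hε : 0 < ε) (hε1 : ε ≤ 1) :
    vnEnt (sh ε (∫ p, A p ∂(μ.prod ν))) - ∫ z, vnEnt (sh ε (∫ y, A (y, z) ∂μ)) ∂ν ≤
      (∫ y, vnEnt (sh ε (∫ z, A (y, z) ∂ν)) ∂μ) - ∫ p, vnEnt (sh ε (A p)) ∂(μ.prod ν) := by
  set B : Y → Matrix (Fin d) (Fin d) ℂ := fun y => ∫ z, A (y, z) ∂ν with hB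
  set C : Z → Matrix (Fin d) (Fin d) ℂ := fun z => ∫ y, A (y, z) ∂μ with hC
  set D := ∫ p, A p ∂(μ.prod ν) with hD
  have hBp : ∀ y, (B y).PosSemidef := fun y => integral_psd fun z => hA _
  have hCp : ∀ z, (C z).PosSemidef := fun z => integral_psd fun y => hA _
  have hDp : D.PosSemidef := integral_psd hA
  have hBm : StronglyMeasurable B := hm.integral_prod_right'
  have hCm : StronglyMeasurable C := hm.integral_prod_left'
  have hBi : Integrable B μ := hi.integral_prod_left
  have hCi : Integrable C ν := hi.integral_prod_right
  have hBD : ∫ y, B y ∂μ = D := (integral_prod A hi).symm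
  have hCD : ∫ z, C z ∂ν = D := (integral_prod_symm A hi).symm
  have hEA := sh_int hm hi hA he hε hε1
  have hEB := sh_int hBm hBi hBp heB hε hε1
  have hEC := sh_int hCm hCi hCp heC hε hε1
  set K := |Real.log ε| + |Real.log (β + ε)| with hK
  have hlogB : StronglyMeasurable fun p : Y × Z => (A p, B p.1) :=
    hm.prodMk (hBm.comp_measurable measurable_fst)
  -- integrability of the trace terms
  have hT1 : Integrable (fun p : Y × Z => (A p * cfc Real.log (sh ε (B p.1))).trace.re) (μ.prod ν) := by
    refine ((integrable_tr hi).const_mul K).mono' ?_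
      (ae_of_all _ fun p => log_shift_bound (hA p) (hBp p.1) hε (hβ p.1))
    refine (sm_comp (K := {A : Matrix (Fin d) (Fin d) ℂ | A.PosSemidef} ×ˢ
        {A : Matrix (Fin d) (Fin d) ℂ | A.PosSemidef})
      (F := fun p => (p.1 * cfc Real.log (sh ε p.2)).trace.re) ?_ hlogB
      fun p => ⟨hA p, hBp p.1⟩).aestronglyMeasurable
    have h2 : ContinuousOn (fun p : Matrix (Fin d) (Fin d) ℂ × Matrix (Fin d) (Fin d) ℂ =>
        cfc Real.log (sh ε p.2))
        ({A | A.PosSemidef} ×ˢ {A | A.PosSemidef}) :=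
      (continuousOn_log_shift hε).comp continuousOn_snd fun p hp => hp.2
    exact continuous_tr.comp_continuousOn (continuousOn_fst.mul h2)
  have hT2 : Integrable (fun y => ((1 : Matrix (Fin d) (Fin d) ℂ) *
      cfc Real.log (sh ε (B y))).trace.re) μ := by
    refine (integrable_const (K * (1 : Matrix (Fin d) (Fin d) ℂ).trace.re)).mono' ?_
      (ae_of_all _ fun y => log_shift_bound Matrix.PosSemidef.one (hBp y) hε (hβ y))
    refine (sm_comp (K := {A : Matrix (Fin d) (Fin d) ℂ | A.PosSemidef})
      (F := fun X => ((1 : Matrix (Fin d) (Fin d) ℂ) * cfc Real.log (sh ε X)).trace.re) ?_ hBm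
      hBp).aestronglyMeasurable
    exact continuous_tr.comp_continuousOn (continuousOn_const.mul (continuousOn_log_shift hε))
  have hT2' : Integrable (fun p : Y × Z => ((1 : Matrix (Fin d) (Fin d) ℂ) *
      cfc Real.log (sh ε (B p.1))).trace.re) (μ.prod ν) := hT2.comp_fst ν
  have hG : Integrable (fun p : Y × Z => rD (sh ε (A p)) (sh ε (B p.1))) (μ.prod ν) := by
    simp only [gfun_eq]
    exact (hEA.neg.sub hT1).sub (hT2'.const_mul ε)
  -- Jensen for a.e. z
  have hJ : ∀ᵐ z ∂ν, rD (sh ε (C z)) (sh ε D) ≤ ∫ y, rD (sh ε (A (y, z))) (sh ε (B y)) ∂μ := by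
    filter_upwards [hG.prod_left_ae, hi.prod_left_ae] with z h1 h2
    have h3 : Integrable (fun y => (A (y, z), B y)) μ := h2.prodMk hBi
    have := (gfun_convex hε).map_integral_le (gfun_cont hε) (isClosed_psd.prod isClosed_psd)
      (ae_of_all μ fun y => (⟨hA (y, z), hBp y⟩ : (A (y, z), B y) ∈ _ ×ˢ _)) h3 h1
    rw [integral_pair h2 hBi, hBD] at this
    exact this
  have hL : Integrable (fun z => rD (sh ε (C z)) (sh ε D)) ν := by
    simp only [gfun_eq]
    exact (hEC.neg.sub (integrable_trmul hCi _)).sub (integrable_const _)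
  have hint := integral_mono_ae hL hG.integral_prod_right hJ
  have hLval : ∫ z, rD (sh ε (C z)) (sh ε D) ∂ν = -(∫ z, vnEnt (sh ε (C z)) ∂ν) + vnEnt (sh ε D) := by
    simp only [gfun_eq]
    rw [int3 hEC (integrable_trmul hCi _) (integrable_const _), integral_trmul hCi, hCD,
      vnEnt_eq_log (herm_shift hDp.1 ε)]
    simp [add_mul]
    ring
  have hRval : ∫ z, ∫ y, rD (sh ε (A (y, z))) (sh ε (B y)) ∂μ ∂ν =
      -(∫ p, vnEnt (sh ε (A p)) ∂(μ.prod ν)) + ∫ y, vnEnt (sh ε (B y)) ∂μ := by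
    rw [← integral_prod_symm _ hG]
    simp only [gfun_eq]
    rw [int3 hEA hT1 (hT2'.const_mul ε)]
    have e1 : ∫ p : Y × Z, (A p * cfc Real.log (sh ε (B p.1))).trace.re ∂(μ.prod ν) =
        ∫ y, (B y * cfc Real.log (sh ε (B y))).trace.re ∂μ := by
      rw [integral_prod _ hT1]
      refine integral_congr_ae ?_
      filter_upwards [hi.prod_right_ae] with y hy
      exact integral_trmul hy _
    have e2 : ∫ p : Y × Z, ε * ((1 : Matrix (Fin d) (Fin d) ℂ) *
        cfc Real.log (sh ε (B p.1))).trace.re ∂(μ.prod ν) =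
        ∫ y, ε * ((1 : Matrix (Fin d) (Fin d) ℂ) * cfc Real.log (sh ε (B y))).trace.re ∂μ := by
      rw [integral_prod _ (hT2'.const_mul ε)]
      simp
    have hT1' : Integrable (fun y => (B y * cfc Real.log (sh ε (B y))).trace.re) μ := by
      refine hT1.integral_prod_left.congr ?_
      filter_upwards [hi.prod_right_ae] with y hy
      exact integral_trmul hy _
    rw [e1, e2, sub_sub, ← integral_add hT1' (hT2.const_mul ε), sub_eq_add_neg]
    rw [add_right_inj]
    rw [← integral_neg]
    refine integral_congr_ae (ae_of_all _ fun y => ?_)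
    simp only
    rw [vnEnt_eq_log (herm_shift (hBp y).1 ε)]
    simp [add_mul]
  rw [hLval] at hint
  have hint := hint.trans_eq hRval
  linarith

lemma jensen_main {A : Y × Z → Matrix (Fin d) (Fin d) ℂ} (hm : StronglyMeasurable A)
    (hi : Integrable A (μ.prod ν)) (hA : ∀ p, (A p).PosSemidef)
    (he : Integrable (fun p => vnEnt (A p)) (μ.prod ν))
    {β : ℝ} (hβ : ∀ y, (∫ z, A (y, z) ∂ν).trace.re ≤ β)
    (heB : Integrable (fun y => vnEnt (∫ z, A (y, z) ∂ν)) μ)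
    (heC : Integrable (fun z => vnEnt (∫ y, A (y, z) ∂μ)) ν) :
    vnEnt (∫ p, A p ∂(μ.prod ν)) - ∫ z, vnEnt (∫ y, A (y, z) ∂μ) ∂ν ≤
      (∫ y, vnEnt (∫ z, A (y, z) ∂ν) ∂μ) - ∫ p, vnEnt (A p) ∂(μ.prod ν) := by
  refine le_of_tendsto_of_tendsto
    ((vnEnt_shift_tendsto (integral_psd hA).1).sub (sh_lim hm.integral_prod_left'
      hi.integral_prod_right (fun z => integral_psd fun y => hA _) heC))
    ((sh_lim hm.integral_prod_right' hi.integral_prod_left (fun y => integral_psd fun z => hA _) heB).sub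
      (sh_lim hm hi hA he)) ?_
  filter_upwards [Ioc_mem_nhdsGT (zero_lt_one' ℝ)] with ε h
  exact jensen_eps hm hi hA he hβ heB heC h.1 h.2

lemma jensen_conc {A : Y → Matrix (Fin d) (Fin d) ℂ}
    (hi : Integrable A μ) (hA : ∀ p, (A p).PosSemidef)
    (he : Integrable (fun p => vnEnt (A p)) μ) :
    ∫ y, vnEnt (A y) ∂μ ≤ vnEnt (∫ y, A y ∂μ) :=
  concaveOn_vnEnt.le_map_integral (continuousOn_vnEnt.mono fun _ h => h.1) isClosed_psd
    (ae_of_all _ hA) hi he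

end Main
end Jensen
end QD

namespace QD

section Gauss
variable {n : ℕ}

/-- Gaussian measure -/
def gM (n : ℕ) : Measure (En n) :=
  (volume : Measure (En n)).withDensity (fun z => ENNReal.ofReal (gaussDensity n z))

lemma gd_pos (z : En n) : 0 < gaussDensity n z := by unfold gaussDensity; positivity

lemma gd_cont : Continuous (gaussDensity n) := by unfold gaussDensity; fun_prop

lemma gd_le (z : En n) : gaussDensity n z ≤ (2 * π) ^ (-(n : ℝ) / 2) := by
  unfold gaussDensity
  have h1 : Real.exp (-‖z‖ ^ 2 / 2) ≤ 1 := by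
    rw [Real.exp_le_one_iff]; nlinarith [sq_nonneg ‖z‖]
  have : 0 ≤ (2 * π) ^ (-(n : ℝ) / 2) := by positivity
  nlinarith

lemma exp_integrable {b : ℝ} (hb : 0 < b) : Integrable (fun z : En n => Real.exp (-b * ‖z‖ ^ 2)) := by
  by_contra h
  have h1 := GaussianFourier.integral_rexp_neg_mul_sq_norm (V := En n) hb
  rw [integral_undef h] at h1
  have : 0 < (π / b) ^ (Module.finrank ℝ (En n) / 2 : ℝ) := by positivity
  linarith

lemma gd_integral : ∫ z, gaussDensity n z = 1 := by
  unfold gaussDensity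
  rw [integral_const_mul]
  have h1 := GaussianFourier.integral_rexp_neg_mul_sq_norm (V := En n) (show (0 : ℝ) < 1 / 2 by norm_num)
  have h2 : ∀ z : En n, -‖z‖ ^ 2 / 2 = -(1 / 2) * ‖z‖ ^ 2 := fun z => by ring
  simp only [h2]
  rw [h1, finrank_euclideanSpace_fin]
  have : π / (1 / 2) = 2 * π := by ring
  rw [this, ← Real.rpow_add (by positivity)]
  have : -(n : ℝ) / 2 + n / 2 = 0 := by ring
  rw [this, Real.rpow_zero]

lemma gd_integrable : Integrable (gaussDensity n) := by
  by_contra h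
  have := gd_integral (n := n)
  rw [integral_undef h] at this
  norm_num at this

lemma gd_sq_integrable : Integrable (fun z : En n => ‖z‖ ^ 2 * gaussDensity n z) := by
  refine (((exp_integrable (n := n) (show (0 : ℝ) < 1 / 4 by norm_num)).const_mul
    (4 * (2 * π) ^ (-(n : ℝ) / 2))).mono' ?_ (ae_of_all _ fun z => ?_))
  · exact (by have := gd_cont (n := n); fun_prop : Continuous _).aestronglyMeasurable
  · rw [Real.norm_of_nonneg (by have := (gd_pos z).le; positivity)]
    unfold gaussDensity
    have h1 : ‖z‖ ^ 2 ≤ 4 * Real.exp (‖z‖ ^ 2 / 4) := by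
      have := Real.add_one_le_exp (‖z‖ ^ 2 / 4); linarith
    have h2 : Real.exp (-(1 / 4) * ‖z‖ ^ 2) = Real.exp (‖z‖ ^ 2 / 4) * Real.exp (-‖z‖ ^ 2 / 2) := by
      rw [← Real.exp_add]; congr 1; ring
    rw [h2]
    have : 0 < (2 * π) ^ (-(n : ℝ) / 2) * Real.exp (-‖z‖ ^ 2 / 2) := by positivity
    nlinarith

lemma gd_log_integrable : Integrable (fun z : En n => gaussDensity n z * Real.log (gaussDensity n z)) := by
  have h : ∀ z : En n, gaussDensity n z * Real.log (gaussDensity n z) =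
      Real.log ((2 * π) ^ (-(n : ℝ) / 2)) * gaussDensity n z - (1 / 2) * (‖z‖ ^ 2 * gaussDensity n z) := by
    intro z
    have : Real.log (gaussDensity n z) = Real.log ((2 * π) ^ (-(n : ℝ) / 2)) - ‖z‖ ^ 2 / 2 := by
      unfold gaussDensity
      rw [Real.log_mul (by positivity) (by positivity), Real.log_exp]; ring
    rw [this]; ring
  simp only [h]
  exact (gd_integrable.const_mul _).sub (gd_sq_integrable.const_mul _)

instance : IsProbabilityMeasure (gM n) := by
  constructor
  unfold gM
  rw [withDensity_apply _ MeasurableSet.univ, Measure.restrict_univ,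
    ← ofReal_integral_eq_lintegral_ofReal gd_integrable (ae_of_all _ fun z => (gd_pos z).le), gd_integral]
  simp

variable {E : Type*} [NormedAddCommGroup E] [NormedSpace ℝ E]

lemma gM_integrable_iff {g : En n → E} :
    Integrable g (gM n) ↔ Integrable (fun z => gaussDensity n z • g z) := by
  unfold gM
  rw [integrable_withDensity_iff_integrable_smul' (by have := gd_cont (n := n); fun_prop)
    (ae_of_all _ fun z => ENNReal.ofReal_lt_top)]
  simp only [ENNReal.toReal_ofReal (gd_pos _).le]

lemma gM_integral (g : En n → E) :
    ∫ z, g z ∂(gM n) = ∫ z, gaussDensity n z • g z := by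
  unfold gM
  rw [integral_withDensity_eq_integral_toReal_smul (by have := gd_cont (n := n); fun_prop)
    (ae_of_all _ fun z => ENNReal.ofReal_lt_top)]
  simp only [ENNReal.toReal_ofReal (gd_pos _).le]

lemma gM_charFun (w : En n) : charFun (gM n) w = Complex.exp (-‖w‖ ^ 2 / 2) := by
  rw [charFun_apply, gM_integral]
  have h := GaussianFourier.integral_cexp_neg_mul_sq_norm_add (V := En n) (b := 1 / 2)
    (by norm_num) Complex.I w
  have h2 : ∀ z : En n, gaussDensity n z • Complex.exp ((inner ℝ z w : ℝ) * Complex.I) =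
      (((2 * π) ^ (-(n : ℝ) / 2) : ℝ) : ℂ) *
        Complex.exp (-(1 / 2) * (‖z‖ : ℂ) ^ 2 + Complex.I * (inner ℝ w z : ℝ)) := by
    intro z
    rw [Complex.exp_add, Complex.real_smul]
    unfold gaussDensity
    push_cast
    rw [real_inner_comm z w, mul_assoc]
    congr 2
    · congr 1; ring
    · congr 1; ring
  simp only [h2]
  rw [integral_const_mul, h, finrank_euclideanSpace_fin]
  have h3 : ((π : ℂ) / (1 / 2)) ^ ((n : ℂ) / 2) = (((2 * π) ^ ((n : ℝ) / 2) : ℝ) : ℂ) := by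
    rw [Complex.ofReal_cpow (by positivity)]
    push_cast
    congr 1; ring
  rw [h3, ← mul_assoc, ← Complex.ofReal_mul, ← Real.rpow_add (by positivity)]
  have : -(n : ℝ) / 2 + n / 2 = 0 := by ring
  rw [this, Real.rpow_zero, Complex.I_sq]
  simp
  congr 1; ring

lemma gM_semi {t s : ℝ} (ht : 0 ≤ t) (hs : 0 ≤ s) :
    ((gM n).prod (gM n)).map (fun p => √t • p.1 + √s • p.2) = (gM n).map (fun z => √(t + s) • z) := by
  have : IsProbabilityMeasure ((gM n).map (fun z => √(t + s) • z)) :=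
    Measure.isProbabilityMeasure_map (by fun_prop)
  have : IsProbabilityMeasure (((gM n).prod (gM n)).map (fun p => √t • p.1 + √s • p.2)) :=
    Measure.isProbabilityMeasure_map (by fun_prop)
  apply Measure.ext_of_charFun
  ext w
  rw [charFun_map_smul, gM_charFun, charFun_apply, integral_map (by fun_prop) (by fun_prop)]
  have h : ∀ p : En n × En n, Complex.exp ((inner ℝ (√t • p.1 + √s • p.2) w : ℝ) * Complex.I) =
      Complex.exp ((inner ℝ p.1 (√t • w) : ℝ) * Complex.I) *
        Complex.exp ((inner ℝ p.2 (√s • w) : ℝ) * Complex.I) := by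
    intro p
    rw [← Complex.exp_add, inner_add_left, real_inner_smul_left, real_inner_smul_left,
      real_inner_smul_right, real_inner_smul_right]
    push_cast; congr 1; ring
  simp only [h]
  rw [integral_prod_mul (fun y : En n => Complex.exp ((inner ℝ y (√t • w) : ℝ) * Complex.I))
    (fun y : En n => Complex.exp ((inner ℝ y (√s • w) : ℝ) * Complex.I)),
    ← charFun_apply, ← charFun_apply, gM_charFun, gM_charFun, ← Complex.exp_add]
  congr 1
  rw [norm_smul, norm_smul, norm_smul]
  simp only [Real.norm_of_nonneg (Real.sqrt_nonneg _)]
  push_cast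
  rw [mul_pow, mul_pow, mul_pow]
  norm_cast
  rw [Real.sq_sqrt ht, Real.sq_sqrt hs, Real.sq_sqrt (by positivity)]
  ring

end Gauss
end QD

namespace QD

section Smooth
variable {n : ℕ} {E : Type*} [NormedAddCommGroup E] [NormedSpace ℝ E]

lemma shear_mp (ν : Measure (En n)) [SFinite ν] (c : ℝ) :
    MeasurePreserving (fun p : En n × En n => (p.1 - c • p.2, p.2)) (volume.prod ν) (volume.prod ν) := by
  have h1 : MeasurePreserving (fun p : En n × En n => (p.1, p.2 - c • p.1)) (ν.prod volume) (ν.prod volume) := by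
    refine MeasurePreserving.skew_product (f := id) (g := fun z x => x - c • z)
      (MeasurePreserving.id ν) (by fun_prop) ?_
    refine ae_of_all _ fun z => ?_
    exact (measurePreserving_sub_right volume (c • z)).map_eq
  exact (Measure.measurePreserving_swap.comp h1).comp Measure.measurePreserving_swap

lemma shear_integrable {ν : Measure (En n)} [SFinite ν] (c : ℝ) {ψ : En n × En n → E}
    (hψ : Integrable ψ (volume.prod ν)) :
    Integrable (fun p : En n × En n => ψ (p.1 - c • p.2, p.2)) (volume.prod ν) :=
  (shear_mp ν c).integrable_comp_of_integrable hψ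

lemma shear_integral {ν : Measure (En n)} [SFinite ν] (c : ℝ) {ψ : En n × En n → E}
    (hψ : StronglyMeasurable ψ) :
    ∫ p : En n × En n, ψ (p.1 - c • p.2, p.2) ∂(volume.prod ν) = ∫ p, ψ p ∂(volume.prod ν) := by
  have h := (shear_mp ν c).map_eq
  conv_rhs => rw [← h]
  rw [integral_map (shear_mp ν c).measurable.aemeasurable hψ.aestronglyMeasurable]

/-- heat semigroup -/
def P (t : ℝ) (φ : En n → E) (x : En n) : E := ∫ z, φ (x - √t • z) ∂(gM n)

lemma P_zero [CompleteSpace E] (φ : En n → E) : P 0 φ = φ := by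
  ext x; simp [P]

lemma slice_sm {φ : En n → E} (hm : StronglyMeasurable φ) (t : ℝ) :
    StronglyMeasurable (fun p : En n × En n => φ (p.1 - √t • p.2)) :=
  hm.comp_measurable (by fun_prop)

lemma P_sm {φ : En n → E} (hm : StronglyMeasurable φ) (t : ℝ) : StronglyMeasurable (P t φ) :=
  (slice_sm hm t).integral_prod_right'

lemma prod_int {φ : En n → E} (hi : Integrable φ) (t : ℝ) :
    Integrable (fun p : En n × En n => φ (p.1 - √t • p.2)) (volume.prod (gM n)) :=
  shear_integrable (√t) (hi.comp_fst (gM n))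

lemma P_integrable {φ : En n → E} (hi : Integrable φ) (t : ℝ) : Integrable (P t φ) :=
  (prod_int hi t).integral_prod_left

lemma P_integral [CompleteSpace E] {φ : En n → E} (hm : StronglyMeasurable φ) (hi : Integrable φ) (t : ℝ) :
    ∫ x, P t φ x = ∫ x, φ x := by
  have h1 : ∫ x, P t φ x = ∫ p : En n × En n, φ (p.1 - √t • p.2) ∂(volume.prod (gM n)) :=
    (integral_prod _ (prod_int hi t)).symm
  rw [h1, shear_integral (√t) (ψ := fun p : En n × En n => φ p.1) (hm.comp_measurable measurable_fst),
    integral_prod _ (hi.comp_fst (gM n))]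
  simp

lemma gM_le : gM n ≤ ENNReal.ofReal ((2 * π) ^ (-(n : ℝ) / 2)) • (volume : Measure (En n)) := by
  unfold gM
  rw [← withDensity_const]
  exact withDensity_mono (ae_of_all _ fun z => ENNReal.ofReal_le_ofReal (gd_le z))

lemma slice_vol {φ : En n → E} (hi : Integrable φ) {t : ℝ} (ht : 0 < t) (x : En n) :
    Integrable (fun z => φ (x - √t • z)) :=
  (hi.comp_sub_left x).comp_smul (Real.sqrt_pos.2 ht).ne'

lemma slice_int {φ : En n → E} (hi : Integrable φ) {t : ℝ} (ht : 0 < t) (x : En n) :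
    Integrable (fun z => φ (x - √t • z)) (gM n) :=
  ((slice_vol hi ht x).smul_measure ENNReal.ofReal_ne_top).mono_measure gM_le

lemma P_bound {q : En n → ℝ} (hi : Integrable q) (h0 : ∀ x, 0 ≤ q x) {t : ℝ} (ht : 0 < t) :
    ∃ C, 0 < C ∧ ∀ x, P t q x ≤ C := by
  refine ⟨max 1 ((2 * π) ^ (-(n : ℝ) / 2) * (|((√t) ^ n)⁻¹| * ∫ x, q x)), by positivity, fun x => ?_⟩
  refine le_trans ?_ (le_max_right _ _)
  unfold P
  refine (integral_mono_measure gM_le (ae_of_all _ fun z => h0 _)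
    ((slice_vol hi ht x).smul_measure ENNReal.ofReal_ne_top)).trans_eq ?_
  rw [integral_smul_measure, ENNReal.toReal_ofReal (by positivity), smul_eq_mul]
  congr 1
  have := Measure.integral_comp_smul (volume : Measure (En n)) (fun w => q (x - w)) (√t)
  rw [this, integral_sub_left_eq_self q volume x, finrank_euclideanSpace_fin, smul_eq_mul]

lemma P_nonneg {q : En n → ℝ} (h0 : ∀ x, 0 ≤ q x) (t : ℝ) (x : En n) : 0 ≤ P t q x :=
  integral_nonneg fun _ => h0 _

lemma P_semi_integrable {φ : En n → E} (hm : StronglyMeasurable φ) (hi : Integrable φ)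
    {t s : ℝ} (ht : 0 < t) (hs : 0 < s) (x : En n) :
    Integrable (fun p : En n × En n => φ (x - √t • p.1 - √s • p.2)) ((gM n).prod (gM n)) := by
  have hm' : StronglyMeasurable (fun w => φ (x - w)) := hm.comp_measurable (by fun_prop)
  have h1 : Integrable (fun w => φ (x - w)) ((gM n).map (fun z => √(t + s) • z)) := by
    rw [integrable_map_measure hm'.aestronglyMeasurable (by fun_prop)]
    exact slice_int hi (add_pos ht hs) x
  rw [← gM_semi ht.le hs.le,
    integrable_map_measure hm'.aestronglyMeasurable (by fun_prop)] at h1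
  refine h1.congr (ae_of_all _ fun p => ?_)
  simp only [Function.comp, sub_sub]

lemma P_semi {φ : En n → E} (hm : StronglyMeasurable φ)
    {t s : ℝ} (ht : 0 ≤ t) (hs : 0 ≤ s) (x : En n) :
    ∫ p : En n × En n, φ (x - √t • p.1 - √s • p.2) ∂((gM n).prod (gM n)) = P (t + s) φ x := by
  have hm' : StronglyMeasurable (fun w => φ (x - w)) := hm.comp_measurable (by fun_prop)
  have h1 : ∫ w, φ (x - w) ∂((gM n).map (fun z => √(t + s) • z)) = P (t + s) φ x := by
    rw [integral_map (by fun_prop) hm'.aestronglyMeasurable]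
    rfl
  rw [← gM_semi ht hs, integral_map (by fun_prop) hm'.aestronglyMeasurable] at h1
  rw [← h1]
  simp only [sub_sub]

lemma P_sq {q : En n → ℝ} (hm : StronglyMeasurable q) (hi : Integrable q) (h0 : ∀ x, 0 ≤ q x)
    (h2 : Integrable fun x : En n => ‖x‖ ^ 2 * q x) (t : ℝ) :
    Integrable (fun x : En n => ‖x‖ ^ 2 * P t q x) := by
  have hz : Integrable (fun z : En n => ‖z‖ ^ 2) (gM n) := by
    rw [gM_integrable_iff]
    refine gd_sq_integrable.congr (ae_of_all _ fun z => ?_)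
    simp [mul_comm]
  have hA := (prod_int h2 t).const_mul 2
  have hB := (shear_integrable (√t) (hi.mul_prod hz)).const_mul (2 * (√t) ^ 2)
  have hC : Integrable (fun p : En n × En n => ‖p.1‖ ^ 2 * q (p.1 - √t • p.2)) (volume.prod (gM n)) := by
    refine (hA.add hB).mono' ?_ (ae_of_all _ fun p => ?_)
    · have : StronglyMeasurable (fun p : En n × En n => ‖p.1‖ ^ 2) :=
        (by fun_prop : Continuous _).stronglyMeasurable
      exact (this.mul (slice_sm hm t)).aestronglyMeasurable
    · have hq := h0 (p.1 - √t • p.2)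
      rw [Real.norm_of_nonneg (by positivity)]
      simp only [Pi.add_apply]
      have h3 : ‖p.1‖ ≤ ‖p.1 - √t • p.2‖ + √t * ‖p.2‖ := by
        have := norm_add_le (p.1 - √t • p.2) (√t • p.2)
        rwa [sub_add_cancel, norm_smul, Real.norm_of_nonneg (Real.sqrt_nonneg t)] at this
      have h4 : ‖p.1‖ ^ 2 ≤ 2 * ‖p.1 - √t • p.2‖ ^ 2 + 2 * (√t) ^ 2 * ‖p.2‖ ^ 2 := by
        have h5 := pow_le_pow_left₀ (norm_nonneg p.1) h3 2
        nlinarith [sq_nonneg (‖p.1 - √t • p.2‖ - √t * ‖p.2‖)]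
      nlinarith [mul_le_mul_of_nonneg_right h4 hq]
  refine hC.integral_prod_left.congr (ae_of_all _ fun x => ?_)
  simp only [P, integral_const_mul]

lemma P_log {q : En n → ℝ} (hm : StronglyMeasurable q) (hi : Integrable q) (h0 : ∀ x, 0 ≤ q x)
    (h2 : Integrable fun x : En n => ‖x‖ ^ 2 * q x) {t : ℝ} (ht : 0 < t) :
    Integrable (fun x : En n => P t q x * Real.log (P t q x)) := by
  obtain ⟨C, hC0, hC⟩ := P_bound hi h0 ht
  have hdom : Integrable (fun x : En n => |Real.log C| * P t q x + ‖x‖ ^ 2 * P t q x +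
      Real.exp (-1) * Real.exp (-1 * ‖x‖ ^ 2)) :=
    (((P_integrable hi t).const_mul _).add (P_sq hm hi h0 h2 t)).add
      ((exp_integrable one_pos).const_mul _)
  refine hdom.mono' ?_ (ae_of_all _ fun x => ?_)
  · have := (P_sm hm t).measurable
    exact (this.mul this.log).aestronglyMeasurable
  · rw [← Real.exp_add]
    have hu0 := P_nonneg h0 t x
    have huC := hC x
    generalize P t q x = u at *
    rcases hu0.eq_or_lt with h | h
    · rw [← h]; simp; positivity
    have hE := Real.exp_pos (-1 + -1 * ‖x‖ ^ 2)
    have hr : 0 ≤ ‖x‖ ^ 2 := by positivity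
    rw [Real.norm_eq_abs, abs_le]
    constructor
    · have := Real.log_le_sub_one_of_pos (div_pos hE h)
      rw [Real.log_div hE.ne' h.ne', Real.log_exp] at this
      have h5 := mul_le_mul_of_nonneg_left this h.le
      have h6 : u * (Real.exp (-1 + -1 * ‖x‖ ^ 2) / u - 1) = Real.exp (-1 + -1 * ‖x‖ ^ 2) - u := by
        field_simp
      rw [h6] at h5
      nlinarith [abs_nonneg (Real.log C), mul_nonneg (abs_nonneg (Real.log C)) h.le]
    · have : Real.log u ≤ |Real.log C| := (Real.log_le_log h huC).trans (le_abs_self _)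
      nlinarith [mul_le_mul_of_nonneg_left this h.le]

end Smooth
end QD

namespace QD

section Assem
open scoped Matrix.Norms.L2Operator
variable {d : ℕ}

lemma psd_eig_le {A : Matrix (Fin d) (Fin d) ℂ} (hA : A.PosSemidef) (i : Fin d) :
    hA.1.eigenvalues i ≤ A.trace.re := by
  rw [trace_eq_sum hA.1]
  exact Finset.single_le_sum (fun k _ => hA.eigenvalues_nonneg k) (Finset.mem_univ i)

lemma psd_norm_le {A : Matrix (Fin d) (Fin d) ℂ} (hA : A.PosSemidef) : ‖A‖ ≤ A.trace.re := by
  have h := spectral' hA.1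
  rw [h, ← h]
  conv_lhs => rw [h]
  rw [CStarRing.norm_mul_mem_unitary _ (Unitary.star_mem hA.1.eigenvectorUnitary.2),
    CStarRing.norm_coe_unitary_mul, Matrix.l2_opNorm_diagonal]
  refine (pi_norm_le_iff_of_nonneg (psd_tr_nonneg hA)).2 fun i => ?_
  simp only [Complex.norm_real]
  have : ‖hA.1.eigenvalues i‖ = hA.1.eigenvalues i := Real.norm_of_nonneg (hA.eigenvalues_nonneg i)
  simpa [this] using psd_eig_le hA i

lemma psd_zero {A : Matrix (Fin d) (Fin d) ℂ} (hA : A.PosSemidef) (h : A.trace.re = 0) : A = 0 := by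
  have := psd_norm_le hA
  rw [h] at this
  exact norm_le_zero_iff.1 this

lemma vnEnt_state_bound {A : Matrix (Fin d) (Fin d) ℂ} (hA : A.PosSemidef) (h1 : A.trace.re = 1) :
    |vnEnt A| ≤ d := by
  rw [vnEnt_eq hA.1]
  refine (Finset.abs_sum_le_sum_abs _ _).trans ?_
  have : ∀ i ∈ Finset.univ, |negMulLog (hA.1.eigenvalues i)| ≤ 1 := by
    intro i _
    have h0 := hA.eigenvalues_nonneg i
    have h2 := psd_eig_le hA i
    rw [h1] at h2
    generalize hA.1.eigenvalues i = u at *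
    rw [abs_of_nonneg (negMulLog_nonneg h0 h2)]
    rcases h0.eq_or_lt with h | h
    · rw [← h]; simp
    have h5 := Real.one_sub_inv_le_log_of_pos h
    have h6 := mul_le_mul_of_nonneg_left h5 h.le
    have h7 : u * (1 - u⁻¹) = u - 1 := by field_simp
    unfold negMulLog
    linarith
  exact (Finset.sum_le_sum this).trans (by simp)

lemma ent_bound {A : Matrix (Fin d) (Fin d) ℂ} (hA : A.PosSemidef) :
    |vnEnt A| ≤ d * A.trace.re + |A.trace.re * Real.log A.trace.re| := by
  rcases (psd_tr_nonneg hA).eq_or_lt with h | h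
  · have h0 : vnEnt (0 : Matrix (Fin d) (Fin d) ℂ) = 0 := by
      have := vnEnt_smul hA.1 0
      simpa using this
    rw [psd_zero hA h.symm, h0]
    simp
  set p := A.trace.re with hp
  have hB : (p⁻¹ • A).PosSemidef := posSemidef_rsmul hA (by positivity)
  have hBt : (p⁻¹ • A).trace.re = 1 := by
    simp [← hp, h.ne']
  have hAe : A = p • (p⁻¹ • A) := by rw [smul_smul, mul_inv_cancel₀ h.ne', one_smul]
  rw [hAe, vnEnt_smul hB.1, hBt, mul_one]
  refine (abs_add_le _ _).trans ?_
  rw [abs_mul, abs_of_pos h]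
  have := vnEnt_state_bound hB hBt
  have e : |negMulLog p| = |p * Real.log p| := by unfold negMulLog; rw [neg_mul, abs_neg]
  rw [e]
  nlinarith

lemma int_entry {α : Type*} [MeasurableSpace α] {μ : Measure α}
    {G : α → Matrix (Fin d) (Fin d) ℂ} (hG : Integrable G μ) (i j : Fin d) :
    (∫ a, G a ∂μ) i j = ∫ a, G a i j ∂μ := by
  let T : Matrix (Fin d) (Fin d) ℂ →L[ℝ] ℂ :=
    LinearMap.toContinuousLinearMap
      { toFun := fun G => G i j
        map_add' := by intro a b; rfl
        map_smul' := by intro a b; rfl }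
  exact (T.integral_comp_comm hG).symm

lemma condEnt_gen {α : Type*} [MeasureSpace α] {p : α → ℝ} {ρ : α → Matrix (Fin d) (Fin d) ℂ}
    (hh : ∀ a, (ρ a).IsHermitian) (ht : ∀ a, p a ≠ 0 → (ρ a).trace.re = 1)
    (hi : Integrable (fun a => p a • ρ a)) (hlog : Integrable (fun a => p a * Real.log (p a)))
    (he : Integrable (fun a => vnEnt (p a • ρ a))) :
    condEnt p ρ = (∫ a, vnEnt (p a • ρ a)) - vnEnt (∫ a, p a • ρ a) := by
  have h1 : ∀ a, p a * vnEnt (ρ a) = vnEnt (p a • ρ a) + p a * Real.log (p a) := by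
    intro a
    rw [vnEnt_smul (hh a)]
    by_cases h : p a = 0
    · simp [h]
    · rw [ht a h]; unfold negMulLog; ring
  have h2 : avgState p ρ = ∫ a, p a • ρ a := by
    ext i j
    rw [int_entry hi]
    simp [avgState]
  unfold condEnt clEnt
  rw [h2]
  simp only [h1]
  rw [integral_add he hlog]
  ring

lemma ent_integrable {α : Type*} [MeasurableSpace α] {μ : Measure α}
    {F : α → Matrix (Fin d) (Fin d) ℂ} (hm : StronglyMeasurable F) (hi : Integrable F μ)
    (hF : ∀ a, (F a).PosSemidef)
    (hl : Integrable (fun a => (F a).trace.re * Real.log (F a).trace.re) μ) :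
    Integrable (fun a => vnEnt (F a)) μ :=
  (((integrable_tr hi).const_mul (d : ℝ)).add hl.abs).mono' (sm_vnEnt hm hF).aestronglyMeasurable
    (ae_of_all _ fun a => ent_bound (hF a))

end Assem
end QD

namespace QD

section Heat
open scoped Matrix.Norms.L2Operator
variable {n d : ℕ} {f : En n → Matrix (Fin d) (Fin d) ℂ}

/-- The entropy functional along the heat flow. -/
def H (f : En n → Matrix (Fin d) (Fin d) ℂ) (t : ℝ) : ℝ := ∫ x, vnEnt (P t f x)

lemma P_psd (hp : ∀ x, (f x).PosSemidef) (t : ℝ) (x : En n) : (P t f x).PosSemidef :=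
  integral_psd fun _ => hp _

lemma P_tr (hi : Integrable f) {t : ℝ} (ht : 0 ≤ t) (x : En n) :
    (P t f x).trace.re = P t (fun y => (f y).trace.re) x := by
  rcases ht.eq_or_lt with h | h
  · subst h; rw [P_zero, P_zero]
  · exact (integral_tr (slice_int hi h x)).symm

lemma P_ent_log (hm : StronglyMeasurable f) (hi : Integrable f) (hp : ∀ x, (f x).PosSemidef)
    (h2 : Integrable fun x : En n => ‖x‖ ^ 2 * (f x).trace.re)
    (hl : Integrable fun x : En n => (f x).trace.re * Real.log (f x).trace.re)
    {t : ℝ} (ht : 0 ≤ t) :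
    Integrable (fun x => (P t f x).trace.re * Real.log (P t f x).trace.re) := by
  rcases ht.eq_or_lt with h | h
  · subst h; rw [P_zero]; exact hl
  · simp only [P_tr hi ht]
    refine P_log ?_ (integrable_tr hi) (fun x => psd_tr_nonneg (hp x)) h2 h
    have := (trL (1 : Matrix (Fin d) (Fin d) ℂ)).continuous.comp_stronglyMeasurable hm
    simpa [trL_apply] using this

lemma P_ent (hm : StronglyMeasurable f) (hi : Integrable f) (hp : ∀ x, (f x).PosSemidef)
    (h2 : Integrable fun x : En n => ‖x‖ ^ 2 * (f x).trace.re)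
    (hl : Integrable fun x : En n => (f x).trace.re * Real.log (f x).trace.re)
    {t : ℝ} (ht : 0 ≤ t) : Integrable (fun x => vnEnt (P t f x)) :=
  ent_integrable (P_sm hm t) (P_integrable hi t) (P_psd hp t) (P_ent_log hm hi hp h2 hl ht)

lemma P_comp (hm : StronglyMeasurable f) (hi : Integrable f) {t s : ℝ} (ht : 0 < t) (hs : 0 < s)
    (x : En n) : P s (P t f) x = P (t + s) f x := by
  rw [add_comm t s, ← P_semi hm hs.le ht.le x, integral_prod _ (P_semi_integrable hm hi hs ht x)]
  rfl

lemma H_mono (hm : StronglyMeasurable f) (hi : Integrable f) (hp : ∀ x, (f x).PosSemidef)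
    (h2 : Integrable fun x : En n => ‖x‖ ^ 2 * (f x).trace.re)
    (hl : Integrable fun x : En n => (f x).trace.re * Real.log (f x).trace.re)
    {t s : ℝ} (ht : 0 < t) (hs : 0 < s) : H f t ≤ H f (t + s) := by
  have he := P_ent hm hi hp h2 hl ht.le
  have h1 := P_integral (sm_vnEnt (P_sm hm t) (P_psd hp t)) he s
  unfold H
  rw [← h1]
  refine integral_mono (P_integrable he s) (P_ent hm hi hp h2 hl (add_pos ht hs).le) fun x => ?_
  have := jensen_conc (slice_int (P_integrable hi t) hs x) (fun z => P_psd hp t _) (slice_int he hs x)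
  have h3 := P_comp hm hi ht hs x
  unfold P at h3 this ⊢
  simp only [h3] at this
  exact this

lemma H_sub (hm : StronglyMeasurable f) (hi : Integrable f) (hp : ∀ x, (f x).PosSemidef)
    (h2 : Integrable fun x : En n => ‖x‖ ^ 2 * (f x).trace.re)
    (hl : Integrable fun x : En n => (f x).trace.re * Real.log (f x).trace.re)
    {t s : ℝ} (ht : 0 < t) (hs : 0 < s) : H f (t + s) - H f t ≤ H f s - H f 0 := by
  have het := P_ent hm hi hp h2 hl ht.le
  have hes := P_ent hm hi hp h2 hl hs.le
  have hets := P_ent hm hi hp h2 hl (add_pos ht hs).le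
  have he0 : Integrable (fun x => vnEnt (f x)) := by
    have := P_ent hm hi hp h2 hl le_rfl
    rwa [P_zero] at this
  have hm0 := sm_vnEnt hm hp
  have h1 : ∫ x, P s (fun y => vnEnt (P t f y)) x = H f t :=
    P_integral (sm_vnEnt (P_sm hm t) (P_psd hp t)) het s
  have h3 : ∫ x, P t (fun y => vnEnt (P s f y)) x = H f s :=
    P_integral (sm_vnEnt (P_sm hm s) (P_psd hp s)) hes t
  have h4 : ∫ x, P (t + s) (fun y => vnEnt (f y)) x = H f 0 := by
    rw [P_integral hm0 he0]; unfold H; rw [P_zero]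
  rw [← h1, ← h3, ← h4]
  have h5 : H f (t + s) = ∫ x, vnEnt (P (t + s) f x) := rfl
  rw [h5, ← integral_sub hets (P_integrable het s),
    ← integral_sub (P_integrable hes t) (P_integrable he0 (t + s))]
  refine integral_mono (hets.sub (P_integrable het s))
    ((P_integrable hes t).sub (P_integrable he0 (t + s))) fun x => ?_
  obtain ⟨C, -, hC⟩ := P_bound (integrable_tr hi) (fun x => psd_tr_nonneg (hp x)) hs
  have hcomm : ∀ z : En n, (∫ y, f (x - √t • y - √s • z) ∂(gM n)) = P t f (x - √s • z) := by
    intro z; unfold P; simp only [sub_right_comm]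
  have key := jensen_main (μ := gM n) (ν := gM n)
    (A := fun p : En n × En n => f (x - √t • p.1 - √s • p.2))
    (hm.comp_measurable (by fun_prop)) (P_semi_integrable hm hi ht hs x) (fun p => hp _)
    (P_semi_integrable hm0 he0 ht hs x) (β := C)
    (fun y => by
      have := hC (x - √t • y)
      rw [← P_tr hi hs.le] at this
      exact this)
    (slice_int hes ht x)
    (by simp only [hcomm]; exact slice_int het hs x)
  simp only [hcomm] at key
  rw [P_semi hm ht.le hs.le, P_semi hm0 ht.le hs.le] at key
  exact key

end Heat
end QD

namespace QD

section CQ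
open scoped Matrix.Norms.L2Operator
variable {n d : ℕ} {q : En n → ℝ} {σ : En n → Matrix (Fin d) (Fin d) ℂ}

/-- The matrix-valued density `q σ`. -/
def fq (q : En n → ℝ) (σ : En n → Matrix (Fin d) (Fin d) ℂ) (x : En n) :
    Matrix (Fin d) (Fin d) ℂ := q x • σ x

lemma fq_psd (h : IsCQState q σ) (x : En n) : (fq q σ x).PosSemidef :=
  posSemidef_rsmul (h.2.2.2.2 x).1 (h.2.1 x)

lemma fq_tr (h : IsCQState q σ) (x : En n) : (fq q σ x).trace.re = q x := by
  simp [fq, (h.2.2.2.2 x).2]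

lemma fq_sm (h : IsCQState q σ) : StronglyMeasurable (fq q σ) :=
  h.1.stronglyMeasurable.smul h.2.2.2.1.stronglyMeasurable

lemma q_int (h : IsCQState q σ) : Integrable q := by
  by_contra hc
  have := h.2.2.1
  rw [integral_undef hc] at this
  norm_num at this

lemma fq_int (h : IsCQState q σ) : Integrable (fq q σ) :=
  (q_int h).mono' (fq_sm h).aestronglyMeasurable
    (ae_of_all _ fun x => (psd_norm_le (fq_psd h x)).trans_eq (fq_tr h x))

lemma slice_int0 {E : Type*} [NormedAddCommGroup E] [NormedSpace ℝ E] {φ : En n → E}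
    (hi : Integrable φ) {t : ℝ} (ht : 0 ≤ t) (x : En n) :
    Integrable (fun z => φ (x - √t • z)) (gM n) := by
  rcases ht.eq_or_lt with h | h
  · subst h; simp
  · exact slice_int hi h x

lemma marg_eq (t : ℝ) : margFst (noisyDensity (√t) q) = P t q := by
  ext x
  unfold P margFst noisyDensity
  rw [gM_integral]
  rfl

lemma margState_eq (h : IsCQState q σ) {t : ℝ} (ht : 0 ≤ t) (x : En n) :
    margFstState (noisyDensity (√t) q) (noisyState (√t) σ) x = (P t q x)⁻¹ • P t (fq q σ) x := by
  unfold margFstState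
  rw [marg_eq]
  have hi := slice_int0 (fq_int h) ht x
  have : (Matrix.of fun i j => ∫ y, ((noisyDensity (√t) q (x, y) : ℝ) : ℂ) * noisyState (√t) σ (x, y) i j)
      = P t (fq q σ) x := by
    ext i j
    unfold P
    rw [gM_integral, int_entry (gM_integrable_iff.1 hi)]
    simp [noisyDensity, noisyState, fq, mul_assoc]
  rw [this, rsmul_eq, Complex.ofReal_inv]

lemma P_tr_q (h : IsCQState q σ) {t : ℝ} (ht : 0 ≤ t) (x : En n) :
    (P t (fq q σ) x).trace.re = P t q x := by
  rw [P_tr (fq_int h) ht]; simp only [fq_tr h]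

lemma heatEnt_eq (h : IsCQState q σ) (hX2 : Integrable fun x : En n => ‖x‖ ^ 2 * q x)
    (hfin : EntFinite q σ) {t : ℝ} (ht : 0 ≤ t) :
    heatEnt q σ t = H (fq q σ) t - vnEnt (∫ x, fq q σ x) := by
  have h2 : Integrable fun x : En n => ‖x‖ ^ 2 * (fq q σ x).trace.re := by simpa only [fq_tr h]
  have hl : Integrable fun x : En n => (fq q σ x).trace.re * Real.log (fq q σ x).trace.re := by
    simpa only [fq_tr h] using hfin.1
  have hps : ∀ x, P t q x • ((P t q x)⁻¹ • P t (fq q σ) x) = P t (fq q σ) x := by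
    intro x
    by_cases h0 : P t q x = 0
    · have := psd_zero (P_psd (fq_psd h) t x) (by rw [P_tr_q h ht, h0])
      rw [this]; simp
    · rw [smul_smul, mul_inv_cancel₀ h0, one_smul]
  have hlog := P_ent_log (fq_sm h) (fq_int h) (fq_psd h) h2 hl ht
  simp only [P_tr_q h ht] at hlog
  unfold heatEnt
  rw [marg_eq, funext (margState_eq h ht), condEnt_gen]
  · simp only [hps]
    rw [P_integral (fq_sm h) (fq_int h)]
    rfl
  · intro x
    exact herm_rsmul (P_psd (fq_psd h) t x).1 _
  · intro x hx
    simp [P_tr_q h ht, hx]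
  · simp only [hps]; exact P_integrable (fq_int h) t
  · exact hlog
  · simp only [hps]; exact P_ent (fq_sm h) (fq_int h) (fq_psd h) h2 hl ht

lemma gd_nml : Integrable (fun z : En n => negMulLog (gaussDensity n z)) := by
  refine gd_log_integrable.neg.congr (ae_of_all _ fun z => ?_)
  simp [negMulLog]

lemma cond_snd (h : IsCQState q σ) (c : ℝ) :
    condEnt (margSnd (noisyDensity c q)) (margSndState (noisyDensity c q) (noisyState c σ)) =
      clEnt (gaussDensity n) := by
  have h1 : margSnd (noisyDensity c q) = gaussDensity n := by
    ext y
    simp only [margSnd, noisyDensity]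
    rw [integral_const_mul, integral_sub_right_eq_self (μ := volume) q, h.2.2.1, mul_one]
  have h2 : ∀ y, margSndState (noisyDensity c q) (noisyState c σ) y = ∫ x, fq q σ x := by
    intro y
    ext i j
    rw [int_entry (fq_int h)]
    unfold margSndState
    rw [h1]
    simp only [noisyDensity, noisyState, Matrix.smul_apply, Matrix.of_apply, Complex.ofReal_mul,
      mul_assoc, smul_eq_mul]
    rw [integral_const_mul,
      integral_sub_right_eq_self (μ := volume) (fun x => (q x : ℂ) * σ x i j), ← mul_assoc,
      inv_mul_cancel₀ (by exact_mod_cast (gd_pos y).ne'), one_mul]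
    simp [fq]
  have h3 : avgState (gaussDensity n) (fun _ => ∫ x, fq q σ x) = ∫ x, fq q σ x := by
    ext i j
    simp only [avgState, Matrix.of_apply]
    rw [integral_mul_const, integral_complex_ofReal, gd_integral]
    simp
  rw [h1, funext h2]
  unfold condEnt
  rw [h3, integral_mul_const, gd_integral]
  ring

lemma cond_joint (h : IsCQState q σ) (hfin : EntFinite q σ) (c : ℝ) :
    condEnt (noisyDensity c q) (noisyState c σ) =
      H (fq q σ) 0 + clEnt (gaussDensity n) - vnEnt (∫ x, fq q σ x) := by
  have hl : Integrable fun x : En n => (fq q σ x).trace.re * Real.log (fq q σ x).trace.re := by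
    simpa only [fq_tr h] using hfin.1
  have he : Integrable fun x => vnEnt (fq q σ x) := ent_integrable (fq_sm h) (fq_int h) (fq_psd h) hl
  let F : En n × En n → Matrix (Fin d) (Fin d) ℂ := fun p => gaussDensity n p.2 • fq q σ p.1
  have hFm : StronglyMeasurable F :=
    (gd_cont.stronglyMeasurable.comp_measurable measurable_snd).smul
      ((fq_sm h).comp_measurable measurable_fst)
  have hFp : ∀ p, (F p).PosSemidef := fun p => posSemidef_rsmul (fq_psd h _) (gd_pos _).le
  have hFi : Integrable F (volume.prod volume) := by
    have := ((gd_integrable (n := n)).smul_prod (fq_int h)).swap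
    exact this
  have hEe : ∀ p, vnEnt (F p) = vnEnt (fq q σ p.1) * gaussDensity n p.2 +
      q p.1 * negMulLog (gaussDensity n p.2) := by
    intro p
    simp only [F]
    rw [vnEnt_smul (fq_psd h _).1, fq_tr h]; ring
  have hE1 := he.mul_prod (gd_integrable (n := n))
  have hE2 := (q_int h).mul_prod (gd_nml (n := n))
  have hEi : Integrable (fun p => vnEnt (F p)) (volume.prod volume) := by
    simp only [hEe]; exact hE1.add hE2
  have hlogi : Integrable (fun p : En n × En n => (gaussDensity n p.2 * q p.1) *
      Real.log (gaussDensity n p.2 * q p.1)) (volume.prod volume) := by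
    have hq : Integrable (fun x => negMulLog (q x)) := by
      refine hfin.1.neg.congr (ae_of_all _ fun z => ?_)
      simp [negMulLog]
    refine (((q_int h).mul_prod (gd_nml (n := n))).add
      (hq.mul_prod (gd_integrable (n := n)))).neg.congr (ae_of_all _ fun p => ?_)
    have := negMulLog_mul (gaussDensity n p.2) (q p.1)
    have e : negMulLog (gaussDensity n p.2 * q p.1) = -((gaussDensity n p.2 * q p.1) *
      Real.log (gaussDensity n p.2 * q p.1)) := by unfold negMulLog; ring
    simp only [Pi.neg_apply, Pi.add_apply]
    linarith
  have hpF : ∀ p, noisyDensity c q p • noisyState c σ p = F (p.1 - c • p.2, p.2) := by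
    intro p
    simp [noisyDensity, noisyState, F, fq, smul_smul]
  have hI1 : ∫ p, F p ∂(volume.prod volume) = ∫ x, fq q σ x := by
    rw [integral_prod_symm _ hFi]
    simp only [F]
    simp only [integral_smul]
    rw [integral_smul_const, gd_integral, one_smul]
  have hI2 : ∫ p, vnEnt (F p) ∂(volume.prod volume) = H (fq q σ) 0 + clEnt (gaussDensity n) := by
    simp only [hEe]
    rw [integral_add hE1 hE2, integral_prod_mul (fun x => vnEnt (fq q σ x)) (gaussDensity n),
      integral_prod_mul q (fun z => negMulLog (gaussDensity n z)), gd_integral, h.2.2.1]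
    unfold H clEnt
    rw [P_zero, mul_one, one_mul, ← integral_neg]
    simp [negMulLog]
  rw [condEnt_gen]
  · simp only [hpF]
    rw [Measure.volume_eq_prod, shear_integral c (sm_vnEnt hFm hFp), shear_integral c hFm, hI1, hI2]
  · intro p; exact (h.2.2.2.2 _).1.1
  · intro p _; simp [noisyState, (h.2.2.2.2 _).2]
  · simp only [hpF]; exact shear_integrable c hFi
  · exact shear_integrable c hlogi
  · simp only [hpF]; exact shear_integrable c hEi

lemma noisyMI_eq (h : IsCQState q σ) (hX2 : Integrable fun x : En n => ‖x‖ ^ 2 * q x)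
    (hfin : EntFinite q σ) {t : ℝ} (ht : 0 ≤ t) :
    noisyMI (√t) q σ = heatEnt q σ t - heatEnt q σ 0 := by
  unfold noisyMI condMI
  rw [cond_snd h, cond_joint h hfin, heatEnt_eq h hX2 hfin le_rfl]
  change heatEnt q σ t + _ - _ = _
  ring

lemma limit_aux {h : ℝ → ℝ} (hmono : ∀ t s, 0 < t → 0 < s → h t ≤ h (t + s))
    (hsub : ∀ t s, 0 < t → 0 < s → h (t + s) ≤ h t + h s) :
    ∃ L : EReal, Tendsto (fun t : ℝ => ((h t / t : ℝ) : EReal)) (𝓝[>] 0) (𝓝 L) := by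
  have h0 : ∀ t, 0 < t → 0 ≤ h t := fun t ht => by
    have := hmono t t ht ht
    have := hsub t t ht ht
    linarith
  have hm : ∀ (m : ℕ) t, 0 < t → h ((m + 1 : ℕ) * t) ≤ (m + 1 : ℕ) * h t := by
    intro m t ht
    induction m with
    | zero => simp
    | succ k ih =>
      have := hsub ((k + 1 : ℕ) * t) t (by positivity) ht
      have e : ((k + 1 + 1 : ℕ) : ℝ) * t = (k + 1 : ℕ) * t + t := by push_cast; ring
      rw [e]
      push_cast at *
      linarith
  have key : ∀ T t, 0 < T → 0 < t → h T / (T + t) ≤ h t / t := by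
    intro T t hT ht
    set m := ⌊T / t⌋₊
    have h1 : T / t < m + 1 := Nat.lt_floor_add_one _
    have h2 : (m : ℝ) ≤ T / t := Nat.floor_le (by positivity)
    rw [div_lt_iff₀ ht] at h1
    rw [le_div_iff₀ ht] at h2
    have h3 := hmono T ((m + 1) * t - T) hT (by linarith)
    have h4 := hm m t ht
    push_cast at h4
    rw [show T + ((m + 1) * t - T) = (m + 1) * t by ring] at h3
    rw [div_le_div_iff₀ (by positivity) ht]
    have h5 := h0 t ht
    nlinarith
  refine ⟨⨆ T : {T : ℝ // 0 < T}, ((h T / T : ℝ) : EReal), ?_⟩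
  refine tendsto_order.2 ⟨fun a ha => ?_, fun a ha => ?_⟩
  · obtain ⟨⟨T, hT⟩, hTa⟩ := lt_iSup_iff.1 ha
    have hlim : Tendsto (fun t : ℝ => ((h T / (T + t) : ℝ) : EReal)) (𝓝[>] 0)
        (𝓝 ((h T / T : ℝ) : EReal)) := by
      refine (continuous_coe_real_ereal.tendsto _).comp ?_
      have : ContinuousAt (fun t : ℝ => h T / (T + t)) 0 := by
        refine ContinuousAt.div (by fun_prop) (by fun_prop) (by simp [hT.ne'])
      have := this.tendsto
      simp only [add_zero] at this
      exact this.mono_left nhdsWithin_le_nhds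
    filter_upwards [hlim.eventually (lt_mem_nhds hTa), self_mem_nhdsWithin] with t h1 h2
    exact h1.trans_le (EReal.coe_le_coe_iff.2 (key T t hT h2))
  · filter_upwards [self_mem_nhdsWithin] with t ht
    exact (le_iSup (fun T : {T : ℝ // 0 < T} => ((h T / T : ℝ) : EReal)) ⟨t, ht⟩).trans_lt ha

end CQ

lemma final {n d : ℕ}
    (q : En n → ℝ) (σ : En n → Matrix (Fin d) (Fin d) ℂ)
    (hcq : IsCQState q σ)
    (hX2 : Integrable fun x : En n => ‖x‖ ^ 2 * q x)
    (hfin : EntFinite q σ) :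
    Tendsto (fun t : ℝ => (((heatEnt q σ t - heatEnt q σ 0) / t : ℝ) : EReal))
      (𝓝[>] 0) (𝓝 (condFisher q σ)) := by
  have h2 : Integrable fun x : En n => ‖x‖ ^ 2 * (fq q σ x).trace.re := by simpa only [fq_tr hcq]
  have hl : Integrable fun x : En n => (fq q σ x).trace.re * Real.log (fq q σ x).trace.re := by
    simpa only [fq_tr hcq] using hfin.1
  obtain ⟨L, hL⟩ := limit_aux (h := fun t => heatEnt q σ t - heatEnt q σ 0)
    (by
      intro t s ht hs
      simp only [heatEnt_eq hcq hX2 hfin ht.le, heatEnt_eq hcq hX2 hfin (add_pos ht hs).le]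
      have := H_mono (fq_sm hcq) (fq_int hcq) (fq_psd hcq) h2 hl ht hs
      linarith)
    (by
      intro t s ht hs
      simp only [heatEnt_eq hcq hX2 hfin ht.le, heatEnt_eq hcq hX2 hfin hs.le,
        heatEnt_eq hcq hX2 hfin le_rfl, heatEnt_eq hcq hX2 hfin (add_pos ht hs).le]
      have := H_sub (fq_sm hcq) (fq_int hcq) (fq_psd hcq) h2 hl ht hs
      linarith)
  have e : (fun t : ℝ => ((fisherSlope q σ t : ℝ) : EReal)) =ᶠ[𝓝[>] 0]
      fun t : ℝ => (((heatEnt q σ t - heatEnt q σ 0) / t : ℝ) : EReal) := by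
    filter_upwards [self_mem_nhdsWithin] with t ht
    unfold fisherSlope
    rw [noisyMI_eq hcq hX2 hfin (le_of_lt ht)]
  have : condFisher q σ = L := (hL.congr' e.symm).limsup_eq
  rw [this]
  exact hL

end QD

/-- The de Bruijn identity with quantum conditioning: the right difference quotient of
`t ↦ S(X + √t Z | M)` at `t = 0` converges (in the extended reals, so the right derivative
exists, finite or `+∞`) to the conditional Fisher information `J(X|M)`. -/
theorem de_bruijn_identity_quantum_conditioning {n d : ℕ}
    (q : En n → ℝ) (σ : En n → Matrix (Fin d) (Fin d) ℂ)
    (hcq : IsCQState q σ)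
    (hX2 : Integrable fun x : En n => ‖x‖ ^ 2 * q x)
    (hfin : EntFinite q σ) :
    Tendsto (fun t : ℝ => (((heatEnt q σ t - heatEnt q σ 0) / t : ℝ) : EReal))
      (𝓝[>] 0) (𝓝 (condFisher q σ)) := by
  exact QD.final q σ hcq hX2 hfin

end
end
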